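/- Let d ∈ ℕ, d ≥ 1, let θ > 0, and let ρ₀ ∈ L¹(ℝ^d) with ρ₀ ≥ 0. If ‖ρ₀‖_{L¹(ℝ^d)} is small enough (depending on d and θ), then for every T > 0 one has sup_{t∈(0,T]} t^{(d/2)(1−1/q)} ‖G(·,t) ∗ ρ₀‖_{L^q(ℝ^d)} ≤ θ for all 1 ≤ q ≤ ∞; in particular, if θ is the small constant from the local existence theorem, there exists a unique global mild solution of the mPKS equations with initial datum ρ₀. -/

import Mathlib

open MeasureTheory Real Filter
open scoped ENNReal BigOperators Topology

noncomputable section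

abbrev Euc (d : ℕ) : Type := EuclideanSpace ℝ (Fin d)

/-- The heat kernel on `ℝ^d`. -/
noncomputable def heatKernel (d : ℕ) (t : ℝ) (x : Euc d) : ℝ :=
  (4 * Real.pi * t) ^ (-(d : ℝ) / 2) * Real.exp (-‖x‖ ^ 2 / (4 * t))

/-- Partial derivative in the `i`-th coordinate direction. -/
noncomputable def pd {d : ℕ} {F : Type*} [NormedAddCommGroup F] [NormedSpace ℝ F]
    (i : Fin d) (f : Euc d → F) : Euc d → F :=
  fun x => fderiv ℝ f x (EuclideanSpace.single i 1)

/-- Multi-index spatial derivative `D_x^β`. -/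
noncomputable def mderiv {d : ℕ} {F : Type*} [NormedAddCommGroup F] [NormedSpace ℝ F]
    (β : Fin d → ℕ) (f : Euc d → F) : Euc d → F :=
  (List.finRange d).foldr (fun i g => (pd i)^[β i] g) f

/-- `k`-th time derivative (pointwise in space). -/
noncomputable def tderiv {d : ℕ} {F : Type*} [NormedAddCommGroup F] [NormedSpace ℝ F]
    (k : ℕ) (ρ : ℝ → Euc d → F) (t : ℝ) : Euc d → F :=
  fun x => iteratedDeriv k (fun s => ρ s x) t

/-- Convolution of two scalar functions on `ℝ^d`. -/
noncomputable def conv {d : ℕ} (f g : Euc d → ℝ) : Euc d → ℝ :=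
  fun x => ∫ y, f (x - y) * g y

/-- Convolution of a vector field with a scalar function on `ℝ^d`. -/
noncomputable def convV {d : ℕ} (f : Euc d → Euc d) (g : Euc d → ℝ) : Euc d → Euc d :=
  fun x => ∫ y, g y • f (x - y)

/-- Gradient of the heat kernel. -/
noncomputable def gradHeat (d : ℕ) (t : ℝ) : Euc d → Euc d :=
  gradient (fun x => heatKernel d t x)

/-- Gradient of the logarithmic potential `c` generated by `ρ`. -/
noncomputable def gradc (d : ℕ) (ρ : Euc d → ℝ) (x : Euc d) : Euc d :=
  (-(1 / (d * Real.pi))) • ∫ y, (ρ y / ‖x - y‖ ^ 2) • (x - y)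

/-- `|β|` for a multi-index. -/
def msize {d : ℕ} (β : Fin d → ℕ) : ℕ := ∑ i, β i

/-- The exponent `2d/(2d-1)` as an element of `ℝ≥0∞`. -/
noncomputable def qd (d : ℕ) : ℝ≥0∞ := (2 * d : ℝ≥0∞) / (2 * d - 1 : ℝ≥0∞)

/-- Right-hand side of the Duhamel formula for the mPKS equations. -/
noncomputable def mildRHS (d : ℕ) (ρ₀ : Euc d → ℝ) (ρ : ℝ → Euc d → ℝ) (t : ℝ) (x : Euc d) : ℝ :=
  conv (heatKernel d t) ρ₀ x -
    ∫ s in Set.Ioc (0:ℝ) t,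
      ∫ y, (inner ℝ (gradHeat d (t - s) (x - y)) (ρ s y • gradc d (ρ s) y) : ℝ)

/-- Mild solution of the mPKS equations on `[0,T]`. -/
def IsMildSolution (d : ℕ) (ρ₀ : Euc d → ℝ) (T : ℝ) (ρ : ℝ → Euc d → ℝ) : Prop :=
  ∀ t ∈ Set.Ioc (0:ℝ) T, ∀ x, ρ t x = mildRHS d ρ₀ ρ t x

/-- Membership in the space `X_T`. -/
def MemXT (d : ℕ) (T : ℝ) (ρ : ℝ → Euc d → ℝ) : Prop :=
  (∀ t ∈ Set.Ioc (0:ℝ) T, MemLp (ρ t) 1 volume) ∧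
  (∀ t ∈ Set.Ioc (0:ℝ) T,
    Filter.Tendsto (fun s => eLpNorm (fun x => ρ s x - ρ t x) 1 volume)
      (nhdsWithin t (Set.Ioc (0:ℝ) T)) (nhds 0)) ∧
  (∃ C : ℝ≥0∞, C ≠ ⊤ ∧ ∀ t ∈ Set.Ioc (0:ℝ) T, eLpNorm (ρ t) 1 volume ≤ C) ∧
  (∃ C : ℝ≥0∞, C ≠ ⊤ ∧ ∀ t ∈ Set.Ioc (0:ℝ) T,
    ENNReal.ofReal (t ^ (1/4 : ℝ)) * eLpNorm (ρ t) (qd d) volume ≤ C)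

/-- Assumption (𝒜): decay of the heat semigroup applied to `ρ₀`. -/
def AssumptionA (d : ℕ) (ρ₀ : Euc d → ℝ) (T θ : ℝ) : Prop :=
  ∀ q : ℝ≥0∞, 1 ≤ q → ∀ t ∈ Set.Ioc (0:ℝ) T,
    ENNReal.ofReal (t ^ (((d : ℝ) / 2) * (1 - q⁻¹.toReal))) *
      eLpNorm (conv (heatKernel d t) ρ₀) q volume ≤ ENNReal.ofReal θ



theorem hk_pos {d : ℕ} {t : ℝ} (ht : 0 < t) (x : Euc d) : 0 < heatKernel d t x := by
  unfold heatKernel; positivity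

theorem hk_neg {d : ℕ} (t : ℝ) (x : Euc d) : heatKernel d t (-x) = heatKernel d t x := by
  simp [heatKernel]

theorem hk_sub_comm {d : ℕ} (t : ℝ) (x y : Euc d) :
    heatKernel d t (x - y) = heatKernel d t (y - x) := by
  rw [← neg_sub, hk_neg]

@[fun_prop]
theorem hk_meas (d : ℕ) : Measurable (fun z : ℝ × Euc d => heatKernel d z.1 z.2) := by
  unfold heatKernel; fun_prop

@[fun_prop]
theorem hk_meas2 {d : ℕ} {α : Type*} [MeasurableSpace α] {f : α → ℝ} {g : α → Euc d}
    (hf : Measurable f) (hg : Measurable g) : Measurable (fun a => heatKernel d (f a) (g a)) :=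
  (hk_meas d).comp (hf.prodMk hg)

theorem hk_cont {d : ℕ} (t : ℝ) : Continuous (heatKernel d t) := by
  unfold heatKernel; fun_prop

theorem hk_le {d : ℕ} {t : ℝ} (ht : 0 < t) (x : Euc d) :
    heatKernel d t x ≤ (4 * π * t) ^ (-(d : ℝ) / 2) := by
  unfold heatKernel
  refine mul_le_of_le_one_right (by positivity) ?_
  rw [Real.exp_le_one_iff, neg_div]
  have : 0 ≤ ‖x‖ ^ 2 / (4 * t) := by positivity
  linarith

theorem hk_integral {d : ℕ} {t : ℝ} (ht : 0 < t) : ∫ x, heatKernel d t x = 1 := by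
  unfold heatKernel
  rw [integral_const_mul]
  have h := GaussianFourier.integral_rexp_neg_mul_sq_norm (V := Euc d) (b := 1 / (4 * t))
    (by positivity)
  have e : (fun v : Euc d => rexp (-(1 / (4 * t)) * ‖v‖ ^ 2)) =
      fun v => rexp (-‖v‖ ^ 2 / (4 * t)) := by
    ext v; congr 1; ring
  rw [e] at h
  rw [h, finrank_euclideanSpace_fin, show π / (1 / (4 * t)) = 4 * π * t by field_simp,
    ← Real.rpow_add (by positivity)]
  rw [show -(d : ℝ) / 2 + d / 2 = 0 by ring, Real.rpow_zero]

theorem hk_integrable {d : ℕ} {t : ℝ} (ht : 0 < t) : Integrable (heatKernel d t) := by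
  by_contra h
  have := hk_integral (d := d) ht
  rw [integral_undef h] at this
  exact zero_ne_one this

theorem hk_lintegral {d : ℕ} {t : ℝ} (ht : 0 < t) :
    ∫⁻ x, ENNReal.ofReal (heatKernel d t x) = 1 := by
  rw [← ofReal_integral_eq_lintegral_ofReal (hk_integrable ht)
    (Eventually.of_forall fun x => (hk_pos ht x).le), hk_integral ht, ENNReal.ofReal_one]

theorem gradHeat_eq {d : ℕ} (t : ℝ) (x : Euc d) :
    gradHeat d t x = (-(1 / (2 * t)) * heatKernel d t x) • x := by
  unfold gradHeat
  apply HasGradientAt.gradient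
  rw [hasGradientAt_iff_hasFDerivAt]
  have h1 : HasFDerivAt (fun x : Euc d => ‖x‖ ^ 2) (2 • (innerSL ℝ x)) x :=
    (hasStrictFDerivAt_norm_sq x).hasFDerivAt
  have h2 : HasFDerivAt (fun x : Euc d => -‖x‖ ^ 2 / (4 * t))
      ((4 * t)⁻¹ • (-(2 • (innerSL ℝ x)) : Euc d →L[ℝ] ℝ)) x := by
    simp only [div_eq_inv_mul]
    exact h1.neg.const_mul (4 * t)⁻¹
  have h3 := (h2.exp).const_mul ((4 * π * t) ^ (-(d : ℝ) / 2))
  refine h3.congr_fderiv ?_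
  ext y
  simp [heatKernel, real_inner_smul_left]
  rcases eq_or_ne t 0 with rfl | ht
  · simp
  · field_simp; ring

@[fun_prop]
theorem gradHeat_meas2 {d : ℕ} {α : Type*} [MeasurableSpace α] {f : α → ℝ} {g : α → Euc d}
    (hf : Measurable f) (hg : Measurable g) : Measurable (fun a => gradHeat d (f a) (g a)) := by
  simp only [gradHeat_eq]; fun_prop

theorem hk_hasGrad {d : ℕ} (t : ℝ) (x : Euc d) :
    HasFDerivAt (heatKernel d t) (innerSL ℝ (gradHeat d t x)) x := by
  have hd : DifferentiableAt ℝ (heatKernel d t) x := by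
    unfold heatKernel
    have : DifferentiableAt ℝ (fun x : Euc d => ‖x‖ ^ 2) x :=
      (hasStrictFDerivAt_norm_sq x).hasFDerivAt.differentiableAt
    fun_prop
  have := hd.hasGradientAt
  rw [hasGradientAt_iff_hasFDerivAt] at this
  exact this

/-- dimension constant -/
def c0 (d : ℕ) : ℝ := 2 ^ ((d : ℝ) / 2)

theorem c0_pos (d : ℕ) : 0 < c0 d := by unfold c0; positivity

theorem gradHeat_norm_le {d : ℕ} {t : ℝ} (ht : 0 < t) (x : Euc d) :
    ‖gradHeat d t x‖ ≤ c0 d * t ^ (-(1 / 2 : ℝ)) * heatKernel d (2 * t) x := by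
  rw [gradHeat_eq, norm_smul, norm_mul, norm_neg, Real.norm_of_nonneg (hk_pos ht x).le,
    Real.norm_of_nonneg (by positivity)]
  unfold heatKernel c0
  have e1 : (4 * π * (2 * t)) ^ (-(d : ℝ) / 2) = 2 ^ (-((d : ℝ) / 2)) * (4 * π * t) ^ (-(d : ℝ) / 2) := by
    rw [show 4 * π * (2 * t) = 2 * (4 * π * t) by ring,
      Real.mul_rpow (by norm_num) (by positivity), neg_div]
  have e2 : rexp (-‖x‖ ^ 2 / (4 * t)) =
      rexp (-‖x‖ ^ 2 / (4 * (2 * t))) * rexp (-‖x‖ ^ 2 / (8 * t)) := by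
    rw [← Real.exp_add]; congr 1; field_simp; ring
  have hs : 0 < √t := Real.sqrt_pos.2 ht
  have hst : √t ^ 2 = t := Real.sq_sqrt ht.le
  have e3 : t ^ (-(1 / 2 : ℝ)) = 1 / √t := by
    rw [Real.rpow_neg ht.le, ← Real.sqrt_eq_rpow, one_div]
  have key : 1 / (2 * t) * rexp (-‖x‖ ^ 2 / (8 * t)) * ‖x‖ ≤ 1 / √t := by
    have h1 : ‖x‖ / (2 * √t) ≤ rexp (‖x‖ ^ 2 / (8 * t)) := by
      have := Real.add_one_le_exp (‖x‖ ^ 2 / (8 * t))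
      refine le_trans ?_ this
      set u := ‖x‖ / √t with hu
      have : ‖x‖ ^ 2 / (8 * t) = u ^ 2 / 8 := by rw [hu, div_pow, hst]; field_simp
      rw [this, show ‖x‖ / (2 * √t) = u / 2 by rw [hu]; field_simp]
      nlinarith [sq_nonneg (u - 2)]
    have h2 : rexp (-‖x‖ ^ 2 / (8 * t)) = (rexp (‖x‖ ^ 2 / (8 * t)))⁻¹ := by
      rw [← Real.exp_neg]; congr 1; ring
    rw [h2]
    have hp := Real.exp_pos (‖x‖ ^ 2 / (8 * t))
    rw [div_le_iff₀ (by positivity)] at h1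
    rw [← hst, hst, mul_assoc, inv_mul_eq_div, div_mul_div_comm, one_mul, div_le_div_iff₀ (by positivity) hs]
    have : ‖x‖ * √t ≤ rexp (‖x‖ ^ 2 / (8 * t)) * (2 * √t) * √t := by gcongr
    nlinarith
  rw [e1, e3, e2]
  have hc : (2:ℝ) ^ ((d : ℝ) / 2) * 2 ^ (-((d : ℝ) / 2)) = 1 := by
    rw [← Real.rpow_add (by norm_num)]; simp
  calc _ = (4 * π * t) ^ (-(d : ℝ) / 2) * rexp (-‖x‖ ^ 2 / (4 * (2 * t))) *
        (1 / (2 * t) * rexp (-‖x‖ ^ 2 / (8 * t)) * ‖x‖) := by ring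
    _ ≤ (4 * π * t) ^ (-(d : ℝ) / 2) * rexp (-‖x‖ ^ 2 / (4 * (2 * t))) * (1 / √t) := by
        gcongr
    _ = (2 ^ ((d : ℝ) / 2) * 2 ^ (-((d : ℝ) / 2))) * (1 / √t *
        ((4 * π * t) ^ (-(d : ℝ) / 2) * rexp (-‖x‖ ^ 2 / (4 * (2 * t))))) := by rw [hc]; ring
    _ = _ := by ring

theorem hk_mul {d : ℕ} {s t : ℝ} (hs : 0 < s) (ht : 0 < t) (x z : Euc d) :
    heatKernel d s (x - z) * heatKernel d t z =
      heatKernel d (s + t) x * heatKernel d (s * t / (s + t)) (z - (t / (s + t)) • x) := by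
  have hst : 0 < s + t := by positivity
  unfold heatKernel
  have e1 : (4 * π * s) ^ (-(d : ℝ) / 2) * (4 * π * t) ^ (-(d : ℝ) / 2) =
      (4 * π * (s + t)) ^ (-(d : ℝ) / 2) * (4 * π * (s * t / (s + t))) ^ (-(d : ℝ) / 2) := by
    rw [← Real.mul_rpow (by positivity) (by positivity),
      ← Real.mul_rpow (by positivity) (by positivity)]
    congr 1; field_simp
  have e2 : rexp (-‖x - z‖ ^ 2 / (4 * s)) * rexp (-‖z‖ ^ 2 / (4 * t)) =
      rexp (-‖x‖ ^ 2 / (4 * (s + t))) *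
        rexp (-‖z - (t / (s + t)) • x‖ ^ 2 / (4 * (s * t / (s + t)))) := by
    rw [← Real.exp_add, ← Real.exp_add]
    congr 1
    rw [norm_sub_sq_real, norm_sub_sq_real, inner_smul_right, norm_smul, real_inner_comm,
      Real.norm_of_nonneg (by positivity)]
    field_simp
    ring
  calc _ = ((4 * π * s) ^ (-(d : ℝ) / 2) * (4 * π * t) ^ (-(d : ℝ) / 2)) *
        (rexp (-‖x - z‖ ^ 2 / (4 * s)) * rexp (-‖z‖ ^ 2 / (4 * t))) := by ring
    _ = _ := by rw [e1, e2]; ring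

theorem hk_semi {d : ℕ} {s t : ℝ} (hs : 0 < s) (ht : 0 < t) (x : Euc d) :
    ∫ z, heatKernel d s (x - z) * heatKernel d t z = heatKernel d (s + t) x := by
  simp_rw [hk_mul hs ht]
  rw [integral_const_mul, integral_sub_right_eq_self (heatKernel d _), hk_integral (by positivity),
    mul_one]

theorem hk_semi_lint {d : ℕ} {s t : ℝ} (hs : 0 < s) (ht : 0 < t) (x : Euc d) :
    ∫⁻ z, ENNReal.ofReal (heatKernel d s (x - z)) * ENNReal.ofReal (heatKernel d t z) =
      ENNReal.ofReal (heatKernel d (s + t) x) := by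
  simp_rw [← ENNReal.ofReal_mul (hk_pos hs _).le, hk_mul hs ht]
  simp_rw [ENNReal.ofReal_mul (hk_pos (show 0 < s + t by positivity) _).le]
  rw [lintegral_const_mul _ (by fun_prop),
    lintegral_sub_right_eq_self (fun z => ENNReal.ofReal (heatKernel d _ z)),
    hk_lintegral (by positivity), mul_one]

theorem gradHeat_lint {d : ℕ} {t : ℝ} (ht : 0 < t) :
    ∫⁻ x, ‖gradHeat d t x‖ₑ ≤ ENNReal.ofReal (c0 d * t ^ (-(1 / 2 : ℝ))) := by
  have hc := c0_pos d
  calc ∫⁻ x, ‖gradHeat d t x‖ₑ ≤ ∫⁻ x, ENNReal.ofReal (c0 d * t ^ (-(1 / 2 : ℝ))) *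
        ENNReal.ofReal (heatKernel d (2 * t) x) := by
        apply lintegral_mono; intro x
        dsimp only
        rw [← ENNReal.ofReal_mul (by positivity), ← ofReal_norm]
        exact ENNReal.ofReal_le_ofReal (gradHeat_norm_le ht x)
    _ = _ := by
        rw [lintegral_const_mul _ (by fun_prop), hk_lintegral (by positivity), mul_one]

theorem gradHeat_neg {d : ℕ} (t : ℝ) (x : Euc d) : gradHeat d t (-x) = - gradHeat d t x := by
  simp [gradHeat_eq, hk_neg]

theorem gradHeat_integrable {d : ℕ} {t : ℝ} (ht : 0 < t) : Integrable (gradHeat d t) :=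
  ⟨(by fun_prop : Measurable (gradHeat d t)).aestronglyMeasurable,
    (gradHeat_lint ht).trans_lt ENNReal.ofReal_lt_top⟩

theorem gradHeat_semi {d : ℕ} {s t : ℝ} (hs : 0 < s) (ht : 0 < t) (x : Euc d) :
    ∫ z, heatKernel d s (x - z) • gradHeat d t z = gradHeat d (s + t) x := by
  have hr : 0 < s * t / (s + t) := by positivity
  set m := (t / (s + t)) • x with hm
  set r := s * t / (s + t) with hrd
  have h0 : ∀ z, heatKernel d s (x - z) • gradHeat d t z =
      (-(1 / (2 * t)) * heatKernel d (s + t) x) • (heatKernel d r (z - m) • z) := by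
    intro z
    rw [gradHeat_eq, smul_smul, smul_smul]
    congr 1
    have := hk_mul hs ht x z
    linear_combination (-(1 / (2 * t))) * this
  simp_rw [h0]
  rw [integral_smul]
  have hi : Integrable (fun z : Euc d => heatKernel d r z • z) := by
    have := (gradHeat_integrable (d := d) hr).smul (-(2 * r))
    refine this.congr (Eventually.of_forall fun z => ?_)
    simp only [Pi.smul_apply, gradHeat_eq, smul_smul]; congr 1; field_simp
  have h1 : ∫ z, heatKernel d r (z - m) • z = ∫ z, heatKernel d r z • (z + m) := by
    rw [← integral_sub_right_eq_self (fun z => heatKernel d r z • (z + m)) m]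
    simp
  have h2 : ∫ z : Euc d, heatKernel d r z • z = 0 := by
    have := integral_neg_eq_self (fun z : Euc d => heatKernel d r z • z) volume
    simp only [hk_neg, smul_neg, integral_neg] at this
    have h3 := eq_neg_iff_add_eq_zero.1 this.symm
    rw [← two_smul ℝ] at h3
    exact (smul_eq_zero.1 h3).resolve_left two_ne_zero
  rw [h1]
  simp_rw [smul_add]
  rw [integral_add hi ((hk_integrable hr).smul_const _), h2, integral_smul_const, hk_integral hr,
    zero_add, one_smul, gradHeat_eq, hm, smul_smul]
  congr 1
  field_simp

theorem hk_girs {d : ℕ} {h : ℝ} (hh : 0 < h) (z a : Euc d) :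
    heatKernel d h z ^ 2 =
      heatKernel d h (z - a) * heatKernel d h (z + a) * rexp (‖a‖ ^ 2 / (2 * h)) := by
  unfold heatKernel
  have : rexp (-‖z‖ ^ 2 / (4 * h)) ^ 2 = rexp (-‖z - a‖ ^ 2 / (4 * h)) *
      rexp (-‖z + a‖ ^ 2 / (4 * h)) * rexp (‖a‖ ^ 2 / (2 * h)) := by
    rw [← Real.exp_nat_mul, ← Real.exp_add, ← Real.exp_add]
    congr 1
    rw [norm_sub_sq_real, norm_add_sq_real]
    field_simp; push_cast; ring
  rw [mul_pow, this]; ring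

/-- `hk (x - a) - hk x` as an integral -/
theorem hk_shift_eq {d : ℕ} (t : ℝ) (x a : Euc d) :
    heatKernel d t (x - a) - heatKernel d t x =
      ∫ r in (0:ℝ)..1, -(inner ℝ (gradHeat d t (x - r • a)) a : ℝ) := by
  have hder : ∀ r : ℝ, HasDerivAt (fun r : ℝ => heatKernel d t (x - r • a))
      (-(inner ℝ (gradHeat d t (x - r • a)) a : ℝ)) r := by
    intro r
    have h1 : HasDerivAt (fun r : ℝ => x - r • a) (-a) r := by
      simpa using ((hasDerivAt_id r).smul_const a).const_sub x
    have := (hk_hasGrad t (x - r • a)).comp_hasDerivAt r h1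
    refine this.congr_deriv ?_
    simp
  have hc : Continuous fun r : ℝ => -(inner ℝ (gradHeat d t (x - r • a)) a : ℝ) := by
    simp only [gradHeat_eq]
    have := hk_cont (d := d) t
    fun_prop
  rw [intervalIntegral.integral_eq_sub_of_hasDerivAt (fun r _ => hder r)
    (hc.intervalIntegrable _ _)]
  simp

theorem hk_shift_lint {d : ℕ} {t : ℝ} (ht : 0 < t) (a : Euc d) :
    ∫⁻ x, ‖heatKernel d t (x - a) - heatKernel d t x‖ₑ ≤
      ENNReal.ofReal (c0 d * t ^ (-(1 / 2 : ℝ))) * ‖a‖ₑ := by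
  calc _ ≤ ∫⁻ x, ∫⁻ r in Set.Ioc (0:ℝ) 1, ‖gradHeat d t (x - r • a)‖ₑ * ‖a‖ₑ := by
        apply lintegral_mono; intro x
        dsimp only
        rw [hk_shift_eq, intervalIntegral.integral_of_le zero_le_one]
        refine (enorm_integral_le_lintegral_enorm _).trans (lintegral_mono fun r => ?_)
        dsimp only
        rw [enorm_neg]
        simp only [← ofReal_norm]
        rw [← ENNReal.ofReal_mul (norm_nonneg _)]
        exact ENNReal.ofReal_le_ofReal (norm_inner_le_norm _ _)
    _ = ∫⁻ r in Set.Ioc (0:ℝ) 1, ∫⁻ x, ‖gradHeat d t (x - r • a)‖ₑ * ‖a‖ₑ := by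
        rw [lintegral_lintegral_swap]
        apply Measurable.aemeasurable
        unfold Function.uncurry
        fun_prop
    _ ≤ ∫⁻ r in Set.Ioc (0:ℝ) 1, ENNReal.ofReal (c0 d * t ^ (-(1 / 2 : ℝ))) * ‖a‖ₑ := by
        apply lintegral_mono; intro r
        dsimp only
        rw [lintegral_mul_const _ (by fun_prop),
          lintegral_sub_right_eq_self (fun x => ‖gradHeat d t x‖ₑ)]
        gcongr
        exact gradHeat_lint ht
    _ = _ := by simp



/-- interpolation between sup and L1 -/
theorem int_interp {α : Type*} [MeasurableSpace α] {μ : Measure α} {r : ℝ} (hr : 1 ≤ r)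
    {f : α → ℝ≥0∞} {A B : ℝ≥0∞} (hB : ∀ x, f x ≤ B)
    (hA : ∫⁻ x, f x ∂μ ≤ A) :
    (∫⁻ x, f x ^ r ∂μ) ≤ B ^ (r - 1) * A := by
  by_cases hBt : B ^ (r - 1) = ⊤
  · rcases eq_or_ne A 0 with h0 | h0
    · subst h0
      have hz : ∫⁻ x, f x ∂μ = 0 := le_antisymm hA bot_le
      obtain ⟨g, hg, hfg, hgi⟩ := exists_measurable_le_lintegral_eq μ (fun x => f x ^ r)
      have : g =ᵐ[μ] 0 := by
        have h1 : ∫⁻ x, g x ^ (1 / r) ∂μ = 0 := by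
          refine le_antisymm ((lintegral_mono fun x => ?_).trans hz.le) bot_le
          calc g x ^ (1 / r) ≤ (f x ^ r) ^ (1 / r) :=
                ENNReal.rpow_le_rpow (hfg x) (by positivity)
            _ = f x := by rw [← ENNReal.rpow_mul, mul_one_div_cancel (by positivity), ENNReal.rpow_one]
        rw [lintegral_eq_zero_iff (by fun_prop)] at h1
        filter_upwards [h1] with x hx
        simpa [show 0 < r by linarith, not_lt.2 (show (0:ℝ) ≤ r by linarith)] using hx
      rw [hgi, lintegral_congr_ae this]; simp
    · rw [hBt, ENNReal.top_mul h0]; exact le_top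
  calc ∫⁻ x, f x ^ r ∂μ ≤ ∫⁻ x, B ^ (r - 1) * f x ∂μ := by
        refine lintegral_mono fun x => ?_
        have : f x ^ r = f x ^ (r - 1) * f x := by
          conv_lhs => rw [show r = (r - 1) + 1 by ring]
          rw [ENNReal.rpow_add_of_nonneg _ _ (by linarith) zero_le_one, ENNReal.rpow_one]
        rw [this]
        gcongr
        exact hB x
    _ = B ^ (r - 1) * ∫⁻ x, f x ∂μ := lintegral_const_mul' _ _ hBt
    _ ≤ _ := by gcongr

/-- Minkowski's integral inequality, specialised -/
theorem mink {α β : Type*} [MeasurableSpace α] [MeasurableSpace β] {μ : Measure α} [SFinite μ]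
    {ν : Measure β} [SFinite ν] {r : ℝ} (hr : 1 < r) {k : α → β → ℝ≥0∞}
    (hk : Measurable (Function.uncurry k)) {φ : α → ℝ≥0∞} (hφ : Measurable φ)
    {a : α → ℝ≥0∞} (ha : Measurable a)
    (h : ∀ᵐ z ∂μ, a z ≠ 0 ∧ a z ≠ ⊤ ∧ ∫⁻ x, k z x ^ r ∂ν ≤ a z ^ r) :
    (∫⁻ x, (∫⁻ z, k z x * φ z ∂μ) ^ r ∂ν) ≤ (∫⁻ z, a z * φ z ∂μ) ^ r := by
  have hk1 : ∀ x, Measurable (fun z => k z x) := fun x => hk.comp measurable_prodMk_right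
  have hk2 : ∀ z, Measurable (k z) := fun z => hk.comp measurable_prodMk_left
  have hr0 : 0 < r := by linarith
  set I := ∫⁻ z, a z * φ z ∂μ with hI
  have hpq : r.HolderConjugate (Real.conjExponent r) := Real.HolderConjugate.conjExponent hr
  set r' := Real.conjExponent r with hr'
  have hr'0 : 0 < r' := hpq.symm.pos
  have hrr : r / r' = r - 1 := by
    have := hpq.sub_one_mul_conj
    field_simp; linarith
  have hsum : 1 / r + 1 / r' = 1 := by simpa [one_div] using hpq.inv_add_inv_eq_one
  have step : ∀ x, (∫⁻ z, k z x * φ z ∂μ) ^ r ≤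
      (∫⁻ z, k z x ^ r * (a z ^ (-(r - 1)) * φ z) ∂μ) * I ^ (r - 1) := by
    intro x
    have h1 : ∫⁻ z, k z x * φ z ∂μ = ∫⁻ z, ((fun z => k z x * a z ^ (-(1 / r')) * φ z ^ (1 / r)) *
        (fun z => a z ^ (1 / r') * φ z ^ (1 / r'))) z ∂μ := by
      refine lintegral_congr_ae ?_
      filter_upwards [h] with z ⟨h0, ht, _⟩
      simp only [Pi.mul_apply]
      have e1 : a z ^ (-(1 / r')) * a z ^ (1 / r') = 1 := by
        rw [← ENNReal.rpow_add _ _ h0 ht]; simp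
      have e2 : φ z ^ (1 / r) * φ z ^ (1 / r') = φ z := by
        rw [← ENNReal.rpow_add_of_nonneg _ _ (by positivity) (by positivity), hsum, ENNReal.rpow_one]
      calc k z x * φ z = k z x * (a z ^ (-(1 / r')) * a z ^ (1 / r')) *
            (φ z ^ (1 / r) * φ z ^ (1 / r')) := by rw [e1, e2, mul_one]
        _ = _ := by ring
    have h2 := ENNReal.lintegral_mul_le_Lp_mul_Lq μ hpq
      (f := fun z => k z x * a z ^ (-(1 / r')) * φ z ^ (1 / r))
      (g := fun z => a z ^ (1 / r') * φ z ^ (1 / r')) (by have := hk1 x; fun_prop) (by fun_prop)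
    rw [h1]
    refine (ENNReal.rpow_le_rpow h2 hr0.le).trans ?_
    rw [ENNReal.mul_rpow_of_nonneg _ _ hr0.le, ← ENNReal.rpow_mul, ← ENNReal.rpow_mul,
      one_div_mul_cancel hr0.ne', ENNReal.rpow_one, show 1 / r' * r = r - 1 by rw [← hrr]; ring]
    refine le_of_eq ?_
    congr 2
    · funext z
      rw [ENNReal.mul_rpow_of_nonneg _ _ hr0.le, ENNReal.mul_rpow_of_nonneg _ _ hr0.le,
        ← ENNReal.rpow_mul, ← ENNReal.rpow_mul, one_div_mul_cancel hr0.ne', ENNReal.rpow_one,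
        show -(1 / r') * r = -(r - 1) by rw [← hrr]; ring, mul_assoc]
    · rw [hI]
      congr 1; funext z
      rw [ENNReal.mul_rpow_of_nonneg _ _ hr'0.le, ← ENNReal.rpow_mul, ← ENNReal.rpow_mul,
        one_div_mul_cancel hr'0.ne', ENNReal.rpow_one, ENNReal.rpow_one]
  have hm : Measurable (Function.uncurry fun x z => k z x ^ r * (a z ^ (-(r - 1)) * φ z)) := by
    have : Measurable fun p : β × α => k p.2 p.1 := hk.comp (by fun_prop : Measurable fun p : β × α => (p.2, p.1))
    unfold Function.uncurry; fun_prop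
  calc _ ≤ ∫⁻ x, (∫⁻ z, k z x ^ r * (a z ^ (-(r - 1)) * φ z) ∂μ) * I ^ (r - 1) ∂ν :=
        lintegral_mono step
    _ = (∫⁻ x, ∫⁻ z, k z x ^ r * (a z ^ (-(r - 1)) * φ z) ∂μ ∂ν) * I ^ (r - 1) :=
        lintegral_mul_const _ hm.lintegral_prod_right'
    _ = (∫⁻ z, ∫⁻ x, k z x ^ r * (a z ^ (-(r - 1)) * φ z) ∂ν ∂μ) * I ^ (r - 1) := by
        rw [lintegral_lintegral_swap hm.aemeasurable]
    _ ≤ (∫⁻ z, a z * φ z ∂μ) * I ^ (r - 1) := by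
        gcongr ?_ * _
        refine lintegral_mono_ae ?_
        filter_upwards [h] with z ⟨h0, ht, hz⟩
        rw [lintegral_mul_const _ (by have := hk2 z; fun_prop)]
        calc _ ≤ a z ^ r * (a z ^ (-(r - 1)) * φ z) := by gcongr
          _ = _ := by
            rw [← mul_assoc, ← ENNReal.rpow_add _ _ h0 ht, show r + -(r - 1) = 1 by ring, ENNReal.rpow_one]
    _ = I ^ r := by
        rw [← hI]
        conv_rhs => rw [show r = 1 + (r - 1) by ring]
        rw [ENNReal.rpow_add_of_nonneg _ _ zero_le_one (by linarith), ENNReal.rpow_one]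

/-- L^r norm of a heat kernel -/
theorem hk_lr {d : ℕ} {t r : ℝ} (ht : 0 < t) (hr : 1 ≤ r) :
    ∫⁻ x, ENNReal.ofReal (heatKernel d t x) ^ r ≤
      ENNReal.ofReal (t ^ (-((d : ℝ) / 2) * (r - 1))) := by
  refine (int_interp hr (B := ENNReal.ofReal (t ^ (-(d : ℝ) / 2))) (fun x => ?_)
    (hk_lintegral ht).le).trans ?_
  · refine ENNReal.ofReal_le_ofReal ((hk_le ht x).trans ?_)
    refine Real.rpow_le_rpow_of_nonpos ht ?_ ?_
    · nlinarith [Real.pi_gt_three]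
    · have : (0:ℝ) ≤ d := by positivity
      linarith
  · rw [mul_one, ENNReal.ofReal_rpow_of_nonneg (by positivity) (by linarith), ← Real.rpow_mul ht.le,
      neg_div]

theorem conv_enorm_le {d : ℕ} (f g : Euc d → ℝ) (x : Euc d) :
    ‖conv f g x‖ₑ ≤ ∫⁻ y, ‖f (x - y)‖ₑ * ‖g y‖ₑ := by
  unfold conv
  refine (enorm_integral_le_lintegral_enorm _).trans (le_of_eq ?_)
  simp_rw [enorm_mul]

theorem conv_lint_le {d : ℕ} {f g : Euc d → ℝ} (hf : Measurable f) (hg : AEMeasurable g) :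
    ∫⁻ x, ‖conv f g x‖ₑ ≤ (∫⁻ x, ‖f x‖ₑ) * ∫⁻ y, ‖g y‖ₑ := by
  calc _ ≤ ∫⁻ x, ∫⁻ y, ‖f (x - y)‖ₑ * ‖g y‖ₑ := lintegral_mono (conv_enorm_le f g)
    _ = ∫⁻ y, ∫⁻ x, ‖f (x - y)‖ₑ * ‖g y‖ₑ := by
        rw [lintegral_lintegral_swap]
        have : AEMeasurable (fun p : Euc d × Euc d => g p.2) (volume.prod volume) :=
          hg.comp_quasiMeasurePreserving Measure.quasiMeasurePreserving_snd
        unfold Function.uncurry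
        fun_prop
    _ = ∫⁻ y, (∫⁻ x, ‖f x‖ₑ) * ‖g y‖ₑ := by
        refine lintegral_congr fun y => ?_
        rw [lintegral_mul_const _ (by fun_prop), lintegral_sub_right_eq_self (fun x => ‖f x‖ₑ)]
    _ = _ := lintegral_const_mul'' _ (by fun_prop)

theorem hk_enorm {d : ℕ} {t : ℝ} (ht : 0 < t) (x : Euc d) :
    ‖heatKernel d t x‖ₑ = ENNReal.ofReal (heatKernel d t x) := by
  rw [← ofReal_norm, Real.norm_of_nonneg (hk_pos ht x).le]

theorem hconv_l1 {d : ℕ} {t : ℝ} (ht : 0 < t) {g : Euc d → ℝ} (hg : AEMeasurable g) :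
    ∫⁻ x, ‖conv (heatKernel d t) g x‖ₑ ≤ ∫⁻ y, ‖g y‖ₑ := by
  refine (conv_lint_le (by fun_prop) hg).trans (le_of_eq ?_)
  simp_rw [hk_enorm ht]
  rw [hk_lintegral ht, one_mul]

theorem hconv_sup {d : ℕ} {t : ℝ} (ht : 0 < t) {g : Euc d → ℝ} (x : Euc d) :
    ‖conv (heatKernel d t) g x‖ₑ ≤ ENNReal.ofReal (t ^ (-((d : ℝ) / 2))) * ∫⁻ y, ‖g y‖ₑ := by
  refine (conv_enorm_le _ _ x).trans ?_
  rw [← lintegral_const_mul' _ _ ENNReal.ofReal_ne_top]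
  refine lintegral_mono fun y => ?_
  dsimp only
  rw [hk_enorm ht]
  gcongr
  refine (hk_le ht _).trans ?_
  rw [← neg_div]
  refine Real.rpow_le_rpow_of_nonpos ht ?_ ?_
  · nlinarith [Real.pi_gt_three]
  · have : (0:ℝ) ≤ d := by positivity
    linarith

theorem hconv_lr {d : ℕ} {t r : ℝ} (ht : 0 < t) (hr : 1 ≤ r) {g : Euc d → ℝ} (hg : AEMeasurable g)
    {A : ℝ≥0∞} (hA : ∫⁻ y, ‖g y‖ₑ ≤ A) :
    ∫⁻ x, ‖conv (heatKernel d t) g x‖ₑ ^ r ≤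
      ENNReal.ofReal (t ^ (-((d : ℝ) / 2) * (r - 1))) * A ^ r := by
  refine (int_interp hr (fun x => hconv_sup ht x) (hconv_l1 ht hg)).trans ?_
  rw [ENNReal.mul_rpow_of_nonneg _ _ (by linarith), ENNReal.ofReal_rpow_of_nonneg (by positivity) (by linarith),
    ← Real.rpow_mul ht.le, mul_assoc]
  gcongr
  calc _ ≤ A ^ (r - 1) * A := by gcongr
    _ = A ^ r := by
      conv_rhs => rw [show r = (r - 1) + 1 by ring]
      rw [ENNReal.rpow_add_of_nonneg _ _ (by linarith) zero_le_one, ENNReal.rpow_one]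

theorem part1 {d : ℕ} {θ : ℝ} (ρ₀ : Euc d → ℝ) (h1 : MemLp ρ₀ 1 volume)
    (h2 : eLpNorm ρ₀ 1 volume ≤ ENNReal.ofReal θ) (T : ℝ) : AssumptionA d ρ₀ T θ := by
  intro q hq t ht
  have ht0 := ht.1
  have hg : AEMeasurable ρ₀ := h1.1.aemeasurable
  rw [eLpNorm_one_eq_lintegral_enorm] at h2
  rcases eq_or_ne q ⊤ with rfl | hqt
  · have : eLpNorm (conv (heatKernel d t) ρ₀) ⊤ volume ≤
        ENNReal.ofReal (t ^ (-((d : ℝ) / 2))) * ENNReal.ofReal θ := by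
      rw [eLpNorm_exponent_top]
      refine eLpNormEssSup_le_of_ae_enorm_bound (Eventually.of_forall fun x => ?_)
      exact (hconv_sup ht0 x).trans (by gcongr)
    calc _ ≤ ENNReal.ofReal (t ^ (((d : ℝ) / 2) * (1 - (⊤ : ℝ≥0∞)⁻¹.toReal))) *
        (ENNReal.ofReal (t ^ (-((d : ℝ) / 2))) * ENNReal.ofReal θ) := by gcongr
      _ = _ := by
        rw [← mul_assoc, ← ENNReal.ofReal_mul (by positivity), ← Real.rpow_add ht0]; simp
  · have hq1 : 1 ≤ q.toReal := by
      rw [← ENNReal.toReal_one]; exact ENNReal.toReal_mono hqt hq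
    have hq0 : 0 < q.toReal := by linarith
    rw [eLpNorm_eq_lintegral_rpow_enorm_toReal (by positivity) hqt]
    have := ENNReal.rpow_le_rpow (hconv_lr ht0 hq1 hg h2) (show 0 ≤ 1 / q.toReal by positivity)
    rw [ENNReal.mul_rpow_of_nonneg _ _ (by positivity), ← ENNReal.rpow_mul,
      mul_one_div_cancel hq0.ne', ENNReal.rpow_one,
      ENNReal.ofReal_rpow_of_nonneg (by positivity) (by positivity), ← Real.rpow_mul ht0.le] at this
    refine (mul_le_mul_right this _).trans (le_of_eq ?_)
    rw [← mul_assoc, ← ENNReal.ofReal_mul (by positivity), ← Real.rpow_add ht0, ENNReal.toReal_inv]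
    rw [show (d:ℝ) / 2 * (1 - q.toReal⁻¹) + -((d:ℝ) / 2) * (q.toReal - 1) * (1 / q.toReal) = 0 by
      field_simp; ring]
    simp



/-- the kernel 1/|z| -/
def kk {d : ℕ} (z : Euc d) : ℝ≥0∞ := ENNReal.ofReal (‖z‖⁻¹)
def kn {d : ℕ} (R : ℝ) (z : Euc d) : ℝ≥0∞ := if ‖z‖ < R then kk z else 0
def kf {d : ℕ} (R : ℝ) (z : Euc d) : ℝ≥0∞ := if R ≤ ‖z‖ then kk z else 0

@[fun_prop] theorem kk_meas {d : ℕ} : Measurable (kk (d := d)) := by unfold kk; fun_prop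
@[fun_prop] theorem kn_meas {d : ℕ} (R : ℝ) : Measurable (kn (d := d) R) := by
  unfold kn
  exact Measurable.ite (measurableSet_lt (by fun_prop) (by fun_prop)) (by fun_prop) (by fun_prop)
@[fun_prop] theorem kf_meas {d : ℕ} (R : ℝ) : Measurable (kf (d := d) R) := by
  unfold kf
  exact Measurable.ite (measurableSet_le (by fun_prop) (by fun_prop)) (by fun_prop) (by fun_prop)

theorem kk_split {d : ℕ} (R : ℝ) (z : Euc d) : kk z = kn R z + kf R z := by
  unfold kn kf
  by_cases h : ‖z‖ < R
  · simp [h, not_le.2 h]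
  · simp [h, not_lt.1 h]

theorem kk_symm {d : ℕ} (x y : Euc d) : kk (x - y) = kk (y - x) := by
  unfold kk; rw [norm_sub_rev]

theorem kk_smul {d : ℕ} {R : ℝ} (hR : 0 < R) (z : Euc d) : kk (R • z) = ENNReal.ofReal R⁻¹ * kk z := by
  unfold kk
  rw [norm_smul, mul_inv, Real.norm_of_nonneg hR.le, ENNReal.ofReal_mul (by positivity)]

theorem kf_le {d : ℕ} {R : ℝ} (hR : 0 < R) (z : Euc d) : kf R z ≤ ENNReal.ofReal R⁻¹ := by
  unfold kf kk
  split_ifs with h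
  · exact ENNReal.ofReal_le_ofReal (by gcongr)
  · exact bot_le

theorem lint_scale {d : ℕ} {R : ℝ} (hR : 0 < R) {g : Euc d → ℝ≥0∞} (hg : Measurable g) :
    ∫⁻ z, g z = ENNReal.ofReal (R ^ (d : ℝ)) * ∫⁻ z, g (R • z) := by
  have h := Measure.map_addHaar_smul (volume : Measure (Euc d)) hR.ne'
  rw [finrank_euclideanSpace_fin] at h
  have h2 : ∫⁻ z, g (R • z) = ∫⁻ z, g z ∂(Measure.map (R • ·) (volume : Measure (Euc d))) := by
    rw [lintegral_map hg (by fun_prop)]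
  rw [h2, h, lintegral_smul_measure, smul_eq_mul, ← mul_assoc, ← ENNReal.ofReal_mul (by positivity),
    abs_of_pos (by positivity), Real.rpow_natCast, mul_inv_cancel₀ (by positivity)]
  simp

theorem kn_int {d : ℕ} (hd : 2 ≤ d) : ∃ C : ℝ, 0 < C ∧ ∀ R : ℝ, 0 < R →
    ∫⁻ z : Euc d, kn R z ≤ ENNReal.ofReal (C * R ^ ((d : ℝ) - 1)) := by
  have h1 : ∫⁻ z : Euc d, kn 1 z < ⊤ := by
    have hi : IntegrableOn (fun z : Euc d => ‖z‖⁻¹) (Metric.ball 0 1) := by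
      refine integrableOn_ball_of_norm_le_rpow (C := 1) (α := 1) (by simp; omega)
        (by simp; omega) ?_ (by fun_prop)
      refine Eventually.of_forall fun z => ?_
      simp [Real.rpow_neg_one]
    have := hi.2
    rw [HasFiniteIntegral] at this
    refine lt_of_le_of_lt ?_ this
    rw [← lintegral_indicator Metric.isOpen_ball.measurableSet]
    refine lintegral_mono fun z => ?_
    unfold kn kk
    simp only [Set.indicator, Metric.mem_ball, dist_zero_right]
    split_ifs
    · rw [← ofReal_norm]; simp
    · exact le_rfl
  refine ⟨(∫⁻ z : Euc d, kn 1 z).toReal + 1, by positivity, fun R hR => ?_⟩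
  rw [lint_scale hR (by fun_prop)]
  have e : ∀ z : Euc d, kn R (R • z) = ENNReal.ofReal R⁻¹ * kn 1 z := by
    intro z
    unfold kn
    rw [kk_smul hR, norm_smul, Real.norm_of_nonneg hR.le]
    have : R * ‖z‖ < R ↔ ‖z‖ < 1 := by constructor <;> intro h <;> nlinarith
    simp [this]
  simp_rw [e]
  rw [lintegral_const_mul _ (by fun_prop), ← mul_assoc, ← ENNReal.ofReal_mul (by positivity),
    ← ENNReal.ofReal_toReal h1.ne, ← ENNReal.ofReal_mul (by positivity)]
  refine ENNReal.ofReal_le_ofReal ?_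
  rw [Real.rpow_sub_one hR.ne', ← div_eq_mul_inv, mul_comm, ENNReal.toReal_ofReal (by positivity)]
  gcongr; linarith

theorem kf_int {d : ℕ} {r : ℝ} (hr : (d : ℝ) < r) : ∃ C : ℝ, 0 < C ∧ ∀ R : ℝ, 0 < R →
    ∫⁻ z : Euc d, kf R z ^ r ≤ ENNReal.ofReal (C * R ^ ((d : ℝ) - r)) := by
  have hr0 : 0 ≤ r := le_trans (by positivity) hr.le
  have h1 : ∫⁻ z : Euc d, kf 1 z ^ r < ⊤ := by
    have hi := finite_integral_one_add_norm (E := Euc d) (μ := volume) (r := r) (by simpa using hr)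
    have := ENNReal.mul_lt_top (ENNReal.ofReal_lt_top (r := 2 ^ r)) hi
    rw [← lintegral_const_mul _ (by fun_prop)] at this
    refine lt_of_le_of_lt (lintegral_mono fun z => ?_) this
    unfold kf kk
    split_ifs with h
    · rw [ENNReal.ofReal_rpow_of_nonneg (by positivity) hr0, ← ENNReal.ofReal_mul (by positivity)]
      refine ENNReal.ofReal_le_ofReal ?_
      rw [Real.rpow_neg (by positivity), ← Real.inv_rpow (by positivity), ← Real.mul_rpow (by positivity) (by positivity)]
      refine Real.rpow_le_rpow (by positivity) ?_ hr0
      rw [inv_eq_one_div, ← div_eq_mul_inv, div_le_div_iff₀ (by linarith) (by positivity)]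
      linarith
    · rcases hr0.eq_or_lt with h0 | h0
      · have : (0:ℝ) ≤ d := by positivity
        linarith
      · simp [h0]
  refine ⟨(∫⁻ z : Euc d, kf 1 z ^ r).toReal + 1, by positivity, fun R hR => ?_⟩
  rw [lint_scale hR (by fun_prop)]
  have e : ∀ z : Euc d, kf R (R • z) ^ r = ENNReal.ofReal (R ^ (-r)) * kf 1 z ^ r := by
    intro z
    rw [Real.rpow_neg hR.le, ← Real.inv_rpow hR.le,
      ← ENNReal.ofReal_rpow_of_nonneg (by positivity) hr0, ← ENNReal.mul_rpow_of_nonneg _ _ hr0]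
    congr 1
    unfold kf
    rw [kk_smul hR, norm_smul, Real.norm_of_nonneg hR.le]
    have : R ≤ R * ‖z‖ ↔ 1 ≤ ‖z‖ := by constructor <;> intro h <;> nlinarith
    simp [this]
  simp_rw [e]
  rw [lintegral_const_mul _ (by fun_prop), ← mul_assoc, ← ENNReal.ofReal_mul (by positivity),
    ← ENNReal.ofReal_toReal h1.ne, ← ENNReal.ofReal_mul (by positivity)]
  refine ENNReal.ofReal_le_ofReal ?_
  rw [← Real.rpow_add hR, ← sub_eq_add_neg, mul_comm, ENNReal.toReal_ofReal (by positivity)]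
  gcongr; linarith

/-- the exponent 2d/(2d-1) -/
def pe (d : ℕ) : ℝ := 2 * d / (2 * d - 1)

/-- potential -/
def HH {d : ℕ} (g : Euc d → ℝ≥0∞) (x : Euc d) : ℝ≥0∞ := ∫⁻ y, kk (x - y) * g y

@[fun_prop] theorem kk_meas2 {d : ℕ} {α : Type*} [MeasurableSpace α] {f : α → Euc d}
    (hf : Measurable f) : Measurable fun a => kk (f a) := kk_meas.comp hf

theorem pe_facts {d : ℕ} (hd : 2 ≤ d) : 1 < pe d ∧ (pe d).HolderConjugate (2 * d) ∧
    1 + 1 / (2 * (d:ℝ) - 1) = pe d := by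
  have h2 : (2:ℝ) ≤ d := by exact_mod_cast hd
  have h3 : (0:ℝ) < 2 * d - 1 := by linarith
  have h1 : 1 < pe d := by
    unfold pe; rw [lt_div_iff₀ h3]; linarith
  refine ⟨h1, ?_, ?_⟩
  · rw [Real.holderConjugate_iff]
    refine ⟨h1, ?_⟩
    unfold pe; field_simp; ring
  · unfold pe; field_simp; ring

theorem hls_diag {d : ℕ} (hd : 2 ≤ d) : ∃ C : ℝ, 0 < C ∧ ∀ f : Euc d → ℝ≥0∞, Measurable f →
    ∫⁻ x, f x ^ pe d ≤ 2 → ∫⁻ x, f x * HH f x ≤ ENNReal.ofReal C := by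
  obtain ⟨C1, hC1, H1⟩ := kn_int hd
  have h2 : (2:ℝ) ≤ d := by exact_mod_cast hd
  obtain ⟨C2, hC2, H2⟩ := kf_int (d := d) (r := 2 * d) (by linarith)
  obtain ⟨hp1, hpq, hpe⟩ := pe_facts hd
  have hp0 : 0 < pe d := by linarith
  set K : ℝ := C1 + 2 ^ (1 / pe d) * C2 ^ (1 / (2 * (d:ℝ))) with hK
  have hK0 : 0 < K := by positivity
  refine ⟨4 * K, by positivity, fun f hf hfp => ?_⟩
  -- pointwise bound
  have key : ∀ x, f x ≠ ⊤ → f x * ∫⁻ y, kk (x - y) * (if f y ≤ f x then f y else 0) ≤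
      ENNReal.ofReal K * f x ^ pe d := by
    intro x hx
    rcases eq_or_ne (f x) 0 with h0 | h0
    · simp [h0]
    set a := (f x).toReal with ha
    have ha0 : 0 < a := ENNReal.toReal_pos h0 hx
    have hfa : f x = ENNReal.ofReal a := (ENNReal.ofReal_toReal hx).symm
    set R := a ^ (-(1 / ((d:ℝ) - 1 / 2))) with hR
    have hR0 : 0 < R := by positivity
    have hd' : (d:ℝ) - 1 / 2 ≠ 0 := by linarith
    have hRm : R ^ (-(1/2) : ℝ) = a ^ (1 / (2 * (d:ℝ) - 1)) := by
      rw [hR, ← Real.rpow_mul ha0.le]; congr 1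
      have : 2 * (d:ℝ) - 1 ≠ 0 := by linarith
      field_simp
    have hRn : a * R ^ ((d:ℝ) - 1) = a ^ (1 / (2 * (d:ℝ) - 1)) := by
      rw [hR, ← Real.rpow_mul ha0.le]
      nth_rewrite 1 [← Real.rpow_one a]
      rw [← Real.rpow_add ha0]; congr 1
      have : 2 * (d:ℝ) - 1 ≠ 0 := by linarith
      rw [show (d:ℝ) - 1 / 2 = (2 * d - 1) / 2 by ring, one_div_div, eq_div_iff this]
      linear_combination (-((d:ℝ) - 1)) * div_mul_cancel₀ 2 this
    have hfun : ∀ R, Measurable fun y => kn R (x - y) := fun R => (kn_meas R).comp (by fun_prop)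
    have hfun' : ∀ R, Measurable fun y => kf R (x - y) := fun R => (kf_meas R).comp (by fun_prop)
    have b1 : ∫⁻ y, kn R (x - y) * f x ≤ ENNReal.ofReal (C1 * a ^ (1 / (2 * (d:ℝ) - 1))) := by
      rw [lintegral_mul_const _ (hfun R), lintegral_sub_left_eq_self (fun z => kn R z), ← hRn, hfa]
      refine (mul_le_mul_left (H1 R hR0) _).trans ?_
      rw [← ENNReal.ofReal_mul (by positivity)]
      exact ENNReal.ofReal_le_ofReal (by ring_nf; rfl)
    have b2 : ∫⁻ y, kf R (x - y) * f y ≤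
        ENNReal.ofReal (2 ^ (1 / pe d) * C2 ^ (1 / (2 * (d:ℝ))) * a ^ (1 / (2 * (d:ℝ) - 1))) := by
      have := ENNReal.lintegral_mul_le_Lp_mul_Lq volume hpq hf.aemeasurable (hfun' R).aemeasurable
      simp only [Pi.mul_apply, mul_comm (f _)] at this
      refine this.trans ?_
      rw [lintegral_sub_left_eq_self (fun z => kf R z ^ (2 * (d:ℝ)))]
      calc _ ≤ (2:ℝ≥0∞) ^ (1 / pe d) * (ENNReal.ofReal (C2 * R ^ ((d:ℝ) - 2 * d))) ^ (1 / (2 * (d:ℝ))) := by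
            gcongr
            exact H2 R hR0
        _ = _ := by
            rw [ENNReal.ofReal_rpow_of_nonneg (by positivity) (by positivity),
              show (2:ℝ≥0∞) = ENNReal.ofReal 2 by simp,
              ENNReal.ofReal_rpow_of_nonneg (by positivity) (by positivity),
              ← ENNReal.ofReal_mul (by positivity), Real.mul_rpow (by positivity) (by positivity),
              ← Real.rpow_mul hR0.le, ← hRm, mul_assoc]
            congr 4
            field_simp; ring
    have b3 : ∫⁻ y, kk (x - y) * (if f y ≤ f x then f y else 0) ≤
        ENNReal.ofReal (K * a ^ (1 / (2 * (d:ℝ) - 1))) := by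
      calc _ ≤ ∫⁻ y, (kn R (x - y) * f x + kf R (x - y) * f y) := by
            refine lintegral_mono fun y => ?_
            dsimp only
            rw [kk_split R]
            split_ifs with h
            · rw [add_mul]; gcongr
            · simp
        _ = _ := lintegral_add_left (by have := hfun R; fun_prop) _
        _ ≤ _ := add_le_add b1 b2
        _ = _ := by
            rw [← ENNReal.ofReal_add (by positivity) (by positivity), hK]; congr 1; ring
    refine (mul_le_mul_right b3 _).trans (le_of_eq ?_)
    rw [hfa, ENNReal.ofReal_rpow_of_pos ha0, ← ENNReal.ofReal_mul (by positivity),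
      ← ENNReal.ofReal_mul (by positivity), ← hpe, Real.rpow_add ha0, Real.rpow_one]
    congr 1; ring
  have hfin : ∀ᵐ x, f x ≠ ⊤ := by
    have h := ae_lt_top (μ := volume) (f := fun x => f x ^ pe d) (by fun_prop)
      (hfp.trans_lt (by simp)).ne
    filter_upwards [h] with x hx h'
    simp [h', hp0] at hx
  set m : Euc d → Euc d → ℝ≥0∞ := fun x y => if f y ≤ f x then f y else 0 with hm
  have hmm : Measurable (fun p : Euc d × Euc d => m p.1 p.2) :=
    Measurable.ite (measurableSet_le (by fun_prop) (by fun_prop)) (by fun_prop) (by fun_prop)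
  have hmm1 : ∀ x, Measurable (m x) := fun x => hmm.comp measurable_prodMk_left
  have hmm2 : Measurable (fun p : Euc d × Euc d => m p.2 p.1) := hmm.comp measurable_swap
  have hmm3 : ∀ y, Measurable (fun x => m x y) := fun x => hmm.comp measurable_prodMk_right
  have half : ∫⁻ x, f x * ∫⁻ y, kk (x - y) * m x y ≤ ENNReal.ofReal (2 * K) := by
    calc _ ≤ ∫⁻ x, ENNReal.ofReal K * f x ^ pe d := by
          refine lintegral_mono_ae ?_
          filter_upwards [hfin] with x hx using key x hx
      _ = ENNReal.ofReal K * ∫⁻ x, f x ^ pe d := lintegral_const_mul _ (by fun_prop)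
      _ ≤ ENNReal.ofReal K * 2 := by gcongr
      _ = _ := by rw [ENNReal.ofReal_mul (by norm_num), mul_comm]; simp
  have half2 : ∫⁻ x, ∫⁻ y, kk (x - y) * (f y * m y x) ≤ ENNReal.ofReal (2 * K) := by
    rw [lintegral_lintegral_swap (by unfold Function.uncurry; fun_prop)]
    refine le_trans (le_of_eq ?_) half
    refine lintegral_congr fun x => ?_
    have := hmm1 x
    rw [← lintegral_const_mul _ (by fun_prop)]
    refine lintegral_congr fun y => ?_
    rw [kk_symm]; ring
  calc ∫⁻ x, f x * HH f x ≤ ∫⁻ x, (f x * ∫⁻ y, kk (x - y) * m x y) +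
        ∫⁻ y, kk (x - y) * (f y * m y x) := by
        refine lintegral_mono fun x => ?_
        have := hmm1 x
        dsimp only [HH]
        rw [← lintegral_const_mul _ (by fun_prop), ← lintegral_const_mul _ (by fun_prop),
          ← lintegral_add_left (by fun_prop)]
        refine lintegral_mono fun y => ?_
        dsimp only [m]
        rcases le_total (f y) (f x) with h | h
        · simp only [h, if_true]; exact le_self_add
        · simp only [h, if_true]
          refine le_trans (le_of_eq ?_) le_add_self
          ring
    _ = _ := by
        have : Measurable fun x => ∫⁻ y, kk (x - y) * m x y :=
          (by unfold Function.uncurry; fun_prop : Measurable (Function.uncurry fun x y => kk (x - y) * m x y)).lintegral_prod_right'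
        exact lintegral_add_left (by fun_prop) _
    _ ≤ ENNReal.ofReal (2 * K) + ENNReal.ofReal (2 * K) := add_le_add half half2
    _ = _ := by rw [← ENNReal.ofReal_add (by positivity) (by positivity)]; congr 1; ring

theorem hls {d : ℕ} (hd : 2 ≤ d) : ∃ C : ℝ, 0 < C ∧ ∀ f g : Euc d → ℝ≥0∞, Measurable f →
    Measurable g → ∀ A B : ℝ≥0∞, A ≠ 0 → A ≠ ⊤ → B ≠ 0 → B ≠ ⊤ →
    ∫⁻ x, f x ^ pe d ≤ A ^ pe d → ∫⁻ x, g x ^ pe d ≤ B ^ pe d →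
    ∫⁻ x, f x * HH g x ≤ ENNReal.ofReal C * A * B := by
  obtain ⟨C, hC, H⟩ := hls_diag hd
  obtain ⟨hp1, hpq, hpe⟩ := pe_facts hd
  have hp0 : 0 < pe d := by linarith
  refine ⟨C, hC, fun f g hf hg A B hA0 hA hB0 hB hfA hgB => ?_⟩
  set h : Euc d → ℝ≥0∞ := fun x => max (A⁻¹ * f x) (B⁻¹ * g x) with hh
  have hAi : A⁻¹ ≠ ⊤ := ENNReal.inv_ne_top.2 hA0
  have hBi : B⁻¹ ≠ ⊤ := ENNReal.inv_ne_top.2 hB0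
  have nrm : ∀ {u : Euc d → ℝ≥0∞} {A : ℝ≥0∞}, Measurable u → A ≠ 0 → A ≠ ⊤ →
      ∫⁻ x, u x ^ pe d ≤ A ^ pe d → ∫⁻ x, (A⁻¹ * u x) ^ pe d ≤ 1 := by
    intro u A hu h0 ht hle
    simp_rw [ENNReal.mul_rpow_of_nonneg _ _ hp0.le]
    rw [lintegral_const_mul _ (by fun_prop)]
    refine (mul_le_mul_right hle _).trans (le_of_eq ?_)
    rw [← ENNReal.mul_rpow_of_nonneg _ _ hp0.le, ENNReal.inv_mul_cancel h0 ht, ENNReal.one_rpow]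
  have h2 : ∫⁻ x, h x ^ pe d ≤ 2 := by
    calc _ ≤ ∫⁻ x, ((A⁻¹ * f x) ^ pe d + (B⁻¹ * g x) ^ pe d) := by
          refine lintegral_mono fun x => ?_
          dsimp only [h]
          rcases le_total (A⁻¹ * f x) (B⁻¹ * g x) with hle | hle
          · rw [max_eq_right hle]; exact le_add_self
          · rw [max_eq_left hle]; exact le_self_add
      _ = _ := lintegral_add_left (by fun_prop) _
      _ ≤ 1 + 1 := add_le_add (nrm hf hA0 hA hfA) (nrm hg hB0 hB hgB)
      _ = 2 := one_add_one_eq_two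
  have h3 := H h (by fun_prop) h2
  have e : ∀ x, f x * HH g x ≤ A * B * (h x * HH h x) := by
    intro x
    have e1 : f x ≤ A * h x := by
      calc f x = A * (A⁻¹ * f x) := by rw [← mul_assoc, ENNReal.mul_inv_cancel hA0 hA, one_mul]
        _ ≤ _ := by gcongr; exact le_max_left _ _
    have e2 : HH g x ≤ B * HH h x := by
      unfold HH
      rw [← lintegral_const_mul _ (by fun_prop)]
      refine lintegral_mono fun y => ?_
      dsimp only
      calc kk (x - y) * g y = B * (kk (x - y) * (B⁻¹ * g y)) := by
            rw [show B * (kk (x - y) * (B⁻¹ * g y)) = (B * B⁻¹) * (kk (x - y) * g y) by ring,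
              ENNReal.mul_inv_cancel hB0 hB, one_mul]
        _ ≤ _ := by gcongr; exact le_max_right _ _
    calc _ ≤ (A * h x) * (B * HH h x) := by gcongr
      _ = _ := by ring
  calc _ ≤ ∫⁻ x, A * B * (h x * HH h x) := lintegral_mono e
    _ = A * B * ∫⁻ x, (h x * HH h x) := lintegral_const_mul' _ _ (ENNReal.mul_ne_top hA hB)
    _ ≤ A * B * ENNReal.ofReal C := by gcongr
    _ = _ := by ring



theorem ti_right {a s t : ℝ} (ha : a < 1) (hst : s ≤ t) :
    ∫⁻ τ in Set.Ioc s t, ENNReal.ofReal ((t - τ) ^ (-a)) =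
      ENNReal.ofReal ((t - s) ^ (1 - a) / (1 - a)) := by
  have hi : IntervalIntegrable (fun u : ℝ => u ^ (-a)) volume 0 (t - s) :=
    intervalIntegral.intervalIntegrable_rpow' (by linarith)
  have hi2 : IntervalIntegrable (fun τ : ℝ => (t - τ) ^ (-a)) volume s t := by
    have := (hi.comp_sub_left t).symm
    simpa using this
  rw [intervalIntegrable_iff_integrableOn_Ioc_of_le hst] at hi2
  rw [← ofReal_integral_eq_lintegral_ofReal hi2]
  · rw [← intervalIntegral.integral_of_le hst,
      intervalIntegral.integral_comp_sub_left (fun u => u ^ (-a)) t, sub_self,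
      integral_rpow (Or.inl (by linarith)), Real.zero_rpow (by linarith)]
    congr 1
    rw [sub_zero, show -a + 1 = 1 - a by ring]
  · refine (ae_restrict_iff' measurableSet_Ioc).2 (Eventually.of_forall fun τ hτ => ?_)
    exact Real.rpow_nonneg (by linarith [hτ.2]) _

theorem ti_left {b t : ℝ} (hb : b < 1) (ht : 0 ≤ t) :
    ∫⁻ τ in Set.Ioc 0 t, ENNReal.ofReal (τ ^ (-b)) = ENNReal.ofReal (t ^ (1 - b) / (1 - b)) := by
  have hi : IntervalIntegrable (fun u : ℝ => u ^ (-b)) volume 0 t :=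
    intervalIntegral.intervalIntegrable_rpow' (by linarith)
  rw [intervalIntegrable_iff_integrableOn_Ioc_of_le ht] at hi
  rw [← ofReal_integral_eq_lintegral_ofReal hi]
  · rw [← intervalIntegral.integral_of_le ht,
      integral_rpow (Or.inl (by linarith)), Real.zero_rpow (by linarith)]
    congr 1
    rw [sub_zero, show -b + 1 = 1 - b by ring]
  · refine (ae_restrict_iff' measurableSet_Ioc).2 (Eventually.of_forall fun τ hτ => ?_)
    exact Real.rpow_nonneg (hτ.1.le) _

theorem ti_both {a b : ℝ} (ha0 : 0 ≤ a) (ha : a < 1) (hb0 : 0 ≤ b) (hb : b < 1) :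
    ∃ C : ℝ, 0 < C ∧ ∀ t : ℝ, 0 < t →
      ∫⁻ s in Set.Ioc 0 t, ENNReal.ofReal ((t - s) ^ (-a)) * ENNReal.ofReal (s ^ (-b)) ≤
        ENNReal.ofReal (C * t ^ (1 - a - b)) := by
  have ha' : 0 < 1 - a := by linarith
  have hb' : 0 < 1 - b := by linarith
  refine ⟨(1 / 2) ^ (-a) / (1 - b) + (1 / 2) ^ (-b) / (1 - a), by positivity, fun t ht => ?_⟩
  calc _ ≤ ∫⁻ s in Set.Ioc 0 t, (ENNReal.ofReal ((t / 2) ^ (-a)) * ENNReal.ofReal (s ^ (-b)) +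
        ENNReal.ofReal ((t / 2) ^ (-b)) * ENNReal.ofReal ((t - s) ^ (-a))) := by
        refine setLIntegral_mono' measurableSet_Ioc fun s hs => ?_
        rcases le_total s (t / 2) with h | h
        · refine le_trans ?_ le_self_add
          gcongr ENNReal.ofReal ?_ * _
          exact Real.rpow_le_rpow_of_nonpos (by positivity) (by linarith) (by linarith)
        · refine le_trans ?_ le_add_self
          rw [mul_comm]
          gcongr ENNReal.ofReal ?_ * _
          exact Real.rpow_le_rpow_of_nonpos (by positivity) h (by linarith)
    _ = ENNReal.ofReal ((t / 2) ^ (-a)) * ENNReal.ofReal (t ^ (1 - b) / (1 - b)) +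
        ENNReal.ofReal ((t / 2) ^ (-b)) * ENNReal.ofReal (t ^ (1 - a) / (1 - a)) := by
        rw [lintegral_add_left (by fun_prop), lintegral_const_mul _ (by fun_prop),
          lintegral_const_mul _ (by fun_prop), ti_left hb ht.le, ti_right ha ht.le, sub_zero]
    _ = _ := by
        rw [← ENNReal.ofReal_mul (by positivity), ← ENNReal.ofReal_mul (by positivity),
          ← ENNReal.ofReal_add (by positivity) (by positivity)]
        congr 1
        have e1 : t ^ (1 - a - b) = t ^ (-a) * t ^ (1 - b) := by
          rw [← Real.rpow_add ht]; congr 1; ring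
        have e2 : t ^ (1 - a - b) = t ^ (-b) * t ^ (1 - a) := by
          rw [← Real.rpow_add ht]; congr 1; ring
        rw [add_mul]
        nth_rewrite 1 [e1]
        rw [e2, div_eq_mul_one_div t 2, Real.mul_rpow ht.le (by norm_num), Real.mul_rpow ht.le (by norm_num)]
        ring

section duh
variable {d : ℕ}

/-- measure on time-space slab -/
abbrev slab (d : ℕ) (a c : ℝ) : Measure (ℝ × Euc d) :=
  ((volume : Measure ℝ).restrict (Set.Ioc a c)).prod volume

def DM (F : ℝ → Euc d → Euc d) (a c t : ℝ) (x : Euc d) : ℝ≥0∞ :=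
  ∫⁻ z, ‖gradHeat d (t - z.1) (x - z.2)‖ₑ * ‖F z.1 z.2‖ₑ ∂(slab d a c)

def Duh (F : ℝ → Euc d → Euc d) (a c t : ℝ) (x : Euc d) : ℝ :=
  ∫ s in Set.Ioc a c, ∫ y, (inner ℝ (gradHeat d (t - s) (x - y)) (F s y) : ℝ)

theorem enorm_inner_le' (u v : Euc d) : ‖(inner ℝ u v : ℝ)‖ₑ ≤ ‖u‖ₑ * ‖v‖ₑ := by
  simp only [← ofReal_norm]
  rw [← ENNReal.ofReal_mul (norm_nonneg _)]
  exact ENNReal.ofReal_le_ofReal (norm_inner_le_norm _ _)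

theorem slab_lt {a c t : ℝ} (hct : c ≤ t) : ∀ᵐ z ∂(slab d a c), z.1 ∈ Set.Ioc a c ∧ z.1 < t := by
  have h : ∀ᵐ s ∂((volume : Measure ℝ).restrict (Set.Ioc a c)), s ∈ Set.Ioc a c ∧ s < t := by
    filter_upwards [ae_restrict_mem measurableSet_Ioc,
      ae_restrict_of_ae (Measure.ae_ne volume c)] with s hs hne
    exact ⟨hs, (lt_of_le_of_ne hs.2 hne).trans_le hct⟩
  exact Measure.quasiMeasurePreserving_fst.ae h

theorem slab_lint {a c : ℝ} {g : ℝ → ℝ≥0∞} (hg : Measurable g) {f : ℝ → Euc d → ℝ≥0∞}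
    (hf : Measurable (Function.uncurry f)) :
    ∫⁻ z, g z.1 * f z.1 z.2 ∂(slab d a c) = ∫⁻ s in Set.Ioc a c, g s * ∫⁻ y, f s y := by
  have hf' : Measurable fun z : ℝ × Euc d => f z.1 z.2 := hf
  rw [lintegral_prod _ (by fun_prop)]
  refine lintegral_congr fun s => ?_
  have : Measurable (f s) := hf.comp measurable_prodMk_left
  dsimp only
  rw [lintegral_const_mul _ this]

theorem ker_meas (t : ℝ) : Measurable (fun p : Euc d × (ℝ × Euc d) =>
    ‖gradHeat d (t - p.2.1) (p.1 - p.2.2)‖ₑ) := by fun_prop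

theorem DM_meas {F : ℝ → Euc d → Euc d} (hF : Measurable (Function.uncurry F)) (a c t : ℝ) :
    Measurable (DM F a c t) := by
  have hF' : Measurable fun z : ℝ × Euc d => F z.1 z.2 := hF
  unfold DM
  refine Measurable.lintegral_prod_right' (f := fun p : Euc d × (ℝ × Euc d) =>
    ‖gradHeat d (t - p.2.1) (p.1 - p.2.2)‖ₑ * ‖F p.2.1 p.2.2‖ₑ) ?_
  have : Measurable fun p : Euc d × (ℝ × Euc d) => F p.2.1 p.2.2 := hF'.comp measurable_snd
  fun_prop

theorem DM_l1 {F : ℝ → Euc d → Euc d} (hF : Measurable (Function.uncurry F)) {a c t : ℝ}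
    (hct : c ≤ t) :
    ∫⁻ x, DM F a c t x ≤
      ∫⁻ s in Set.Ioc a c, ENNReal.ofReal (c0 d * (t - s) ^ (-(1 / 2 : ℝ))) * ∫⁻ y, ‖F s y‖ₑ := by
  have hF' : Measurable fun z : ℝ × Euc d => F z.1 z.2 := hF
  have : Measurable fun p : Euc d × (ℝ × Euc d) => F p.2.1 p.2.2 := hF'.comp measurable_snd
  unfold DM
  rw [lintegral_lintegral_swap (by unfold Function.uncurry; fun_prop),
    ← slab_lint (by fun_prop) (by unfold Function.uncurry; fun_prop)]
  refine lintegral_mono_ae ?_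
  filter_upwards [slab_lt hct] with z hz
  rw [lintegral_mul_const _ (by fun_prop), lintegral_sub_right_eq_self (fun x => ‖gradHeat d _ x‖ₑ)]
  gcongr
  exact gradHeat_lint (by linarith [hz.2])

theorem gradHeat_lr {r u : ℝ} (hr : 1 ≤ r) (hu : 0 < u) :
    ∫⁻ x, ‖gradHeat d u x‖ₑ ^ r ≤
      ENNReal.ofReal (c0 d * u ^ (-(1 / 2 + (d : ℝ) / 2 * (1 - 1 / r)))) ^ r := by
  have hc := c0_pos d
  have hr0 : 0 < r := by linarith
  calc _ ≤ ∫⁻ x, ENNReal.ofReal (c0 d * u ^ (-(1 / 2 : ℝ))) ^ r *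
        ENNReal.ofReal (heatKernel d (2 * u) x) ^ r := by
        refine lintegral_mono fun x => ?_
        dsimp only
        rw [← ENNReal.mul_rpow_of_nonneg _ _ hr0.le, ← ENNReal.ofReal_mul (by positivity), ← ofReal_norm]
        exact ENNReal.rpow_le_rpow (ENNReal.ofReal_le_ofReal (gradHeat_norm_le hu x)) hr0.le
    _ = ENNReal.ofReal (c0 d * u ^ (-(1 / 2 : ℝ))) ^ r *
        ∫⁻ x, ENNReal.ofReal (heatKernel d (2 * u) x) ^ r := lintegral_const_mul _ (by fun_prop)
    _ ≤ ENNReal.ofReal (c0 d * u ^ (-(1 / 2 : ℝ))) ^ r *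
        ENNReal.ofReal (u ^ (-((d : ℝ) / 2) * (r - 1))) := by
        gcongr
        refine (hk_lr (by positivity) hr).trans (ENNReal.ofReal_le_ofReal ?_)
        refine Real.rpow_le_rpow_of_nonpos hu (by linarith) ?_
        have : 0 ≤ (d:ℝ) / 2 * (r - 1) := mul_nonneg (by positivity) (by linarith)
        linarith
    _ = _ := by
        rw [ENNReal.ofReal_rpow_of_nonneg (by positivity) hr0.le,
          ENNReal.ofReal_rpow_of_nonneg (by positivity) hr0.le, ← ENNReal.ofReal_mul (by positivity),
          Real.mul_rpow hc.le (by positivity), Real.mul_rpow hc.le (by positivity),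
          ← Real.rpow_mul hu.le, ← Real.rpow_mul hu.le, mul_assoc, ← Real.rpow_add hu]
        congr 3
        field_simp; ring

theorem DM_lr {F : ℝ → Euc d → Euc d} (hF : Measurable (Function.uncurry F)) {a c t r : ℝ}
    (hct : c ≤ t) (hr : 1 < r) :
    ∫⁻ x, DM F a c t x ^ r ≤
      (∫⁻ s in Set.Ioc a c, ENNReal.ofReal (c0 d * (t - s) ^ (-(1 / 2 + (d : ℝ) / 2 * (1 - 1 / r)))) *
        ∫⁻ y, ‖F s y‖ₑ) ^ r := by
  have hF' : Measurable fun z : ℝ × Euc d => F z.1 z.2 := hF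
  rw [← slab_lint (by fun_prop) (by unfold Function.uncurry; fun_prop)]
  have key := mink (μ := slab d a c) (ν := (volume : Measure (Euc d)))
    (k := fun z x => ‖gradHeat d (t - z.1) (x - z.2)‖ₑ) hr
    (by unfold Function.uncurry; fun_prop) (φ := fun z => ‖F z.1 z.2‖ₑ) (by fun_prop)
    (a := fun z => ENNReal.ofReal (c0 d * (t - z.1) ^ (-(1 / 2 + (d : ℝ) / 2 * (1 - 1 / r)))))
    (by fun_prop) ?_
  · exact key
  filter_upwards [slab_lt hct] with z hz
  have h0 : 0 < t - z.1 := by linarith [hz.2]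
  refine ⟨?_, ENNReal.ofReal_ne_top, ?_⟩
  · have := c0_pos d
    rw [ENNReal.ofReal_ne_zero_iff]; positivity
  · rw [lintegral_sub_right_eq_self (fun x => ‖gradHeat d _ x‖ₑ ^ r)]
    exact gradHeat_lr hr.le h0

theorem Duh_le {F : ℝ → Euc d → Euc d} (hF : Measurable (Function.uncurry F)) (a c t : ℝ) (x : Euc d) :
    ‖Duh F a c t x‖ₑ ≤ DM F a c t x := by
  have hF' : Measurable fun z : ℝ × Euc d => F z.1 z.2 := hF
  unfold Duh DM
  rw [lintegral_prod _ (by fun_prop)]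
  refine (enorm_integral_le_lintegral_enorm _).trans (lintegral_mono fun s => ?_)
  refine (enorm_integral_le_lintegral_enorm _).trans (lintegral_mono fun y => ?_)
  exact enorm_inner_le' _ _

theorem Duh_int {F : ℝ → Euc d → Euc d} (hF : Measurable (Function.uncurry F)) {a c t : ℝ} {x : Euc d}
    (h : DM F a c t x ≠ ⊤) : Integrable (fun z : ℝ × Euc d =>
      (inner ℝ (gradHeat d (t - z.1) (x - z.2)) (F z.1 z.2) : ℝ)) (slab d a c) := by
  have hF' : Measurable fun z : ℝ × Euc d => F z.1 z.2 := hF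
  refine ⟨(by fun_prop : Measurable _).aestronglyMeasurable, ?_⟩
  refine lt_of_le_of_lt (lintegral_mono fun z => enorm_inner_le' _ _) (lt_top_iff_ne_top.2 h)

theorem Duh_eq {F : ℝ → Euc d → Euc d} (hF : Measurable (Function.uncurry F)) {a c t : ℝ} {x : Euc d}
    (h : DM F a c t x ≠ ⊤) : Duh F a c t x = ∫ z : ℝ × Euc d,
      (inner ℝ (gradHeat d (t - z.1) (x - z.2)) (F z.1 z.2) : ℝ) ∂(slab d a c) := by
  rw [integral_prod _ (Duh_int hF h)]; rfl

theorem Duh_meas {F : ℝ → Euc d → Euc d} (hF : Measurable (Function.uncurry F)) (a : ℝ) :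
    Measurable (fun p : ℝ × Euc d => Duh F a p.1 p.1 p.2) := by
  have hF' : Measurable fun z : ℝ × Euc d => F z.1 z.2 := hF
  have h1 : StronglyMeasurable (fun q : (ℝ × Euc d) × ℝ => Set.indicator {q : (ℝ × Euc d) × ℝ | q.2 ∈ Set.Ioc a q.1.1} (fun q =>
      ∫ y, (inner ℝ (gradHeat d (q.1.1 - q.2) (q.1.2 - y)) (F q.2 y) : ℝ)) q) := by
    refine StronglyMeasurable.indicator ?_ ?_
    · refine StronglyMeasurable.integral_prod_right' (f := fun p : ((ℝ × Euc d) × ℝ) × Euc d =>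
        (inner ℝ (gradHeat d (p.1.1.1 - p.1.2) (p.1.1.2 - p.2)) (F p.1.2 p.2) : ℝ)) ?_
      refine Measurable.stronglyMeasurable ?_
      have : Measurable fun p : ((ℝ × Euc d) × ℝ) × Euc d => F p.1.2 p.2 :=
        hF'.comp (by fun_prop : Measurable fun p : ((ℝ × Euc d) × ℝ) × Euc d => (p.1.2, p.2))
      fun_prop
    · exact (measurableSet_lt measurable_const measurable_snd).inter
        (measurableSet_le measurable_snd (measurable_fst.comp measurable_fst))
  have h2 := h1.integral_prod_right' (ν := volume)
  convert h2.measurable using 1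
  ext p
  unfold Duh
  rw [← integral_indicator measurableSet_Ioc]
  rfl

theorem Duh_sub {F G : ℝ → Euc d → Euc d} (hF : Measurable (Function.uncurry F))
    (hG : Measurable (Function.uncurry G)) {a c t : ℝ} {x : Euc d}
    (h1 : DM F a c t x ≠ ⊤) (h2 : DM G a c t x ≠ ⊤) :
    Duh F a c t x - Duh G a c t x = Duh (fun s y => F s y - G s y) a c t x := by
  have hF' : Measurable fun z : ℝ × Euc d => F z.1 z.2 := hF
  have hG' : Measurable fun z : ℝ × Euc d => G z.1 z.2 := hG
  have h3 : DM (fun s y => F s y - G s y) a c t x ≠ ⊤ := by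
    refine ne_top_of_le_ne_top (ENNReal.add_ne_top.2 ⟨h1, h2⟩) ?_
    unfold DM
    rw [← lintegral_add_left (by fun_prop)]
    refine lintegral_mono fun z => ?_
    dsimp only
    rw [← mul_add]
    gcongr
    exact enorm_sub_le
  rw [Duh_eq hF h1, Duh_eq hG h2, Duh_eq (by unfold Function.uncurry; fun_prop) h3,
    ← integral_sub (Duh_int hF h1) (Duh_int hG h2)]
  simp_rw [inner_sub_right]

theorem slab_union {a b c : ℝ} (hab : a ≤ b) (hbc : b ≤ c) :
    slab d a c = slab d a b + slab d b c := by
  unfold slab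
  rw [← Set.Ioc_union_Ioc_eq_Ioc hab hbc, Measure.restrict_union (Set.Ioc_disjoint_Ioc_of_le le_rfl)
    measurableSet_Ioc, Measure.add_prod]

theorem Duh_split {F : ℝ → Euc d → Euc d} (hF : Measurable (Function.uncurry F)) {a b c t : ℝ}
    (hab : a ≤ b) (hbc : b ≤ c) {x : Euc d} (h : DM F a c t x ≠ ⊤) :
    Duh F a c t x = Duh F a b t x + Duh F b c t x := by
  have e : DM F a c t x = DM F a b t x + DM F b c t x := by
    unfold DM; rw [slab_union hab hbc, lintegral_add_measure]
  rw [e] at h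
  obtain ⟨h1, h2⟩ := ENNReal.add_ne_top.1 h
  rw [Duh_eq hF h1, Duh_eq hF h2, Duh_eq hF (by rw [e]; exact h), slab_union hab hbc,
    integral_add_measure (Duh_int hF h1) (Duh_int hF h2)]

theorem gradHeat_semi' {s t : ℝ} (hs : 0 < s) (ht : 0 < t) (x w : Euc d) :
    ∫ y, heatKernel d s (x - y) • gradHeat d t (y - w) = gradHeat d (s + t) (x - w) := by
  rw [← gradHeat_semi hs ht (x - w),
    ← integral_add_right_eq_self (fun y => heatKernel d s (x - y) • gradHeat d t (y - w)) w]
  congr 1; ext1 y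
  rw [add_sub_cancel_right, show x - (y + w) = x - w - y by abel]

theorem Duh_conv {F : ℝ → Euc d → Euc d} (hF : Measurable (Function.uncurry F)) {a c t : ℝ}
    (hct : c < t) (h : ∫⁻ x, DM F a c c x ≠ ⊤) (x : Euc d) :
    conv (heatKernel d (t - c)) (Duh F a c c) x = Duh F a c t x ∧ DM F a c t x ≠ ⊤ := by
  have hF' : Measurable fun z : ℝ × Euc d => F z.1 z.2 := hF
  have hu : 0 < t - c := by linarith
  have hfin := ae_lt_top (DM_meas hF a c c) h
  have hF2 : Measurable fun p : Euc d × (ℝ × Euc d) => F p.2.1 p.2.2 := hF'.comp measurable_snd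
  have bnd : ∫⁻ y, ∫⁻ z, ‖heatKernel d (t - c) (x - y)‖ₑ * (‖gradHeat d (c - z.1) (y - z.2)‖ₑ *
      ‖F z.1 z.2‖ₑ) ∂(slab d a c) < ⊤ := by
    calc _ ≤ ∫⁻ y, ENNReal.ofReal ((4 * π * (t - c)) ^ (-(d : ℝ) / 2)) * DM F a c c y := by
          refine lintegral_mono fun y => ?_
          dsimp only
          unfold DM
          rw [lintegral_const_mul _ (by fun_prop), hk_enorm hu]
          gcongr
          exact hk_le hu _
      _ = _ := lintegral_const_mul' _ _ ENNReal.ofReal_ne_top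
      _ < ⊤ := ENNReal.mul_lt_top ENNReal.ofReal_lt_top (lt_top_iff_ne_top.2 h)
  have hI : Integrable (Function.uncurry fun (y : Euc d) (z : ℝ × Euc d) =>
      heatKernel d (t - c) (x - y) * (inner ℝ (gradHeat d (c - z.1) (y - z.2)) (F z.1 z.2) : ℝ))
      (volume.prod (slab d a c)) := by
    refine ⟨Measurable.aestronglyMeasurable (by unfold Function.uncurry; fun_prop), ?_⟩
    unfold HasFiniteIntegral
    rw [lintegral_prod _ (by unfold Function.uncurry; fun_prop)]
    refine lt_of_le_of_lt (lintegral_mono fun y => lintegral_mono fun z => ?_) bnd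
    simp only [Function.uncurry, enorm_mul]
    gcongr
    exact enorm_inner_le' _ _
  have hz : ∀ᵐ z ∂(slab d a c), gradHeat d (t - z.1) (x - z.2) =
      ∫ y, heatKernel d (t - c) (x - y) • gradHeat d (c - z.1) (y - z.2) := by
    filter_upwards [slab_lt (le_refl c)] with z hz
    rw [gradHeat_semi' hu (by linarith [hz.2])]
    congr 1; ring
  have hD : DM F a c t x ≠ ⊤ := by
    refine ne_top_of_le_ne_top bnd.ne ?_
    rw [lintegral_lintegral_swap (by unfold Function.uncurry; fun_prop)]
    unfold DM
    refine lintegral_mono_ae ?_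
    filter_upwards [hz] with z hz
    rw [hz]
    simp_rw [← mul_assoc]
    rw [lintegral_mul_const _ (by fun_prop)]
    gcongr
    refine (enorm_integral_le_lintegral_enorm _).trans (le_of_eq ?_)
    simp_rw [enorm_smul]
  refine ⟨?_, hD⟩
  rw [Duh_eq hF hD]
  unfold conv
  calc _ = ∫ y, ∫ z, heatKernel d (t - c) (x - y) *
        (inner ℝ (gradHeat d (c - z.1) (y - z.2)) (F z.1 z.2) : ℝ) ∂(slab d a c) := by
        refine integral_congr_ae ?_
        filter_upwards [hfin] with y hy
        rw [integral_const_mul, Duh_eq hF hy.ne]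
    _ = ∫ z, (∫ y, heatKernel d (t - c) (x - y) *
        (inner ℝ (gradHeat d (c - z.1) (y - z.2)) (F z.1 z.2) : ℝ)) ∂(slab d a c) :=
        integral_integral_swap hI
    _ = _ := by
        refine integral_congr_ae ?_
        filter_upwards [hz, slab_lt (le_refl c)] with z hz hz2
        rw [hz, real_inner_comm, ← integral_inner]
        · congr 1; ext1 y
          rw [real_inner_smul_right, real_inner_comm]
        · have : Integrable fun y => gradHeat d (c - z.1) (y - z.2) :=
            (gradHeat_integrable (by linarith [hz2.2])).comp_sub_right z.2
          refine this.bdd_smul (𝕜 := ℝ) (C := (4 * π * (t - c)) ^ (-(d : ℝ) / 2)) ?_ ?_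
          · exact Measurable.aestronglyMeasurable (by fun_prop)
          · refine Eventually.of_forall fun y => ?_
            rw [Real.norm_of_nonneg (hk_pos hu _).le]
            exact hk_le hu _

end duh


section p5
variable {d : ℕ}

/-- the `L^r` norm -/
abbrev NN {d : ℕ} {ε : Type*} [ENorm ε] (r : ℝ) (f : Euc d → ε) : ℝ≥0∞ := eLpNorm' f r volume

theorem NN_pow {r : ℝ} (hr : 0 < r) {ε : Type*} [ENorm ε] (f : Euc d → ε) :
    ∫⁻ x, ‖f x‖ₑ ^ r = NN r f ^ r := lintegral_rpow_enorm_eq_rpow_eLpNorm' hr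

theorem NN_le {r : ℝ} (hr : 0 < r) {ε : Type*} [ENorm ε] {f : Euc d → ε} {A : ℝ≥0∞}
    (h : ∫⁻ x, ‖f x‖ₑ ^ r ≤ A ^ r) : NN r f ≤ A := by
  rw [NN_pow hr] at h
  exact (ENNReal.rpow_le_rpow_iff hr).1 h

theorem NN_mono {r : ℝ} (hr : 0 < r) {ε ε' : Type*} [ENorm ε] [ENorm ε'] {f : Euc d → ε}
    {g : Euc d → ε'} (h : ∀ᵐ x, ‖f x‖ₑ ≤ ‖g x‖ₑ) : NN r f ≤ NN r g := by
  refine NN_le hr ?_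
  rw [← NN_pow hr]
  refine lintegral_mono_ae ?_
  filter_upwards [h] with x hx
  exact ENNReal.rpow_le_rpow hx hr.le

theorem NN_congr {r : ℝ} {ε : Type*} [ENorm ε] {f g : Euc d → ε} (h : f =ᵐ[volume] g) :
    NN r f = NN r g := by
  simp only [eLpNorm'_eq_lintegral_enorm]
  congr 1
  refine lintegral_congr_ae ?_
  filter_upwards [h] with x hx
  rw [hx]

theorem NN_one {ε : Type*} [ENorm ε] (f : Euc d → ε) : NN 1 f = ∫⁻ x, ‖f x‖ₑ := by
  simp [eLpNorm'_eq_lintegral_enorm]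

theorem NN_ae0 {r : ℝ} (hr : 0 < r) {f : Euc d → ℝ≥0∞} (hf : Measurable f) (h : NN r f = 0) :
    f =ᵐ[volume] 0 := by
  have h1 := NN_pow hr f
  rw [h, ENNReal.zero_rpow_of_pos hr, lintegral_eq_zero_iff (by fun_prop)] at h1
  filter_upwards [h1] with x hx
  simpa [hr, hr.le, hr.not_gt] using hx

theorem HH_zero {g : Euc d → ℝ≥0∞} (h : g =ᵐ[volume] 0) (x : Euc d) : HH g x = 0 := by
  unfold HH
  rw [lintegral_congr_ae (g := 0)]
  · simp
  filter_upwards [h] with y hy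
  simp [hy]

theorem HH_congr {f g : Euc d → ℝ≥0∞} (h : f =ᵐ[volume] g) (x : Euc d) : HH f x = HH g x := by
  unfold HH
  refine lintegral_congr_ae ?_
  filter_upwards [h] with y hy
  rw [hy]

theorem hls' (hd : 2 ≤ d) : ∃ C : ℝ, 0 < C ∧ ∀ f g : Euc d → ℝ≥0∞, AEMeasurable f → AEMeasurable g →
    ∫⁻ x, f x * HH g x ≤ ENNReal.ofReal C * NN (pe d) f * NN (pe d) g := by
  obtain ⟨C, hC, H⟩ := hls hd
  have hp : 0 < pe d := by linarith [(pe_facts hd).1]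
  refine ⟨C, hC, ?_⟩
  suffices h : ∀ f g : Euc d → ℝ≥0∞, Measurable f → Measurable g →
    ∫⁻ x, f x * HH g x ≤ ENNReal.ofReal C * NN (pe d) f * NN (pe d) g by
    intro f g hf hg
    have h1 := h _ _ hf.measurable_mk hg.measurable_mk
    rw [← NN_congr hf.ae_eq_mk, ← NN_congr hg.ae_eq_mk] at h1
    refine le_trans (le_of_eq ?_) h1
    refine lintegral_congr_ae ?_
    filter_upwards [hf.ae_eq_mk] with x hx
    rw [hx, HH_congr hg.ae_eq_mk]
  intro f g hf hg
  by_cases f0 : NN (pe d) f = 0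
  · rw [lintegral_congr_ae (g := 0)]
    · simp
    filter_upwards [NN_ae0 hp hf f0] with y hy
    simp [hy]
  by_cases g0 : NN (pe d) g = 0
  · simp [HH_zero (NN_ae0 hp hg g0)]
  have hC0 : ENNReal.ofReal C ≠ 0 := by simpa using hC
  by_cases ft : NN (pe d) f = ⊤
  · rw [ft, ENNReal.mul_top hC0, ENNReal.top_mul g0]; exact le_top
  by_cases gt : NN (pe d) g = ⊤
  · rw [gt, ENNReal.mul_top (mul_ne_zero hC0 f0)]; exact le_top
  exact H f g hf hg _ _ f0 ft g0 gt (by rw [← NN_pow hp]; rfl) (by rw [← NN_pow hp]; rfl)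

def FF (u : ℝ → Euc d → ℝ) (s : ℝ) (y : Euc d) : Euc d := u s y • gradc d (u s) y

theorem mildRHS_eq (ρ₀ : Euc d → ℝ) (u : ℝ → Euc d → ℝ) (t : ℝ) (x : Euc d) :
    mildRHS d ρ₀ u t x = conv (heatKernel d t) ρ₀ x - Duh (FF u) 0 t t x := rfl

theorem gradc_meas {u : ℝ → Euc d → ℝ} (hu : Measurable (Function.uncurry u)) :
    Measurable (Function.uncurry fun s y => gradc d (u s) y) := by
  have hu' : Measurable fun z : ℝ × Euc d => u z.1 z.2 := hu
  unfold gradc Function.uncurry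
  refine Measurable.fun_const_smul (c := (-(1 / (d * Real.pi)) : ℝ)) ?_
  refine (StronglyMeasurable.integral_prod_right' (f := fun p : (ℝ × Euc d) × Euc d =>
    (u p.1.1 p.2 / ‖p.1.2 - p.2‖ ^ 2) • (p.1.2 - p.2)) ?_).measurable
  refine Measurable.stronglyMeasurable ?_
  have : Measurable fun p : (ℝ × Euc d) × Euc d => u p.1.1 p.2 :=
    hu'.comp (by fun_prop : Measurable fun p : (ℝ × Euc d) × Euc d => (p.1.1, p.2))
  fun_prop

theorem FF_meas {u : ℝ → Euc d → ℝ} (hu : Measurable (Function.uncurry u)) :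
    Measurable (Function.uncurry (FF u)) := by
  have := gradc_meas hu
  unfold Function.uncurry FF at *
  fun_prop

theorem kk_enorm (f : Euc d → ℝ) (x y : Euc d) :
    ‖(f y / ‖x - y‖ ^ 2) • (x - y)‖ₑ = kk (x - y) * ‖f y‖ₑ := by
  unfold kk
  rw [← ofReal_norm, ← ofReal_norm, ← ENNReal.ofReal_mul (by positivity), norm_smul, norm_div, norm_pow, norm_norm]
  congr 1
  rcases eq_or_ne ‖x - y‖ 0 with h | h
  · simp [h]
  · field_simp

theorem gradc_le (hd : 1 ≤ d) (f : Euc d → ℝ) (x : Euc d) :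
    ‖gradc d f x‖ₑ ≤ HH (fun y => ‖f y‖ₑ) x := by
  unfold gradc HH
  rw [enorm_smul]
  have h1 : ‖-(1 / ((d:ℝ) * π))‖ₑ ≤ 1 := by
    rw [← ofReal_norm, ← ENNReal.ofReal_one, norm_neg, Real.norm_of_nonneg (by positivity)]
    refine ENNReal.ofReal_le_ofReal ?_
    have : (1:ℝ) ≤ d := by exact_mod_cast hd
    rw [div_le_one (by positivity)]
    nlinarith [Real.pi_gt_three]
  calc _ ≤ 1 * ∫⁻ y, ‖(f y / ‖x - y‖ ^ 2) • (x - y)‖ₑ :=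
        mul_le_mul' h1 (enorm_integral_le_lintegral_enorm _)
    _ = _ := by simp_rw [one_mul, kk_enorm]

theorem gradc_congr {f g : Euc d → ℝ} (h : f =ᵐ[volume] g) (x : Euc d) : gradc d f x = gradc d g x := by
  unfold gradc
  congr 1
  refine integral_congr_ae ?_
  filter_upwards [h] with y hy
  rw [hy]

theorem FF_congr {u v : ℝ → Euc d → ℝ} {s : ℝ} (h : u s =ᵐ[volume] v s) :
    FF u s =ᵐ[volume] FF v s := by
  filter_upwards [h] with y hy
  unfold FF
  rw [hy, gradc_congr h]

theorem Duh_congr {F G : ℝ → Euc d → Euc d} {a c : ℝ} (h : ∀ s ∈ Set.Ioc a c, F s =ᵐ[volume] G s)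
    (t : ℝ) (x : Euc d) : Duh F a c t x = Duh G a c t x := by
  unfold Duh
  refine setIntegral_congr_fun measurableSet_Ioc fun s hs => ?_
  refine integral_congr_ae ?_
  filter_upwards [h s hs] with y hy
  rw [hy]

theorem HH_fin (hd : 2 ≤ d) {g : Euc d → ℝ≥0∞} (hg : AEMeasurable g) (h : NN (pe d) g ≠ ⊤) :
    ∀ᵐ x, HH g x < ⊤ := by
  wlog hm : Measurable g generalizing g
  · have := this hg.measurable_mk.aemeasurable (by rwa [← NN_congr hg.ae_eq_mk]) hg.measurable_mk
    simpa only [HH_congr hg.ae_eq_mk] using this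
  obtain ⟨C, hC, H⟩ := hls' hd
  have hp : 1 < pe d := (pe_facts hd).1
  have h1 := H (fun x => ENNReal.ofReal (heatKernel d 1 x)) g (by fun_prop) hg
  have h2 : NN (pe d) (fun x : Euc d => ENNReal.ofReal (heatKernel d 1 x)) ≤ 1 := by
    refine NN_le (by linarith) ?_
    simpa using hk_lr (d := d) one_pos hp.le
  have h3 : Measurable (HH g) := by
    unfold HH
    refine Measurable.lintegral_prod_right' (f := fun p : Euc d × Euc d => kk (p.1 - p.2) * g p.2) ?_
    fun_prop
  have h4 : ∫⁻ x, ENNReal.ofReal (heatKernel d 1 x) * HH g x ≠ ⊤ := by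
    refine ne_top_of_le_ne_top ?_ h1
    refine ENNReal.mul_ne_top (ENNReal.mul_ne_top ENNReal.ofReal_ne_top ?_) h
    exact ne_top_of_le_ne_top ENNReal.one_ne_top h2
  filter_upwards [ae_lt_top (by fun_prop) h4] with x hx
  rw [lt_top_iff_ne_top] at hx ⊢
  intro h5
  rw [h5, ENNReal.mul_top] at hx
  · exact hx rfl
  · simpa using hk_pos one_pos x

theorem gradc_int {f : Euc d → ℝ} (hf : AEMeasurable f) {x : Euc d}
    (h : HH (fun y => ‖f y‖ₑ) x < ⊤) : Integrable fun y => (f y / ‖x - y‖ ^ 2) • (x - y) := by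
  refine ⟨AEMeasurable.aestronglyMeasurable (by fun_prop), ?_⟩
  unfold HasFiniteIntegral
  simp_rw [kk_enorm]
  exact h

theorem gradc_sub {f g : Euc d → ℝ} (hf : AEMeasurable f) (hg : AEMeasurable g) {x : Euc d}
    (h : HH (fun y => ‖f y‖ₑ) x < ⊤) (h' : HH (fun y => ‖g y‖ₑ) x < ⊤) :
    gradc d f x - gradc d g x = gradc d (fun y => f y - g y) x := by
  unfold gradc
  rw [← smul_sub, ← integral_sub (gradc_int hf h) (gradc_int hg h')]
  simp_rw [sub_div, sub_smul]

theorem NN_en {r : ℝ} (f : Euc d → ℝ) : NN r (fun x => ‖f x‖ₑ) = NN r f := by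
  simp only [eLpNorm'_eq_lintegral_enorm, enorm_enorm]

theorem F_l1 (hd : 2 ≤ d) : ∃ C : ℝ, 0 < C ∧ ∀ f g : Euc d → ℝ, AEMeasurable f → AEMeasurable g →
    ∫⁻ x, ‖f x • gradc d g x‖ₑ ≤ ENNReal.ofReal C * NN (pe d) f * NN (pe d) g := by
  obtain ⟨C, hC, H⟩ := hls' hd
  refine ⟨C, hC, fun f g hf hg => ?_⟩
  rw [← NN_en f, ← NN_en g]
  refine le_trans (lintegral_mono fun x => ?_) (H _ _ (by fun_prop) (by fun_prop))
  rw [enorm_smul]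
  gcongr
  exact gradc_le (by omega) _ _

theorem F_diff (hd : 2 ≤ d) : ∃ C : ℝ, 0 < C ∧ ∀ f g : Euc d → ℝ, Measurable f → Measurable g →
    NN (pe d) f ≠ ⊤ → NN (pe d) g ≠ ⊤ →
    ∫⁻ x, ‖f x • gradc d f x - g x • gradc d g x‖ₑ ≤
      ENNReal.ofReal C * (NN (pe d) f + NN (pe d) g) * NN (pe d) (fun x => f x - g x) := by
  obtain ⟨C, hC, H⟩ := F_l1 hd
  refine ⟨C, hC, fun f g hf hg hft hgt => ?_⟩
  have hfm := HH_fin hd (g := fun x => ‖f x‖ₑ) (by fun_prop) (by rwa [NN_en])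
  have hgm := HH_fin hd (g := fun x => ‖g x‖ₑ) (by fun_prop) (by rwa [NN_en])
  have m1 : Measurable fun x => gradc d f x := by
    have h := gradc_meas (u := fun _ => f) (hf.comp measurable_snd)
    have h2 := h.comp (measurable_prodMk_left (x := (0:ℝ)))
    exact h2
  calc _ ≤ ∫⁻ x, (‖(f x - g x) • gradc d f x‖ₑ + ‖g x • gradc d (fun y => f y - g y) x‖ₑ) := by
        refine lintegral_mono_ae ?_
        filter_upwards [hfm, hgm] with x h1 h2
        rw [← gradc_sub hf.aemeasurable hg.aemeasurable h1 h2]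
        refine le_trans (le_of_eq ?_) (enorm_add_le _ _)
        congr 1
        module
    _ = (∫⁻ x, ‖(f x - g x) • gradc d f x‖ₑ) + ∫⁻ x, ‖g x • gradc d (fun y => f y - g y) x‖ₑ :=
        lintegral_add_left (by fun_prop) _
    _ ≤ _ := add_le_add (H (fun x => f x - g x) f (by fun_prop) (by fun_prop))
        (H g (fun y => f y - g y) (by fun_prop) (by fun_prop))
    _ = _ := by ring

/-- heat exponent -/
def ka (d : ℕ) (r : ℝ) : ℝ := (d : ℝ) / 2 * (1 - 1 / r)

theorem ka_pe (hd : 2 ≤ d) : ka d (pe d) = 1 / 4 := by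
  unfold ka pe
  have : (2:ℝ) ≤ d := by exact_mod_cast hd
  have h2 : (2:ℝ) * d - 1 ≠ 0 := by linarith
  field_simp
  ring

theorem ka_one : ka d 1 = 0 := by simp [ka]

theorem ka_nonneg {r : ℝ} (hr : 1 ≤ r) : 0 ≤ ka d r := by
  unfold ka
  have : 1 / r ≤ 1 := (div_le_one (by linarith)).2 hr
  exact mul_nonneg (by positivity) (by linarith)

theorem hconv_NN {t r : ℝ} (ht : 0 < t) (hr : 1 ≤ r) {g : Euc d → ℝ} (hg : AEMeasurable g) :
    NN r (conv (heatKernel d t) g) ≤ ENNReal.ofReal (t ^ (-ka d r)) * ∫⁻ y, ‖g y‖ₑ := by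
  refine NN_le (by linarith) ((hconv_lr ht hr hg le_rfl).trans (le_of_eq ?_))
  rw [ENNReal.mul_rpow_of_nonneg _ _ (by linarith), ENNReal.ofReal_rpow_of_nonneg (by positivity) (by linarith),
    ← Real.rpow_mul ht.le]
  congr 3
  have : r ≠ 0 := by linarith
  unfold ka; field_simp

theorem DM_NN {F : ℝ → Euc d → Euc d} (hF : Measurable (Function.uncurry F)) {a c t r : ℝ}
    (hct : c ≤ t) (hr : 1 ≤ r) :
    NN r (DM F a c t) ≤
      ∫⁻ s in Set.Ioc a c, ENNReal.ofReal (c0 d * (t - s) ^ (-(1 / 2 + ka d r))) * ∫⁻ y, ‖F s y‖ₑ := by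
  rcases hr.eq_or_lt with rfl | hr
  · rw [NN_one, ka_one, add_zero]
    exact DM_l1 hF hct
  · exact NN_le (by linarith) (DM_lr hF hct hr)

theorem DM_crit {r : ℝ} (hr : 1 ≤ r) (hk : ka d r < 1 / 2) : ∃ C : ℝ, 0 < C ∧
    ∀ F : ℝ → Euc d → Euc d, Measurable (Function.uncurry F) → ∀ (t : ℝ) (B : ℝ≥0∞), 0 < t →
    (∀ s ∈ Set.Ioc 0 t, ∫⁻ y, ‖F s y‖ₑ ≤ B * ENNReal.ofReal (s ^ (-(1 / 2 : ℝ)))) →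
    NN r (DM F 0 t t) ≤ ENNReal.ofReal (C * t ^ (-ka d r)) * B := by
  have h0 := ka_nonneg (d := d) hr
  have hc := c0_pos d
  obtain ⟨C, hC, H⟩ := ti_both (a := 1 / 2 + ka d r) (b := 1 / 2) (by linarith) (by linarith)
    (by norm_num) (by norm_num)
  refine ⟨c0 d * C, by positivity, fun F hF t B ht hB => (DM_NN hF le_rfl hr).trans ?_⟩
  calc _ ≤ ∫⁻ s in Set.Ioc 0 t, ENNReal.ofReal (c0 d) * B *
        (ENNReal.ofReal ((t - s) ^ (-(1 / 2 + ka d r))) * ENNReal.ofReal (s ^ (-(1 / 2 : ℝ)))) := by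
        refine setLIntegral_mono' measurableSet_Ioc fun s hs => ?_
        refine (mul_le_mul_right (hB s hs) _).trans (le_of_eq ?_)
        rw [ENNReal.ofReal_mul hc.le]; ring
    _ = ENNReal.ofReal (c0 d) * B * ∫⁻ s in Set.Ioc 0 t,
        (ENNReal.ofReal ((t - s) ^ (-(1 / 2 + ka d r))) * ENNReal.ofReal (s ^ (-(1 / 2 : ℝ)))) :=
        lintegral_const_mul _ (by fun_prop)
    _ ≤ ENNReal.ofReal (c0 d) * B * ENNReal.ofReal (C * t ^ (1 - (1 / 2 + ka d r) - 1 / 2)) := by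
        gcongr; exact H t ht
    _ = _ := by
        rw [show 1 - (1 / 2 + ka d r) - 1 / 2 = - ka d r by ring, mul_assoc (c0 d), ENNReal.ofReal_mul hc.le]
        ring

theorem DM_const {r : ℝ} (hr : 1 ≤ r) (hk : ka d r < 1 / 2) : ∃ C : ℝ, 0 < C ∧
    ∀ F : ℝ → Euc d → Euc d, Measurable (Function.uncurry F) → ∀ (a t : ℝ) (B : ℝ≥0∞), a ≤ t →
    (∀ s ∈ Set.Ioc a t, ∫⁻ y, ‖F s y‖ₑ ≤ B) →
    NN r (DM F a t t) ≤ ENNReal.ofReal (C * (t - a) ^ (1 / 2 - ka d r)) * B := by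
  have h0 := ka_nonneg (d := d) hr
  have hc := c0_pos d
  have h1 : 0 < 1 / 2 - ka d r := by linarith
  refine ⟨c0 d / (1 / 2 - ka d r), by positivity, fun F hF a t B hat hB => (DM_NN hF le_rfl hr).trans ?_⟩
  calc _ ≤ ∫⁻ s in Set.Ioc a t, ENNReal.ofReal (c0 d) * B *
        (ENNReal.ofReal ((t - s) ^ (-(1 / 2 + ka d r)))) := by
        refine setLIntegral_mono' measurableSet_Ioc fun s hs => ?_
        refine (mul_le_mul_right (hB s hs) _).trans (le_of_eq ?_)
        rw [ENNReal.ofReal_mul hc.le]; ring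
    _ = ENNReal.ofReal (c0 d) * B * ∫⁻ s in Set.Ioc a t,
        (ENNReal.ofReal ((t - s) ^ (-(1 / 2 + ka d r)))) :=
        lintegral_const_mul _ (by fun_prop)
    _ = _ := by
        rw [ti_right (by linarith) hat, show 1 - (1 / 2 + ka d r) = 1 / 2 - ka d r by ring, mul_right_comm,
          ← ENNReal.ofReal_mul hc.le]
        congr 2; ring

end p5

section p6
variable {d : ℕ}

theorem hconv_int {t : ℝ} (ht : 0 < t) {f : Euc d → ℝ} (hf : Integrable f) (x : Euc d) :
    Integrable fun y => heatKernel d t (x - y) * f y := by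
  refine hf.bdd_mul (c := (4 * π * t) ^ (-(d : ℝ) / 2)) ?_ ?_
  · exact Measurable.aestronglyMeasurable (by fun_prop)
  · refine Eventually.of_forall fun y => ?_
    rw [Real.norm_of_nonneg (hk_pos ht _).le]
    exact hk_le ht _

theorem hconv_sub {t : ℝ} (ht : 0 < t) {f g : Euc d → ℝ} (hf : Integrable f) (hg : Integrable g)
    (x : Euc d) : conv (heatKernel d t) (fun y => f y - g y) x =
      conv (heatKernel d t) f x - conv (heatKernel d t) g x := by
  unfold conv
  rw [← integral_sub (hconv_int ht hf x) (hconv_int ht hg x)]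
  simp_rw [mul_sub]

theorem conv_congr {k f g : Euc d → ℝ} (h : f =ᵐ[volume] g) (x : Euc d) : conv k f x = conv k g x := by
  unfold conv
  refine integral_congr_ae ?_
  filter_upwards [h] with y hy
  rw [hy]

theorem hconv_meas {f : Euc d → ℝ} (hf : AEMeasurable f) :
    Measurable fun p : ℝ × Euc d => conv (heatKernel d p.1) f p.2 := by
  simp_rw [conv_congr hf.ae_eq_mk]
  have := hf.measurable_mk
  unfold conv
  refine (StronglyMeasurable.integral_prod_right' (f := fun p : (ℝ × Euc d) × Euc d =>
    heatKernel d p.1.1 (p.1.2 - p.2) * hf.mk f p.2) ?_).measurable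
  exact Measurable.stronglyMeasurable (by fun_prop)

theorem hconv_integrable {t : ℝ} (ht : 0 < t) {f : Euc d → ℝ} (hf : Integrable f) :
    Integrable (conv (heatKernel d t) f) := by
  refine ⟨((hconv_meas hf.aemeasurable).comp (measurable_prodMk_left (x := t))).aestronglyMeasurable, ?_⟩
  exact lt_of_le_of_lt (hconv_l1 ht hf.aemeasurable) hf.2

theorem hconv_semi {a b : ℝ} (ha : 0 < a) (hb : 0 < b) {f : Euc d → ℝ} (hf : Integrable f) (x : Euc d) :
    conv (heatKernel d a) (conv (heatKernel d b) f) x = conv (heatKernel d (a + b)) f x := by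
  unfold conv
  simp_rw [← integral_const_mul]
  rw [integral_integral_swap]
  · congr 1; ext1 z
    simp_rw [← mul_assoc]
    rw [integral_mul_const]
    congr 1
    rw [← hk_semi ha hb (x - z), ← integral_add_right_eq_self _ z]
    congr 1; ext1 y
    rw [add_sub_cancel_right, show x - (y + z) = x - z - y by abel]
  · have h1 : AEMeasurable (fun p : Euc d × Euc d => f p.2) (volume.prod volume) :=
      hf.aemeasurable.comp_quasiMeasurePreserving Measure.quasiMeasurePreserving_snd
    have h2 : AEMeasurable (Function.uncurry fun y z => heatKernel d a (x - y) * (heatKernel d b (y - z) * f z))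
      (volume.prod volume) := by unfold Function.uncurry; fun_prop
    refine ⟨h2.aestronglyMeasurable, ?_⟩
    unfold HasFiniteIntegral
    rw [lintegral_prod_symm _ (by fun_prop)]
    simp only [Function.uncurry, enorm_mul, ← mul_assoc]
    calc _ = ∫⁻ z, (∫⁻ y, ‖heatKernel d a (x - y)‖ₑ * ‖heatKernel d b (y - z)‖ₑ) * ‖f z‖ₑ := by
          refine lintegral_congr fun z => ?_
          rw [lintegral_mul_const _ (by fun_prop)]
      _ ≤ ∫⁻ z, (ENNReal.ofReal ((4 * π * a) ^ (-(d : ℝ) / 2)) * 1) * ‖f z‖ₑ := by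
          refine lintegral_mono fun z => ?_
          dsimp only
          gcongr
          rw [← hk_lintegral (d := d) hb,
            ← lintegral_sub_right_eq_self (fun y => ENNReal.ofReal (heatKernel d b y)) z, ← lintegral_const_mul _ (by fun_prop)]
          refine lintegral_mono fun y => ?_
          dsimp only
          rw [hk_enorm ha, hk_enorm hb]
          gcongr
          exact hk_le ha _
      _ < ⊤ := by
          rw [lintegral_const_mul' _ _ (by simp)]
          exact ENNReal.mul_lt_top (by simp) hf.2

theorem hk_moment {h : ℝ} (hh : 0 < h) :
    ∫⁻ y : Euc d, ENNReal.ofReal (heatKernel d h y) * ‖y‖ₑ ≤ ENNReal.ofReal (2 * c0 d * h ^ (1 / 2 : ℝ)) := by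
  have e : ∀ y : Euc d, ENNReal.ofReal (heatKernel d h y) * ‖y‖ₑ =
      ENNReal.ofReal (2 * h) * ‖gradHeat d h y‖ₑ := by
    intro y
    have := hk_pos hh y
    rw [gradHeat_eq, ← ofReal_norm, ← ofReal_norm, ← ENNReal.ofReal_mul this.le,
      ← ENNReal.ofReal_mul (by positivity), norm_smul]
    congr 1
    rw [norm_mul, norm_neg, Real.norm_of_nonneg this.le, Real.norm_of_nonneg (by positivity)]
    field_simp
  simp_rw [e]
  rw [lintegral_const_mul _ (by fun_prop)]
  refine (mul_le_mul_right (gradHeat_lint hh) _).trans (le_of_eq ?_)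
  rw [← ENNReal.ofReal_mul (by positivity)]
  congr 1
  have : h ^ (1 / 2 : ℝ) = h * h ^ (-(1 / 2 : ℝ)) := by
    rw [← Real.rpow_one_add' hh.le (by norm_num)]; norm_num
  rw [this]; ring

theorem hk_time {a h : ℝ} (ha : 0 < a) (hh : 0 < h) :
    ∫⁻ x : Euc d, ‖heatKernel d (a + h) x - heatKernel d a x‖ₑ ≤
      ENNReal.ofReal (2 * c0 d ^ 2 * (h ^ (1 / 2 : ℝ) * a ^ (-(1 / 2 : ℝ)))) := by
  have hc := c0_pos d
  calc _ ≤ ∫⁻ x : Euc d, ∫⁻ y, ENNReal.ofReal (heatKernel d h y) *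
        ‖heatKernel d a (x - y) - heatKernel d a x‖ₑ := by
        refine lintegral_mono fun x => ?_
        have e : heatKernel d (a + h) x - heatKernel d a x =
            ∫ y, heatKernel d h y * (heatKernel d a (x - y) - heatKernel d a x) := by
          have i1 : Integrable fun y => heatKernel d a (x - y) * heatKernel d h y :=
            hconv_int ha (hk_integrable hh) x
          simp_rw [mul_sub]
          rw [integral_sub (by simpa only [mul_comm] using i1) ((hk_integrable hh).mul_const _),
            integral_mul_const, hk_integral hh, one_mul, ← hk_semi ha hh x]
          simp_rw [mul_comm]
        rw [e]
        refine (enorm_integral_le_lintegral_enorm _).trans (le_of_eq ?_)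
        simp_rw [enorm_mul, hk_enorm hh]
    _ = ∫⁻ y : Euc d, ENNReal.ofReal (heatKernel d h y) * ∫⁻ x,
        ‖heatKernel d a (x - y) - heatKernel d a x‖ₑ := by
        rw [lintegral_lintegral_swap (by unfold Function.uncurry; fun_prop)]
        refine lintegral_congr fun y => ?_
        rw [lintegral_const_mul _ (by fun_prop)]
    _ ≤ ∫⁻ y : Euc d, ENNReal.ofReal (c0 d * a ^ (-(1 / 2 : ℝ))) *
        (ENNReal.ofReal (heatKernel d h y) * ‖y‖ₑ) := by
        refine lintegral_mono fun y => ?_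
        refine (mul_le_mul_right (hk_shift_lint ha y) _).trans (le_of_eq ?_)
        ring
    _ ≤ ENNReal.ofReal (c0 d * a ^ (-(1 / 2 : ℝ))) * ENNReal.ofReal (2 * c0 d * h ^ (1 / 2 : ℝ)) := by
        rw [lintegral_const_mul _ (by fun_prop)]
        gcongr
        exact hk_moment hh
    _ = _ := by
        rw [← ENNReal.ofReal_mul (by positivity)]
        congr 1; ring

theorem hconv_time {a h : ℝ} (ha : 0 < a) (hh : 0 ≤ h) {f : Euc d → ℝ} (hf : Integrable f) :
    ∫⁻ x, ‖conv (heatKernel d (a + h)) f x - conv (heatKernel d a) f x‖ₑ ≤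
      ENNReal.ofReal (2 * c0 d ^ 2 * (h ^ (1 / 2 : ℝ) * a ^ (-(1 / 2 : ℝ)))) * ∫⁻ x, ‖f x‖ₑ := by
  rcases hh.eq_or_lt with rfl | hh
  · simp
  have e : ∀ x, conv (heatKernel d (a + h)) f x - conv (heatKernel d a) f x =
      conv (fun x => heatKernel d (a + h) x - heatKernel d a x) f x := by
    intro x
    unfold conv
    rw [← integral_sub (hconv_int (by linarith) hf x) (hconv_int ha hf x)]
    simp_rw [sub_mul]
  simp_rw [e]
  refine (conv_lint_le (by fun_prop) hf.aemeasurable).trans ?_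
  gcongr
  exact hk_time ha hh

/-- linear mild solution with flux `F` -/
structure LS (F : ℝ → Euc d → Euc d) (ρ₀ : Euc d → ℝ) (u : ℝ → Euc d → ℝ) (T : ℝ) (B : ℝ≥0∞) : Prop where
  mF : Measurable (Function.uncurry F)
  r0 : Integrable ρ₀
  Bt : B ≠ ⊤
  eq : ∀ t ∈ Set.Ioc 0 T, u t =ᵐ[volume] fun x => conv (heatKernel d t) ρ₀ x - Duh F 0 t t x
  bF : ∀ s ∈ Set.Ioc 0 T, ∫⁻ y, ‖F s y‖ₑ ≤ B * ENNReal.ofReal (s ^ (-(1 / 2 : ℝ)))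

section ls
variable {F : ℝ → Euc d → Euc d} {ρ₀ : Euc d → ℝ} {u : ℝ → Euc d → ℝ} {T : ℝ} {B : ℝ≥0∞}

theorem LS_DM (d : ℕ) : ∃ C : ℝ, 0 < C ∧ ∀ {F : ℝ → Euc d → Euc d} {ρ₀ : Euc d → ℝ} {u : ℝ → Euc d → ℝ} {T : ℝ}
    {B : ℝ≥0∞}, LS F ρ₀ u T B → ∀ t ∈ Set.Ioc 0 T, ∫⁻ x, DM F 0 t t x ≤ ENNReal.ofReal C * B := by
  obtain ⟨C, hC, H⟩ := DM_crit (d := d) le_rfl (by rw [ka_one]; norm_num)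
  refine ⟨C, hC, fun h t ht => ?_⟩
  have := H _ h.mF t _ ht.1 (fun s hs => h.bF s ⟨hs.1, hs.2.trans ht.2⟩)
  rw [NN_one, ka_one] at this
  simpa using this

theorem LS.DMt (h : LS F ρ₀ u T B) {t : ℝ} (ht : t ∈ Set.Ioc 0 T) : ∫⁻ x, DM F 0 t t x ≠ ⊤ := by
  obtain ⟨C, hC, H⟩ := LS_DM d
  exact ne_top_of_le_ne_top (ENNReal.mul_ne_top ENNReal.ofReal_ne_top h.Bt) (H h t ht)

theorem Duh_meas1 (hF : Measurable (Function.uncurry F)) (a t : ℝ) : Measurable (Duh F a t t) :=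
  (Duh_meas hF a).comp (measurable_prodMk_left (x := t))

theorem LS.int_Duh (h : LS F ρ₀ u T B) {t : ℝ} (ht : t ∈ Set.Ioc 0 T) : Integrable (Duh F 0 t t) :=
  ⟨(Duh_meas1 h.mF 0 t).aestronglyMeasurable,
    lt_of_le_of_lt (lintegral_mono (Duh_le h.mF 0 t t)) (lt_top_iff_ne_top.2 (h.DMt ht))⟩

theorem LS.int (h : LS F ρ₀ u T B) {t : ℝ} (ht : t ∈ Set.Ioc 0 T) : Integrable (u t) :=
  ((hconv_integrable ht.1 h.r0).sub (h.int_Duh ht)).congr (h.eq t ht).symm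

theorem LS.restart (h : LS F ρ₀ u T B) {s t : ℝ} (hs : 0 < s) (hst : s < t) (htT : t ≤ T) :
    u t =ᵐ[volume] fun x => conv (heatKernel d (t - s)) (u s) x - Duh F s t t x := by
  have ht : t ∈ Set.Ioc 0 T := ⟨hs.trans hst, htT⟩
  have hs' : s ∈ Set.Ioc 0 T := ⟨hs, hst.le.trans htT⟩
  have hu : 0 < t - s := by linarith
  filter_upwards [h.eq t ht, ae_lt_top (DM_meas h.mF 0 t t) (h.DMt ht)] with x hx hx2
  rw [hx, conv_congr (h.eq s hs') x, hconv_sub hu (hconv_integrable hs h.r0) (h.int_Duh hs'),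
    hconv_semi hu hs h.r0, (Duh_conv h.mF hst (h.DMt hs') x).1, Duh_split h.mF hs.le hst.le hx2.ne]
  rw [sub_add_cancel]; ring

theorem LS.l1 (d : ℕ) : ∃ C : ℝ, 0 < C ∧ ∀ {F : ℝ → Euc d → Euc d} {ρ₀ : Euc d → ℝ} {u : ℝ → Euc d → ℝ} {T : ℝ}
    {B : ℝ≥0∞}, LS F ρ₀ u T B → ∀ t ∈ Set.Ioc 0 T,
      ∫⁻ x, ‖u t x‖ₑ ≤ (∫⁻ x, ‖ρ₀ x‖ₑ) + ENNReal.ofReal C * B := by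
  obtain ⟨C, hC, H⟩ := LS_DM d
  refine ⟨C, hC, fun {F ρ₀ u T B} h t ht => ?_⟩
  have m : Measurable (conv (heatKernel d t) ρ₀) :=
    (hconv_meas h.r0.aemeasurable).comp (measurable_prodMk_left (x := t))
  calc _ ≤ ∫⁻ x, (‖conv (heatKernel d t) ρ₀ x‖ₑ + DM F 0 t t x) := by
        refine lintegral_mono_ae ?_
        filter_upwards [h.eq t ht] with x hx
        rw [hx]
        exact enorm_sub_le.trans (by gcongr; exact Duh_le h.mF _ _ _ _)
    _ = (∫⁻ x, ‖conv (heatKernel d t) ρ₀ x‖ₑ) + ∫⁻ x, DM F 0 t t x := lintegral_add_left (by fun_prop) _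
    _ ≤ _ := add_le_add (hconv_l1 ht.1 h.r0.aemeasurable) (H h t ht)

theorem LS.modulus (h : LS F ρ₀ u T B) {a : ℝ} (ha : 0 < a) {ε : ℝ} (hε : 0 < ε) :
    ∃ δ : ℝ, 0 < δ ∧ ∀ t₁ t₂ : ℝ, a ≤ t₁ → t₁ ≤ t₂ → t₂ ≤ T → t₂ - t₁ ≤ δ →
      ∫⁻ x, ‖u t₂ x - u t₁ x‖ₑ ≤ ENNReal.ofReal ε := by
  obtain ⟨C₁, hC₁, H₁⟩ := LS.l1 d
  obtain ⟨C, hC, H⟩ := DM_const (d := d) le_rfl (by rw [ka_one]; norm_num)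
  have hc := c0_pos d
  set m := (∫⁻ x, ‖ρ₀ x‖ₑ) + ENNReal.ofReal C₁ * B with hm
  have hmt : m ≠ ⊤ := ENNReal.add_ne_top.2 ⟨h.r0.2.ne, ENNReal.mul_ne_top ENNReal.ofReal_ne_top h.Bt⟩
  set f : ℝ → ℝ := fun η => 2 * c0 d ^ 2 * η ^ (1 / 2 : ℝ) * m.toReal +
    2 * (C * (η ^ 2 + η) ^ (1 / 2 : ℝ) * (B.toReal * (a / 2) ^ (-(1 / 2 : ℝ)))) with hf
  have hfc : ContinuousAt f 0 := by
    refine ContinuousAt.add ?_ ?_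
    · exact (continuousAt_const.mul (Real.continuousAt_rpow_const _ _ (by norm_num))).mul continuousAt_const
    · refine continuousAt_const.mul ((continuousAt_const.mul ?_).mul continuousAt_const)
      exact ContinuousAt.rpow_const (by fun_prop) (by norm_num)
  have hf0 : f 0 = 0 := by simp [hf]
  have h1 : ∀ᶠ η in 𝓝[>] (0:ℝ), f η < ε ∧ η < a / 2 ∧ 0 < η := by
    have := hfc.eventually (Iio_mem_nhds (by rw [hf0]; exact hε))
    filter_upwards [nhdsWithin_le_nhds this, nhdsWithin_le_nhds (Iio_mem_nhds (show (0:ℝ) < a / 2 by positivity)),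
      self_mem_nhdsWithin] with η h1 h2 h3
    exact ⟨h1, h2, h3⟩
  obtain ⟨η, hη1, hη2, hη0⟩ := h1.exists
  refine ⟨η ^ 2, by positivity, fun t₁ t₂ h1 h12 h2T hδ => ?_⟩
  have hs0 : 0 < t₁ - η := by linarith
  have hsT : t₁ - η ∈ Set.Ioc 0 T := ⟨hs0, by linarith⟩
  have hB : ∀ τ ∈ Set.Ioc (t₁ - η) T, ∫⁻ y, ‖F τ y‖ₑ ≤ B * ENNReal.ofReal ((a / 2) ^ (-(1 / 2 : ℝ))) := by
    intro τ hτ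
    refine (h.bF τ ⟨hs0.trans hτ.1, hτ.2⟩).trans ?_
    gcongr B * ENNReal.ofReal ?_
    exact Real.rpow_le_rpow_of_nonpos (by positivity) (by linarith [hτ.1]) (by norm_num)
  have hD : ∀ t, t₁ ≤ t → t ≤ t₂ → ∫⁻ x, DM F (t₁ - η) t t x ≤
      ENNReal.ofReal (C * (η ^ 2 + η) ^ (1 / 2 : ℝ)) * (B * ENNReal.ofReal ((a / 2) ^ (-(1 / 2 : ℝ)))) := by
    intro t ht1 ht2
    have := H F h.mF (t₁ - η) t _ (by linarith) (fun s hs => hB s ⟨hs.1, hs.2.trans (ht2.trans h2T)⟩)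
    rw [NN_one, ka_one] at this
    refine this.trans ?_
    gcongr
    rw [sub_zero]
    exact Real.rpow_le_rpow (by linarith) (by linarith) (by norm_num)
  have hi := h.int hsT
  have m1 := fun t => (hconv_meas (d := d) hi.aemeasurable).comp (measurable_prodMk_left (x := t))
  have key := hconv_time (a := η) (h := t₂ - t₁) hη0 (by linarith) hi
  calc _ ≤ ∫⁻ x, (‖conv (heatKernel d (η + (t₂ - t₁))) (u (t₁ - η)) x - conv (heatKernel d η) (u (t₁ - η)) x‖ₑ +
        (DM F (t₁ - η) t₂ t₂ x + DM F (t₁ - η) t₁ t₁ x)) := by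
        refine lintegral_mono_ae ?_
        filter_upwards [h.restart hs0 (show t₁ - η < t₁ by linarith) (by linarith),
          h.restart hs0 (show t₁ - η < t₂ by linarith) h2T] with x e1 e2
        rw [e1, e2, show t₂ - (t₁ - η) = η + (t₂ - t₁) by ring, show t₁ - (t₁ - η) = η by ring, sub_sub_sub_comm]
        refine enorm_sub_le.trans ?_
        gcongr
        exact enorm_sub_le.trans (add_le_add (Duh_le h.mF _ _ _ _) (Duh_le h.mF _ _ _ _))
    _ = (∫⁻ x, ‖conv (heatKernel d (η + (t₂ - t₁))) (u (t₁ - η)) x - conv (heatKernel d η) (u (t₁ - η)) x‖ₑ) +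
        ((∫⁻ x, DM F (t₁ - η) t₂ t₂ x) + ∫⁻ x, DM F (t₁ - η) t₁ t₁ x) := by
        rw [← lintegral_add_right _ (DM_meas h.mF _ _ _)]
        exact lintegral_add_right _ ((DM_meas h.mF _ _ _).add (DM_meas h.mF _ _ _))
    _ ≤ ENNReal.ofReal (2 * c0 d ^ 2 * η ^ (1 / 2 : ℝ)) * m +
        2 * (ENNReal.ofReal (C * (η ^ 2 + η) ^ (1 / 2 : ℝ)) * (B * ENNReal.ofReal ((a / 2) ^ (-(1 / 2 : ℝ))))) := by
        refine add_le_add (key.trans ?_) ?_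
        · refine mul_le_mul' (ENNReal.ofReal_le_ofReal ?_) (H₁ h _ hsT)
          gcongr
          calc _ ≤ (η ^ 2) ^ (1 / 2 : ℝ) * η ^ (-(1 / 2) : ℝ) := by
                gcongr
            _ = _ := by
                rw [← Real.rpow_natCast, ← Real.rpow_mul hη0.le, ← Real.rpow_add hη0]; norm_num
        · rw [two_mul]
          exact add_le_add (hD _ h12 le_rfl) (hD _ le_rfl h12)
    _ = ENNReal.ofReal (f η) := by
        rw [hf]
        dsimp only
        rw [ENNReal.ofReal_add (by positivity) (by positivity), ENNReal.ofReal_mul (q := m.toReal) (by positivity),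
          ENNReal.ofReal_toReal hmt, ENNReal.ofReal_mul (p := 2) (by norm_num),
          ENNReal.ofReal_mul (q := B.toReal * _) (by positivity),
          ENNReal.ofReal_mul (p := B.toReal) (by positivity), ENNReal.ofReal_toReal h.Bt]
        norm_num
    _ ≤ _ := ENNReal.ofReal_le_ofReal hη1.le

theorem LS.cont (h : LS F ρ₀ u T B) {t : ℝ} (ht : t ∈ Set.Ioc 0 T) :
    Tendsto (fun s => ∫⁻ x, ‖u s x - u t x‖ₑ) (𝓝[Set.Ioc 0 T] t) (𝓝 0) := by
  rw [ENNReal.tendsto_nhds_zero]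
  intro ε hε
  rcases eq_or_ne ε ⊤ with rfl | hεt
  · simp
  have ht0 := ht.1
  obtain ⟨δ, hδ, H⟩ := h.modulus (half_pos ht.1) (ENNReal.toReal_pos hε.ne' hεt)
  rw [ENNReal.ofReal_toReal hεt] at H
  have h1 : ∀ᶠ s in 𝓝[Set.Ioc 0 T] t, |s - t| < min δ (t / 2) :=
    nhdsWithin_le_nhds (Metric.ball_mem_nhds t (lt_min hδ (half_pos ht.1)))
  filter_upwards [h1, self_mem_nhdsWithin] with s hs hsT
  have h2 := lt_min_iff.1 hs
  have h3 := abs_lt.1 h2.1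
  have h4 := abs_lt.1 h2.2
  rcases le_total s t with hst | hst
  · simp_rw [fun x => enorm_sub_rev (u s x) (u t x)]
    exact H s t (by linarith) hst ht.2 (by linarith)
  · exact H t s (by linarith) hst hsT.2 (by linarith)

end ls
end p6

section p7
variable {d : ℕ}

theorem NN_sub_le {r : ℝ} (hr : 1 ≤ r) {f g h : Euc d → ℝ} (hf : AEMeasurable f) (hg : AEMeasurable g)
    (hh : AEMeasurable h) :
    NN r (fun x => f x - h x) ≤ NN r (fun x => f x - g x) + NN r (fun x => g x - h x) := by
  refine le_trans (NN_mono (by linarith) (Eventually.of_forall fun x => ?_))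
    (eLpNorm'_add_le (f := fun x => f x - g x) (g := fun x => g x - h x)
      (AEMeasurable.aestronglyMeasurable (by fun_prop)) (AEMeasurable.aestronglyMeasurable (by fun_prop)) hr)
  simp

theorem NN_comm {r : ℝ} (f g : Euc d → ℝ) : NN r (fun x => f x - g x) = NN r (fun x => g x - f x) := by
  simp only [eLpNorm'_eq_lintegral_enorm, enorm_sub_rev]

theorem NN_sub0 {r : ℝ} (hr : 1 ≤ r) {f g : Euc d → ℝ} (hf : AEMeasurable f) (hg : AEMeasurable g) :
    NN r (fun x => f x - g x) ≤ NN r f + NN r g := by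
  have := NN_sub_le hr hf (aemeasurable_const (b := (0:ℝ))) hg
  rwa [NN_comm (fun _ => (0:ℝ)), show (fun x => f x - 0) = f by simp, show (fun x => g x - 0) = g by simp] at this

theorem NN_zero' {r : ℝ} (hr : 0 < r) {f g : Euc d → ℝ} (hf : AEMeasurable f) (hg : AEMeasurable g)
    (h : NN r (fun x => f x - g x) = 0) : f =ᵐ[volume] g := by
  have h1 := (eLpNorm'_eq_zero_iff hr (AEMeasurable.aestronglyMeasurable (by fun_prop))).1 h
  filter_upwards [h1] with x hx
  exact sub_eq_zero.1 hx

theorem NN_fatou {r : ℝ} (hr : 0 < r) {f : ℕ → Euc d → ℝ} {g : Euc d → ℝ} (hf : ∀ n, Measurable (f n))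
    (h : ∀ᵐ x, Tendsto (fun n => f n x) atTop (𝓝 (g x))) {A : ℝ≥0∞} (hA : ∀ᶠ n in atTop, NN r (f n) ≤ A) :
    NN r g ≤ A := by
  refine NN_le hr ?_
  calc _ = ∫⁻ x, liminf (fun n => ‖f n x‖ₑ ^ r) atTop := by
        refine lintegral_congr_ae ?_
        filter_upwards [h] with x hx
        exact (((ENNReal.continuous_rpow_const (y := r)).tendsto _).comp
          ((continuous_enorm.tendsto _).comp hx)).liminf_eq.symm
    _ ≤ liminf (fun n => ∫⁻ x, ‖f n x‖ₑ ^ r) atTop := lintegral_liminf_le fun n => by have := hf n; fun_prop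
    _ ≤ _ := by
        refine liminf_le_of_le (by isBoundedDefault) fun b hb => ?_
        obtain ⟨n, h1, h2⟩ := (hb.and hA).exists
        refine h1.trans ?_
        rw [NN_pow hr]
        exact ENNReal.rpow_le_rpow h2 hr.le

/-- critical bound -/
def XB (u : ℝ → Euc d → ℝ) (T A : ℝ) : Prop :=
  ∀ t ∈ Set.Ioc 0 T, NN (pe d) (u t) ≤ ENNReal.ofReal (A * t ^ (-(1 / 4 : ℝ)))

theorem meas_sl {α : Type*} [MeasurableSpace α] {u : ℝ → Euc d → α} (hu : Measurable (Function.uncurry u)) (t : ℝ) : Measurable (u t) :=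
  hu.comp measurable_prodMk_left

theorem quarter {t : ℝ} (ht : 0 < t) : t ^ (-(1 / 4 : ℝ)) * t ^ (-(1 / 4 : ℝ)) = t ^ (-(1 / 2 : ℝ)) := by
  rw [← Real.rpow_add ht]; norm_num

theorem FF_bd (hd : 2 ≤ d) : ∃ K : ℝ, 0 < K ∧ ∀ (u : ℝ → Euc d → ℝ) (T A : ℝ), Measurable (Function.uncurry u) →
    0 ≤ A → XB u T A → ∀ s ∈ Set.Ioc 0 T, ∫⁻ y, ‖FF u s y‖ₑ ≤
      ENNReal.ofReal (K * A ^ 2) * ENNReal.ofReal (s ^ (-(1 / 2 : ℝ))) := by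
  obtain ⟨C, hC, H⟩ := F_l1 hd
  refine ⟨C, hC, fun u T A hu hA hX s hs => ?_⟩
  have hs0 := hs.1
  have m := (meas_sl hu s).aemeasurable (μ := volume)
  refine (H (u s) (u s) m m).trans ?_
  calc _ ≤ ENNReal.ofReal C * ENNReal.ofReal (A * s ^ (-(1 / 4 : ℝ))) * ENNReal.ofReal (A * s ^ (-(1 / 4 : ℝ))) :=
        mul_le_mul' (mul_le_mul' le_rfl (hX s hs)) (hX s hs)
    _ = _ := by
        rw [← ENNReal.ofReal_mul (by positivity), ← ENNReal.ofReal_mul (by positivity),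
          ← ENNReal.ofReal_mul (by positivity), ← quarter hs0]
        congr 1; ring

theorem bil (hd : 2 ≤ d) : ∃ K : ℝ, 0 < K ∧ ∀ (u v : ℝ → Euc d → ℝ) (T A A' D : ℝ),
    Measurable (Function.uncurry u) → Measurable (Function.uncurry v) → 0 ≤ A → 0 ≤ A' → 0 ≤ D →
    XB u T A → XB v T A' → XB (fun t x => u t x - v t x) T D →
    XB (fun t x => Duh (FF u) 0 t t x - Duh (FF v) 0 t t x) T (K * (A + A') * D) := by
  obtain ⟨C, hC, H⟩ := F_diff hd
  obtain ⟨K₁, hK₁, H₁⟩ := FF_bd hd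
  have hp := (pe_facts hd).1
  obtain ⟨C₂, hC₂, H₂⟩ := DM_crit (d := d) hp.le (by rw [ka_pe hd]; norm_num)
  obtain ⟨C₃, hC₃, H₃⟩ := DM_crit (d := d) le_rfl (by rw [ka_one]; norm_num)
  rw [ka_pe hd] at H₂
  refine ⟨C₂ * C, by positivity, fun u v T A A' D hu hv hA hA' hD hXu hXv hXD t ht => ?_⟩
  have fin : ∀ (w : ℝ → Euc d → ℝ) (A : ℝ), Measurable (Function.uncurry w) → 0 ≤ A → XB w T A → ∀ᵐ x, DM (FF w) 0 t t x < ⊤ := by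
    intro w A hw hA hX
    refine ae_lt_top (DM_meas (FF_meas hw) _ _ _) ?_
    have := H₃ _ (FF_meas hw) t _ ht.1 (fun s hs => H₁ w T A hw hA hX s ⟨hs.1, hs.2.trans ht.2⟩)
    rw [NN_one] at this
    refine ne_top_of_le_ne_top ?_ this
    exact ENNReal.mul_ne_top ENNReal.ofReal_ne_top ENNReal.ofReal_ne_top
  have hm : Measurable (Function.uncurry fun s y => FF u s y - FF v s y) := (FF_meas hu).sub (FF_meas hv)
  have h1 := H₂ _ hm t (ENNReal.ofReal (C * (A + A') * D)) ht.1 ?_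
  · refine le_trans (NN_mono (by linarith) ?_) (h1.trans (le_of_eq ?_))
    · filter_upwards [fin u A hu hA hXu, fin v A' hv hA' hXv] with x hx hx2
      rw [Duh_sub (FF_meas hu) (FF_meas hv) hx.ne hx2.ne]
      exact Duh_le hm _ _ _ _
    · have := ht.1
      rw [← ENNReal.ofReal_mul (by positivity)]
      congr 1; ring
  · intro s hs
    have hs0 := hs.1
    have hs' : s ∈ Set.Ioc 0 T := ⟨hs.1, hs.2.trans ht.2⟩
    refine (H (u s) (v s) (meas_sl hu s) (meas_sl hv s) (ne_top_of_le_ne_top ENNReal.ofReal_ne_top (hXu s hs'))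
      (ne_top_of_le_ne_top ENNReal.ofReal_ne_top (hXv s hs'))).trans ?_
    calc _ ≤ ENNReal.ofReal C * (ENNReal.ofReal (A * s ^ (-(1 / 4 : ℝ))) + ENNReal.ofReal (A' * s ^ (-(1 / 4 : ℝ)))) *
          ENNReal.ofReal (D * s ^ (-(1 / 4 : ℝ))) :=
          mul_le_mul' (mul_le_mul' le_rfl (add_le_add (hXu s hs') (hXv s hs'))) (hXD s hs')
      _ = _ := by
        rw [← ENNReal.ofReal_add (by positivity) (by positivity), ← ENNReal.ofReal_mul (by positivity),
          ← ENNReal.ofReal_mul (by positivity), ← ENNReal.ofReal_mul (by positivity), ← quarter hs0]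
        congr 1; ring

theorem FF_zero (s : ℝ) (y : Euc d) : FF (fun _ _ => (0:ℝ)) s y = 0 := by simp [FF]

theorem Duh_zero (a c t : ℝ) (x : Euc d) : Duh (FF (fun _ _ => (0:ℝ))) a c t x = 0 := by
  simp [Duh, FF_zero]

theorem XB_zero (hd : 2 ≤ d) {T A : ℝ} : XB (fun _ (_ : Euc d) => (0:ℝ)) T A := by
  intro t ht
  have : (0:ℝ) < pe d := by linarith [(pe_facts hd).1]
  rw [show NN (pe d) (fun _ : Euc d => (0:ℝ)) = 0 from ?_]
  · exact bot_le
  · exact (eLpNorm'_eq_zero_iff this aestronglyMeasurable_const).2 (by rfl)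

theorem mild_meas {ρ₀ : Euc d → ℝ} (h0 : Integrable ρ₀) {u : ℝ → Euc d → ℝ}
    (hu : Measurable (Function.uncurry u)) : Measurable (Function.uncurry (mildRHS d ρ₀ u)) :=
  (hconv_meas h0.aemeasurable).sub (Duh_meas (FF_meas hu) 0)

def pic (ρ₀ : Euc d → ℝ) : ℕ → ℝ → Euc d → ℝ
  | 0 => fun _ _ => 0
  | n + 1 => mildRHS d ρ₀ (pic ρ₀ n)

theorem XB_lin (hd : 2 ≤ d) {ρ₀ : Euc d → ℝ} (h0 : Integrable ρ₀) {ε : ℝ} (hε : 0 ≤ ε)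
    (h1 : ∫⁻ x, ‖ρ₀ x‖ₑ ≤ ENNReal.ofReal ε) (T : ℝ) : XB (fun t => conv (heatKernel d t) ρ₀) T ε := by
  intro t ht
  have ht0 := ht.1
  refine (hconv_NN ht.1 (pe_facts hd).1.le h0.aemeasurable).trans ?_
  rw [ka_pe hd, mul_comm ε, ENNReal.ofReal_mul (by positivity)]
  gcongr

theorem existence (hd : 2 ≤ d) : ∃ ε₀ : ℝ, 0 < ε₀ ∧ ∀ (ρ₀ : Euc d → ℝ) (ε : ℝ), Integrable ρ₀ → 0 ≤ ε → ε ≤ ε₀ →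
    ∫⁻ x, ‖ρ₀ x‖ₑ ≤ ENNReal.ofReal ε → ∃ ρ : ℝ → Euc d → ℝ, Measurable (Function.uncurry ρ) ∧
      (∀ t, 0 < t → ∀ x, ρ t x = mildRHS d ρ₀ ρ t x) ∧ ∀ T, XB ρ T (2 * ε) := by
  obtain ⟨K, hK, H⟩ := bil hd
  have hp := (pe_facts hd).1
  have hp0 : 0 < pe d := by linarith
  refine ⟨1 / (8 * K), by positivity, fun ρ₀ ε h0 hε hεK h1 => ?_⟩
  have hKε : K * ε ≤ 1 / 8 := by
    rw [le_div_iff₀ (by positivity)] at hεK; linarith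
  have hL := XB_lin hd h0 hε h1
  have hm : ∀ n, Measurable (Function.uncurry (pic ρ₀ n)) := by
    intro n
    induction n with
    | zero => exact measurable_const
    | succ n ih => exact mild_meas h0 ih
  have hmt : ∀ n t, AEMeasurable (pic ρ₀ n t) volume := fun n t => (meas_sl (hm n) t).aemeasurable
  have step : ∀ u, Measurable (Function.uncurry u) → ∀ T, XB u T (2 * ε) → XB (mildRHS d ρ₀ u) T (2 * ε) := by
    intro u hu T hX t ht
    have ht0 := ht.1
    have b := H u (fun _ _ => 0) T (2 * ε) 0 (2 * ε) hu measurable_const (by positivity) le_rfl (by positivity) hX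
      (XB_zero hd) (by simpa using hX) t ht
    simp only [Duh_zero, sub_zero, add_zero] at b
    have hm1 : AEMeasurable (Duh (FF u) 0 t t) := (Duh_meas1 (FF_meas hu) 0 t).aemeasurable
    have hm2 := ((meas_sl (u := fun t x => conv (heatKernel d t) ρ₀ x) (hconv_meas h0.aemeasurable) t)).aemeasurable (μ := volume)
    refine (NN_sub0 hp.le hm2 hm1).trans ((add_le_add (hL T t ht) b).trans ?_)
    rw [← ENNReal.ofReal_add (by positivity) (by positivity), ← add_mul]
    gcongr
    nlinarith
  have hX : ∀ n T, XB (pic ρ₀ n) T (2 * ε) := by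
    intro n T
    induction n with
    | zero => exact XB_zero hd
    | succ n ih => exact step _ (hm n) T ih
  have contr : ∀ u v, Measurable (Function.uncurry u) → Measurable (Function.uncurry v) → ∀ T D, 0 ≤ D →
      XB u T (2 * ε) → XB v T (2 * ε) → XB (fun t x => u t x - v t x) T D →
      XB (fun t x => mildRHS d ρ₀ u t x - mildRHS d ρ₀ v t x) T (D / 2) := by
    intro u v hu hv T D hD hXu hXv hXD t ht
    have ht0 := ht.1
    have b := H u v T _ _ D hu hv (by positivity) (by positivity) hD hXu hXv hXD t ht
    simp_rw [mildRHS_eq, sub_sub_sub_cancel_left]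
    rw [NN_comm]
    refine b.trans (ENNReal.ofReal_le_ofReal ?_)
    gcongr
    nlinarith
  have hdiff : ∀ n T, XB (fun t x => pic ρ₀ (n + 1) t x - pic ρ₀ n t x) T (2 * ε * (1 / 2) ^ n) := by
    intro n T
    induction n with
    | zero => simpa [pic] using hX 1 T
    | succ n ih =>
      have := contr _ _ (hm (n + 1)) (hm n) T _ (by positivity) (hX _ T) (hX _ T) ih
      rw [pow_succ, ← mul_assoc, mul_one_div]
      exact this
  have hcau : ∀ n k t, 0 < t → NN (pe d) (fun x => pic ρ₀ (n + k) t x - pic ρ₀ n t x) ≤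
      ENNReal.ofReal (4 * ε * (1 / 2) ^ n * t ^ (-(1 / 4 : ℝ))) := by
    intro n k t ht
    have : NN (pe d) (fun x => pic ρ₀ (n + k) t x - pic ρ₀ n t x) ≤
      ENNReal.ofReal (4 * ε * ((1 / 2) ^ n * (1 - (1 / 2) ^ k)) * t ^ (-(1 / 4 : ℝ))) := by
      induction k with
      | zero => 
        have := XB_zero hd (T := t) (A := 0) t ⟨ht, le_rfl⟩
        simpa using this
      | succ k ih =>
        have h2 : (0:ℝ) ≤ 1 - (1 / 2) ^ k := sub_nonneg.2 (pow_le_one₀ (by norm_num) (by norm_num))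
        refine (NN_sub_le hp.le (hmt _ t) (hmt (n + k) t) (hmt _ t)).trans
          ((add_le_add (hdiff (n + k) t t ⟨ht, le_rfl⟩) ih).trans (le_of_eq ?_))
        rw [← ENNReal.ofReal_add (by positivity) (by positivity), ← add_mul]
        congr 2
        rw [pow_add, pow_succ]; ring
    refine this.trans (ENNReal.ofReal_le_ofReal ?_)
    gcongr ?_ * _
    have : (0:ℝ) ≤ (1 / 2) ^ k := by positivity
    have h3 : (0:ℝ) ≤ (1 / 2) ^ n := by positivity
    gcongr
    nlinarith
  set U : ℝ → Euc d → ℝ := fun t x => limUnder atTop (fun n => pic ρ₀ n t x) with hU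
  have hUm : Measurable (Function.uncurry U) :=
    (StronglyMeasurable.limUnder (f := fun n (p : ℝ × Euc d) => pic ρ₀ n p.1 p.2)
      (fun n => (hm n).stronglyMeasurable)).measurable
  have hlim : ∀ t, 0 < t → ∀ᵐ x, Tendsto (fun n => pic ρ₀ n t x) atTop (𝓝 (U t x)) := by
    intro t ht
    have h2 := Lp.ae_tendsto_of_cauchy_eLpNorm' (μ := volume) (f := fun n => pic ρ₀ n t) (p := pe d)
      (fun n => (hmt n t).aestronglyMeasurable) hp.le
      (B := fun n => ENNReal.ofReal ((8 * ε * t ^ (-(1 / 4 : ℝ)) + 1) * (1 / 2) ^ n)) ?_ ?_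
    · filter_upwards [h2] with x hx
      exact tendsto_nhds_limUnder hx
    · rw [← ENNReal.ofReal_tsum_of_nonneg]
      · exact ENNReal.ofReal_ne_top
      · intro n; positivity
      · exact (summable_geometric_of_lt_one (by norm_num) (by norm_num)).mul_left _
    · intro N n m hn hm'
      obtain ⟨n, rfl⟩ := Nat.exists_eq_add_of_le hn
      obtain ⟨m, rfl⟩ := Nat.exists_eq_add_of_le hm'
      have := NN_sub_le hp.le (hmt (N + n) t) (hmt N t) (hmt (N + m) t)
      rw [NN_comm (pic ρ₀ N t)] at this
      refine lt_of_le_of_lt (this.trans (add_le_add (hcau N n t ht) (hcau N m t ht))) ?_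
      rw [← ENNReal.ofReal_add (by positivity) (by positivity)]
      refine (ENNReal.ofReal_lt_ofReal_iff (by positivity)).2 ?_
      have : (0:ℝ) < (1 / 2) ^ N := by positivity
      nlinarith
  have hXU : ∀ T, XB U T (2 * ε) := fun T t ht =>
    NN_fatou hp0 (fun n => meas_sl (hm n) t) (hlim t ht.1) (Eventually.of_forall fun n => hX n T t ht)
  have hUd : ∀ n T, XB (fun t x => U t x - pic ρ₀ n t x) T (4 * ε * (1 / 2) ^ n) := by
    intro n T t ht
    refine NN_fatou hp0 (f := fun m x => pic ρ₀ m t x - pic ρ₀ n t x)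
      (fun m => (meas_sl (hm m) t).sub (meas_sl (hm n) t)) ?_ ?_
    · filter_upwards [hlim t ht.1] with x hx
      exact hx.sub_const _
    · filter_upwards [eventually_ge_atTop n] with m hm'
      obtain ⟨m, rfl⟩ := Nat.exists_eq_add_of_le hm'
      exact hcau n m t ht.1
  have hrm := mild_meas h0 hUm
  have hae : ∀ t, 0 < t → mildRHS d ρ₀ U t =ᵐ[volume] U t := by
    intro t ht
    have m1 := (meas_sl hrm t).aemeasurable (μ := volume)
    have m2 := (meas_sl hUm t).aemeasurable (μ := volume)
    refine NN_zero' hp0 m1 m2 ?_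
    have hb : ∀ n : ℕ, NN (pe d) (fun x => mildRHS d ρ₀ U t x - U t x) ≤
        ENNReal.ofReal (4 * ε * t ^ (-(1 / 4 : ℝ)) * (1 / 2) ^ n) := by
      intro n
      have b1 := contr U (pic ρ₀ n) hUm (hm n) t _ (by positivity) (hXU t) (hX n t) (hUd n t) t ⟨ht, le_rfl⟩
      have b2 := hUd (n + 1) t t ⟨ht, le_rfl⟩
      rw [NN_comm] at b2
      refine (NN_sub_le hp.le m1 (hmt (n + 1) t) m2).trans ((add_le_add b1 b2).trans (le_of_eq ?_))
      rw [← ENNReal.ofReal_add (by positivity) (by positivity)]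
      congr 1
      rw [pow_succ]; ring
    refine le_antisymm (ge_of_tendsto' (x := atTop) ?_ hb) bot_le
    have : Tendsto (fun n : ℕ => 4 * ε * t ^ (-(1 / 4 : ℝ)) * (1 / 2) ^ n) atTop (𝓝 (4 * ε * t ^ (-(1 / 4 : ℝ)) * 0)) :=
      (tendsto_pow_atTop_nhds_zero_of_lt_one (by norm_num) (by norm_num)).const_mul _
    simpa using ENNReal.tendsto_ofReal this
  refine ⟨mildRHS d ρ₀ U, hrm, fun t ht x => ?_, fun T t ht => ?_⟩
  · rw [mildRHS_eq, mildRHS_eq]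
    congr 1
    exact Duh_congr (fun s hs => FF_congr (hae s hs.1).symm) _ _
  · rw [NN_congr (hae t ht.1)]
    exact hXU T t ht

end p7

section p8
variable {d : ℕ}

theorem meas_rep {v : ℝ → Euc d → ℝ} (hi : ∀ t, 0 < t → Integrable (v t))
    (hc : ∀ t, 0 < t → Tendsto (fun s => ∫⁻ x, ‖v s x - v t x‖ₑ) (𝓝 t) (𝓝 0)) :
    ∃ u : ℝ → Euc d → ℝ, Measurable (Function.uncurry u) ∧ ∀ t, 0 < t → u t =ᵐ[volume] v t := by
  set a : ℕ → ℝ → Euc d → ℝ := fun n i x => ⨍ y in Metric.closedBall x (1 / ((n:ℝ) + 1)), v (rexp i) y with ha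
  have hcont : ∀ n x, Continuous fun i => a n i x := by
    intro n x
    simp only [ha, setAverage_eq]
    simp only [smul_eq_mul]
    refine Continuous.mul continuous_const ?_
    rw [continuous_iff_continuousAt]
    intro i
    have h1 : Tendsto (fun t => ∫ y in Metric.closedBall x (1 / ((n:ℝ) + 1)), v t y) (𝓝 (rexp i))
        (𝓝 (∫ y in Metric.closedBall x (1 / ((n:ℝ) + 1)), v (rexp i) y)) := by
      refine tendsto_setIntegral_of_L1 _ (hi _ (exp_pos i)).aestronglyMeasurable ?_ (hc _ (exp_pos i)) _
      filter_upwards [lt_mem_nhds (exp_pos i)] with s hs using hi s hs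
    exact h1.comp (continuous_exp.tendsto i)
  have hmeas : ∀ n i, Measurable (a n i) := by
    intro n i
    simp only [ha, setAverage_eq]
    have h2 : ∀ x : Euc d, volume.real (Metric.closedBall x (1 / ((n:ℝ) + 1))) =
        volume.real (Metric.closedBall (0 : Euc d) (1 / ((n:ℝ) + 1))) := by
      intro x
      rw [measureReal_def, measureReal_def, Measure.addHaar_closedBall_center]
    simp_rw [h2]
    simp only [smul_eq_mul]
    refine Measurable.const_mul ?_ _
    obtain ⟨g, hg, hvg⟩ := (hi _ (exp_pos i)).aestronglyMeasurable
    have h3 : (fun x : Euc d => ∫ y in Metric.closedBall x (1 / ((n:ℝ) + 1)), v (rexp i) y) =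
        fun x : Euc d => ∫ y, Set.indicator {p : Euc d × Euc d | dist p.2 p.1 ≤ 1 / ((n:ℝ) + 1)} (fun p => g p.2) (x, y) := by
      ext x
      rw [← integral_indicator Metric.isClosed_closedBall.measurableSet]
      refine integral_congr_ae ?_
      filter_upwards [hvg] with y hy
      simp [Set.indicator, Metric.mem_closedBall, hy]
    rw [h3]
    refine (StronglyMeasurable.integral_prod_right' (f := Set.indicator {p : Euc d × Euc d | dist p.2 p.1 ≤ 1 / ((n:ℝ) + 1)} (fun p => g p.2)) ?_).measurable
    refine ((hg.measurable.comp measurable_snd).indicator ?_).stronglyMeasurable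
    exact (isClosed_le (by fun_prop) (by fun_prop)).measurableSet
  have hj : ∀ n, Measurable (Function.uncurry (a n)) := fun n =>
    measurable_uncurry_of_continuous_of_measurable (hcont n) (hmeas n)
  refine ⟨fun t x => limUnder atTop (fun n => a n (Real.log t) x), ?_, fun t ht => ?_⟩
  · refine (StronglyMeasurable.limUnder (f := fun n (p : ℝ × Euc d) => a n (Real.log p.1) p.2) fun n => ?_).measurable
    exact ((hj n).comp ((measurable_log.comp measurable_fst).prodMk measurable_snd)).stronglyMeasurable
  · filter_upwards [IsUnifLocDoublingMeasure.ae_tendsto_average volume (hi t ht).locallyIntegrable 1] with x hx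
    refine Tendsto.limUnder_eq ?_
    simp only [ha, exp_log ht]
    refine hx (fun _ => x) _ ?_ ?_
    · refine tendsto_nhdsWithin_iff.2 ⟨tendsto_one_div_add_atTop_nhds_zero_nat, Eventually.of_forall fun n => ?_⟩
      simp only [Set.mem_Ioi]; positivity
    · refine Eventually.of_forall fun n => ?_
      simp only [Metric.mem_closedBall, dist_self]; positivity

/-- the standing package for a solution -/
theorem sol_LS (hd : 2 ≤ d) : ∃ K : ℝ, 0 < K ∧ ∀ (ρ₀ : Euc d → ℝ) (u : ℝ → Euc d → ℝ) (T A : ℝ),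
    Integrable ρ₀ → Measurable (Function.uncurry u) → 0 ≤ A → XB u T A →
    (∀ t ∈ Set.Ioc 0 T, u t =ᵐ[volume] mildRHS d ρ₀ u t) →
    LS (FF u) ρ₀ u T (ENNReal.ofReal (K * A ^ 2)) := by
  obtain ⟨K, hK, H⟩ := FF_bd hd
  refine ⟨K, hK, fun ρ₀ u T A h0 hu hA hX he => ⟨FF_meas hu, h0, ENNReal.ofReal_ne_top, he, ?_⟩⟩
  exact H u T A hu hA hX

/-- restart bound in `L^r` -/
theorem LS.restart_NN {r : ℝ} (hr : 1 ≤ r) (hk : ka d r < 1 / 2) : ∃ C : ℝ, 0 < C ∧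
    ∀ {F : ℝ → Euc d → Euc d} {ρ₀ : Euc d → ℝ} {u : ℝ → Euc d → ℝ} {T : ℝ} {B : ℝ≥0∞},
    LS F ρ₀ u T B → ∀ s t, 0 < s → s < t → t ≤ T →
    NN r (u t) ≤ ENNReal.ofReal ((t - s) ^ (-ka d r)) * (∫⁻ x, ‖u s x‖ₑ) +
      ENNReal.ofReal (C * (t - s) ^ (1 / 2 - ka d r)) * (B * ENNReal.ofReal (s ^ (-(1 / 2 : ℝ)))) := by
  obtain ⟨C, hC, H⟩ := DM_const (d := d) hr hk
  refine ⟨C, hC, fun {F ρ₀ u T B} h s t hs hst htT => ?_⟩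
  have hsT : s ∈ Set.Ioc 0 T := ⟨hs, hst.le.trans htT⟩
  rw [NN_congr (h.restart hs hst htT)]
  refine (NN_sub0 hr ?_ ?_).trans (add_le_add (hconv_NN (sub_pos.2 hst) hr (h.int hsT).aemeasurable) ?_)
  · exact ((hconv_integrable (sub_pos.2 hst) (h.int hsT))).aemeasurable
  · exact (Duh_meas1 h.mF _ _).aemeasurable
  refine (NN_mono (by linarith) (Eventually.of_forall fun x => ?_)).trans
    (H F h.mF s t (B * ENNReal.ofReal (s ^ (-(1 / 2 : ℝ)))) hst.le fun τ hτ => ?_)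
  · simpa using Duh_le h.mF s t t x
  · refine (h.bF τ ⟨hs.trans hτ.1, hτ.2.trans htT⟩).trans ?_
    refine mul_le_mul' le_rfl (ENNReal.ofReal_le_ofReal ?_)
    exact Real.rpow_le_rpow_of_nonpos hs hτ.1.le (by norm_num)

end p8

section p9
variable {d : ℕ}

theorem HH_lin (hd : 2 ≤ d) : ∃ C : ℝ, 0 < C ∧ ∀ (h : ℝ) (g : Euc d → ℝ) (x : Euc d), 0 < h → Integrable g →
    HH (fun y => ‖conv (heatKernel d h) g y‖ₑ) x ≤ ENNReal.ofReal (C * h ^ (-(1 / 2 : ℝ))) * ∫⁻ y, ‖g y‖ₑ := by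
  obtain ⟨C, hC, H⟩ := kn_int hd
  refine ⟨C + 1, by positivity, fun h g x hh hg => ?_⟩
  have hR : 0 < h ^ (1 / 2 : ℝ) := by positivity
  have hm := (hconv_integrable hh hg).aemeasurable.enorm
  have h1 : HH (fun y => ‖conv (heatKernel d h) g y‖ₑ) x ≤
      (∫⁻ y, kn (h ^ (1 / 2 : ℝ)) (x - y) * (ENNReal.ofReal (h ^ (-((d : ℝ) / 2))) * ∫⁻ y, ‖g y‖ₑ)) +
      ∫⁻ y, ENNReal.ofReal (h ^ (1 / 2 : ℝ))⁻¹ * ‖conv (heatKernel d h) g y‖ₑ := by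
    unfold HH
    rw [← lintegral_add_left (by fun_prop)]
    refine lintegral_mono fun y => ?_
    rw [kk_split (h ^ (1 / 2 : ℝ)), add_mul]
    gcongr
    · exact hconv_sup hh y
    · exact kf_le hR _
  refine h1.trans ?_
  rw [lintegral_mul_const _ (by fun_prop), lintegral_const_mul' _ _ ENNReal.ofReal_ne_top,
    lintegral_sub_left_eq_self (fun z => kn (h ^ (1 / 2 : ℝ)) z) x, ← mul_assoc]
  refine (add_le_add (mul_le_mul' (mul_le_mul' (H _ hR) le_rfl) le_rfl) (mul_le_mul' le_rfl (hconv_l1 hh hg.aemeasurable))).trans ?_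
  rw [← ENNReal.ofReal_mul (by positivity), ← add_mul, ← ENNReal.ofReal_add (by positivity) (by positivity)]
  refine mul_le_mul' (ENNReal.ofReal_le_ofReal (le_of_eq ?_)) le_rfl
  rw [← rpow_mul hh.le, ← rpow_neg hh.le, mul_assoc, ← rpow_add hh, add_mul, one_mul]
  congr 3
  ring

def JJ (h : ℝ) (z : Euc d) : ℝ≥0∞ := HH (fun x => ENNReal.ofReal (heatKernel d h x)) z

theorem JJ_meas2 {α : Type*} [MeasurableSpace α] {f : α → ℝ} {g : α → Euc d} (hf : Measurable f) (hg : Measurable g) :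
    Measurable fun a => JJ (f a) (g a) := by
  unfold JJ HH
  refine Measurable.lintegral_prod_right' (f := fun p : α × Euc d => kk (g p.1 - p.2) * ENNReal.ofReal (heatKernel d (f p.1) p.2)) ?_
  have := hk_meas2 (d := d) (hf.comp (measurable_fst (β := Euc d))) (measurable_snd (α := α))
  have h2 : Measurable fun p : α × Euc d => kk (g p.1 - p.2) := kk_meas.comp ((hg.comp measurable_fst).sub measurable_snd)
  exact h2.mul this.ennreal_ofReal

theorem JJ_lr (hd : 2 ≤ d) : ∃ C : ℝ, 0 < C ∧ ∀ h : ℝ, 0 < h →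
    NN (4 * d) (JJ (d := d) h) ≤ ENNReal.ofReal (C * h ^ (-(3 / 8 : ℝ))) := by
  have hd' : (2:ℝ) ≤ d := by exact_mod_cast hd
  obtain ⟨C₁, hC₁, H₁⟩ := kn_int hd
  obtain ⟨C₂, hC₂, H₂⟩ := kf_int (d := d) (r := 4 * d) (by linarith)
  refine ⟨C₁ + C₂ ^ (1 / (4 * d : ℝ)), by positivity, fun h hh => ?_⟩
  have hR : 0 < h ^ (1 / 2 : ℝ) := by positivity
  set R := h ^ (1 / 2 : ℝ) with hRd
  have hr0 : (0:ℝ) < 4 * d := by linarith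
  have hk : Measurable fun y : Euc d => ENNReal.ofReal (heatKernel d h y) := (hk_cont h).measurable.ennreal_ofReal
  have e1 : JJ (d := d) h = (fun z => ∫⁻ y, ENNReal.ofReal (heatKernel d h (z - y)) * kn R y) +
      fun z => ∫⁻ y, kf R (z - y) * ENNReal.ofReal (heatKernel d h y) := by
    ext z
    have hk2 : Measurable fun y : Euc d => ENNReal.ofReal (heatKernel d h (z - y)) := hk.comp (by fun_prop)
    simp only [JJ, HH, Pi.add_apply]
    rw [← lintegral_sub_left_eq_self (fun y => ENNReal.ofReal (heatKernel d h (z - y)) * kn R y) z, ← lintegral_add_left]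
    · refine lintegral_congr fun y => ?_
      rw [kk_split R]; simp; ring
    · simp only [sub_sub_cancel]; exact hk.mul ((kn_meas R).comp (by fun_prop))
  have m1 : Measurable (Function.uncurry fun y z : Euc d => ENNReal.ofReal (heatKernel d h (z - y))) :=
    hk.comp (measurable_snd.sub measurable_fst)
  have m2 : Measurable (Function.uncurry fun y z : Euc d => kf R (z - y)) :=
    (kf_meas R).comp (measurable_snd.sub measurable_fst)
  rw [e1]
  have M1 : Measurable (fun z => ∫⁻ y, ENNReal.ofReal (heatKernel d h (z - y)) * kn R y) :=
    Measurable.lintegral_prod_left' (f := fun p : Euc d × Euc d => ENNReal.ofReal (heatKernel d h (p.2 - p.1)) * kn R p.1)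
      (m1.mul ((kn_meas R).comp measurable_fst))
  have M2 : Measurable (fun z => ∫⁻ y, kf R (z - y) * ENNReal.ofReal (heatKernel d h y)) :=
    Measurable.lintegral_prod_left' (f := fun p : Euc d × Euc d => kf R (p.2 - p.1) * ENNReal.ofReal (heatKernel d h p.1))
      (m2.mul (hk.comp measurable_fst))
  refine (eLpNorm'_add_le M1.aestronglyMeasurable M2.aestronglyMeasurable (by linarith)).trans ?_
  rw [add_mul, ENNReal.ofReal_add (by positivity) (by positivity)]
  refine add_le_add (NN_le hr0 ?_) (NN_le hr0 ?_)
  · simp only [enorm_eq_self]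
    refine (mink (by linarith) m1 (kn_meas R) (a := fun _ => ENNReal.ofReal (h ^ (-((d : ℝ) / 2 * (1 - 1 / (4 * d)))))) measurable_const ?_).trans ?_
    · refine Eventually.of_forall fun y => ⟨?_, ENNReal.ofReal_ne_top, ?_⟩
      · simp; positivity
      rw [lintegral_sub_right_eq_self (fun z => ENNReal.ofReal (heatKernel d h z) ^ (4 * d : ℝ)) y]
      refine (hk_lr hh (by linarith)).trans (le_of_eq ?_)
      rw [ENNReal.ofReal_rpow_of_pos (by positivity), ← rpow_mul hh.le]
      congr 2; field_simp
    · rw [lintegral_const_mul' _ _ ENNReal.ofReal_ne_top]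
      refine ENNReal.rpow_le_rpow ((mul_le_mul' le_rfl (H₁ R hR)).trans ?_) hr0.le
      rw [← ENNReal.ofReal_mul (by positivity)]
      refine ENNReal.ofReal_le_ofReal (le_of_eq ?_)
      rw [hRd, ← rpow_mul hh.le, mul_left_comm, ← rpow_add hh]
      congr 2; field_simp; ring
  · simp only [enorm_eq_self]
    refine (mink (by linarith) m2 hk (a := fun _ => ENNReal.ofReal (C₂ ^ (1 / (4 * d : ℝ)) * h ^ (-(3 / 8 : ℝ)))) measurable_const ?_).trans ?_
    · refine Eventually.of_forall fun y => ⟨?_, ENNReal.ofReal_ne_top, ?_⟩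
      · simp; positivity
      rw [lintegral_sub_right_eq_self (fun z => kf R z ^ (4 * d : ℝ)) y]
      refine (H₂ R hR).trans (le_of_eq ?_)
      rw [ENNReal.ofReal_rpow_of_pos (by positivity), mul_rpow (by positivity) (by positivity), ← rpow_mul hC₂.le,
        ← rpow_mul hh.le, ← rpow_mul hh.le]
      congr 2
      · field_simp; simp
      · congr 1; ring
    · rw [lintegral_const_mul' _ _ ENNReal.ofReal_ne_top, hk_lintegral hh, mul_one]

theorem NN_holder (hd : 2 ≤ d) {f g : Euc d → ℝ≥0∞} (hf : AEMeasurable f) (hg : AEMeasurable g) :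
    NN (pe d) (fun x => f x * g x) ≤ NN (4 * d) f * NN (4 * d / (4 * d - 3)) g := by
  have hd' : (2:ℝ) ≤ d := by exact_mod_cast hd
  have h0 : (0:ℝ) < 2 * d - 1 := by linarith
  have h3 : (0:ℝ) < 4 * d - 3 := by linarith
  have := ENNReal.lintegral_Lp_mul_le_Lq_mul_Lr (p := pe d) (q := 4 * d) (r := 4 * d / (4 * d - 3))
    (by linarith [(pe_facts hd).1]) ?_ ?_ volume hf hg
  · simpa [eLpNorm'] using this
  · unfold pe; rw [div_lt_iff₀ h0]; nlinarith
  · unfold pe; field_simp; ring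

theorem HH_DM {F : ℝ → Euc d → Euc d} (hF : Measurable (Function.uncurry F)) {s t : ℝ} (x0 : Euc d) :
    HH (DM F s t t) x0 ≤ ∫⁻ τ in Set.Ioc s t, ENNReal.ofReal (c0 d * (t - τ) ^ (-(1 / 2 : ℝ))) *
      ∫⁻ y, JJ (2 * (t - τ)) (x0 - y) * ‖F τ y‖ₑ := by
  have hFm : Measurable fun z : ℝ × Euc d => ‖F z.1 z.2‖ₑ := hF.enorm
  have hJ : Measurable fun z : ℝ × Euc d => JJ (2 * (t - z.1)) (x0 - z.2) := JJ_meas2 (by fun_prop) (by fun_prop)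
  rw [← slab_lint (by fun_prop) (f := fun τ y => JJ (2 * (t - τ)) (x0 - y) * ‖F τ y‖ₑ) (hJ.mul hFm)]
  unfold HH DM
  have hk := ker_meas (d := d) t
  have : ∀ x, kk (x0 - x) * ∫⁻ z, ‖gradHeat d (t - z.1) (x - z.2)‖ₑ * ‖F z.1 z.2‖ₑ ∂(slab d s t) =
      ∫⁻ z, kk (x0 - x) * (‖gradHeat d (t - z.1) (x - z.2)‖ₑ * ‖F z.1 z.2‖ₑ) ∂(slab d s t) := fun x => by
    rw [lintegral_const_mul]
    exact (hk.comp (measurable_const.prodMk measurable_id)).mul hFm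
  simp_rw [this]
  rw [lintegral_lintegral_swap]
  · refine lintegral_mono_ae ?_
    filter_upwards [slab_lt (d := d) (a := s) (le_refl t)] with z hz
    have h0 : 0 < t - z.1 := sub_pos.2 hz.2
    have e : JJ (2 * (t - z.1)) (x0 - z.2) = ∫⁻ x, kk (x0 - x) * ENNReal.ofReal (heatKernel d (2 * (t - z.1)) (x - z.2)) := by
      unfold JJ HH
      rw [← lintegral_sub_right_eq_self (fun x => kk (x0 - z.2 - x) * ENNReal.ofReal (heatKernel d (2 * (t - z.1)) x)) z.2]
      simp
    have hm : Measurable fun x => ENNReal.ofReal (heatKernel d (2 * (t - z.1)) (x - z.2)) :=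
      ((hk_cont _).measurable.comp (by fun_prop)).ennreal_ofReal
    rw [e, ← mul_assoc, ← lintegral_const_mul _ (by fun_prop), ← lintegral_mul_const _ (by fun_prop)]
    refine lintegral_mono fun x => ?_
    have : ‖gradHeat d (t - z.1) (x - z.2)‖ₑ ≤ ENNReal.ofReal (c0 d * (t - z.1) ^ (-(1 / 2 : ℝ))) * ENNReal.ofReal (heatKernel d (2 * (t - z.1)) (x - z.2)) := by
      rw [← ofReal_norm, ← ENNReal.ofReal_mul (mul_nonneg (c0_pos d).le (by positivity))]
      exact ENNReal.ofReal_le_ofReal (gradHeat_norm_le h0 _)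
    refine (mul_le_mul' le_rfl (mul_le_mul' this le_rfl)).trans (le_of_eq ?_)
    ring
  · have h1 : Measurable fun p : Euc d × (ℝ × Euc d) => kk (x0 - p.1) := by fun_prop
    exact (h1.mul (hk.mul (hFm.comp measurable_snd))).aemeasurable

theorem LS.l1' {F : ℝ → Euc d → Euc d} {ρ₀ : Euc d → ℝ} {u : ℝ → Euc d → ℝ} {T : ℝ} {B : ℝ≥0∞} (h : LS F ρ₀ u T B) :
    ∃ L : ℝ, 0 ≤ L ∧ ∀ t ∈ Set.Ioc 0 T, ∫⁻ x, ‖u t x‖ₑ ≤ ENNReal.ofReal L := by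
  obtain ⟨C, hC, H⟩ := LS.l1 d
  refine ⟨((∫⁻ x, ‖ρ₀ x‖ₑ) + ENNReal.ofReal C * B).toReal, ENNReal.toReal_nonneg, fun t ht => ?_⟩
  rw [ENNReal.ofReal_toReal]
  · exact H h t ht
  · exact ENNReal.add_ne_top.2 ⟨h.r0.2.ne, ENNReal.mul_ne_top ENNReal.ofReal_ne_top h.Bt⟩

theorem Lq_bd (hd : 2 ≤ d) {F : ℝ → Euc d → Euc d} {ρ₀ : Euc d → ℝ} {u : ℝ → Euc d → ℝ} {T : ℝ} {B : ℝ≥0∞} (h : LS F ρ₀ u T B) :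
    ∃ L : ℝ, 0 ≤ L ∧ ∀ t ∈ Set.Ioc 0 T, NN (4 * d / (4 * d - 3)) (u t) ≤ ENNReal.ofReal (L * t ^ (-(3 / 8 : ℝ))) := by
  have hd' : (2:ℝ) ≤ d := by exact_mod_cast hd
  have h3 : (0:ℝ) < 4 * d - 3 := by linarith
  have hk : ka d (4 * d / (4 * d - 3)) = 3 / 8 := by unfold ka; field_simp; ring
  obtain ⟨C, hC, H⟩ := LS.restart_NN (d := d) (r := 4 * d / (4 * d - 3)) (by rw [le_div_iff₀ h3]; linarith) (by rw [hk]; norm_num)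
  obtain ⟨L, hL, H1⟩ := h.l1'
  rw [hk] at H
  refine ⟨(1 / 2 : ℝ) ^ (-(3 / 8 : ℝ)) * L + C * (1 / 2 : ℝ) ^ (-(3 / 8 : ℝ)) * B.toReal, by positivity, fun t ht => ?_⟩
  have t0 := ht.1
  refine (H h (t * (1 / 2)) t (by linarith) (by linarith) ht.2).trans ?_
  have e : t - t * (1 / 2) = t * (1 / 2) := by ring
  obtain ⟨b, hb0, hb⟩ : ∃ b : ℝ, 0 ≤ b ∧ B = ENNReal.ofReal b := ⟨_, ENNReal.toReal_nonneg, (ENNReal.ofReal_toReal h.Bt).symm⟩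
  rw [e, hb, ENNReal.toReal_ofReal hb0]
  refine (add_le_add (mul_le_mul' le_rfl (H1 _ ⟨by linarith, by linarith [ht.2]⟩)) le_rfl).trans ?_
  rw [← ENNReal.ofReal_mul (by positivity), ← ENNReal.ofReal_mul (by positivity), ← ENNReal.ofReal_mul (by positivity),
    ← ENNReal.ofReal_add (by positivity) (by positivity)]
  refine ENNReal.ofReal_le_ofReal (le_of_eq ?_)
  have e2 : (t * (1 / 2)) ^ (1 / 2 - 3 / 8 : ℝ) * (t * (1 / 2)) ^ (-(1 / 2 : ℝ)) = (t * (1 / 2)) ^ (-(3 / 8 : ℝ)) := by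
    rw [← rpow_add (by positivity)]; norm_num
  rw [show ∀ a b c e : ℝ, a * b * (c * e) = a * c * (b * e) by intros; ring, e2, mul_rpow t0.le (by norm_num)]
  ring

theorem drift_bd (hd : 2 ≤ d) {ρ₀ : Euc d → ℝ} {u : ℝ → Euc d → ℝ} {T A : ℝ} {B : ℝ≥0∞} (hu : Measurable (Function.uncurry u))
    (hA : 0 ≤ A) (hX : XB u T A) (h : LS (FF u) ρ₀ u T B) :
    ∃ A' : ℝ, 0 < A' ∧ ∀ t ∈ Set.Ioc 0 T, ∀ x, ‖gradc d (u t) x‖ ≤ A' * t ^ (-(1 / 2 : ℝ)) := by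
  obtain ⟨L, hL, H1⟩ := h.l1'
  obtain ⟨L', hL', H2⟩ := Lq_bd hd h
  obtain ⟨C, hC, H3⟩ := HH_lin hd
  obtain ⟨C', hC', H4⟩ := JJ_lr hd
  obtain ⟨K, hK, H5⟩ := hls' hd
  set E : ℝ := c0 d * (K * (C' * 2 ^ (-(3 / 8 : ℝ)) * L') * A) with hE
  have hE0 : 0 ≤ E := by have := c0_pos d; positivity
  refine ⟨C * (1 / 2) ^ (-(1 / 2 : ℝ)) * L + E * (1 / 2) ^ (-(1 / 2 : ℝ)) * 8 + 1, by positivity, fun t ht x => ?_⟩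
  have t0 := ht.1
  have hs : t * (1 / 2) ∈ Set.Ioc 0 T := ⟨by linarith, by linarith [ht.2]⟩
  have e : t - t * (1 / 2) = t * (1 / 2) := by ring
  have key : HH (fun y => ‖u t y‖ₑ) x ≤ ENNReal.ofReal ((C * (1 / 2) ^ (-(1 / 2 : ℝ)) * L + E * (1 / 2) ^ (-(1 / 2 : ℝ)) * 8 + 1) * t ^ (-(1 / 2 : ℝ))) := by
    have r := h.restart hs.1 (by linarith : t * (1 / 2) < t) ht.2
    have h1 : HH (fun y => ‖u t y‖ₑ) x ≤ HH (fun y => ‖conv (heatKernel d (t - t * (1 / 2))) (u (t * (1 / 2))) y‖ₑ) x +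
        HH (DM (FF u) (t * (1 / 2)) t t) x := by
      rw [HH_congr (g := fun y => ‖conv (heatKernel d (t - t * (1 / 2))) (u (t * (1 / 2))) y - Duh (FF u) (t * (1 / 2)) t t y‖ₑ)
        (by filter_upwards [r] with y hy; rw [hy])]
      unfold HH
      rw [← lintegral_add_right _ (by have := DM_meas h.mF (t * (1 / 2)) t t; fun_prop)]
      refine lintegral_mono fun y => ?_
      rw [← mul_add]
      gcongr
      exact (enorm_sub_le).trans (add_le_add le_rfl (Duh_le h.mF _ _ _ _))
    refine h1.trans ((add_le_add ((H3 _ _ x (by linarith) (h.int hs)).trans (mul_le_mul' le_rfl (H1 _ hs))) (HH_DM h.mF x)).trans ?_)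
    have h2 : ∀ τ ∈ Set.Ioc (t * (1 / 2)) t, τ < t → ENNReal.ofReal (c0 d * (t - τ) ^ (-(1 / 2 : ℝ))) *
        ∫⁻ y, JJ (2 * (t - τ)) (x - y) * ‖FF u τ y‖ₑ ≤
        ENNReal.ofReal (E * (t * (1 / 2)) ^ (-(5 / 8 : ℝ))) * ENNReal.ofReal ((t - τ) ^ (-(7 / 8 : ℝ))) := by
      intro τ hτ hτt
      have τ0 : 0 < τ := hs.1.trans hτ.1
      have s0 := hs.1
      have hτT : τ ∈ Set.Ioc 0 T := ⟨τ0, hτ.2.trans ht.2⟩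
      have u0 : 0 < t - τ := by linarith
      have hum : Measurable fun y => ‖u τ y‖ₑ := (meas_sl hu τ).enorm
      have hJm : Measurable fun y : Euc d => JJ (2 * (t - τ)) (x - y) := JJ_meas2 measurable_const (by fun_prop)
      have b1 : ∫⁻ y, JJ (2 * (t - τ)) (x - y) * ‖FF u τ y‖ₑ ≤ ∫⁻ y, (JJ (2 * (t - τ)) (x - y) * ‖u τ y‖ₑ) * HH (fun y => ‖u τ y‖ₑ) y := by
        refine lintegral_mono fun y => ?_
        rw [FF, enorm_smul, mul_assoc]
        gcongr
        exact gradc_le (by lia) _ _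
      have b2 : NN (4 * d) (fun y => JJ (d := d) (2 * (t - τ)) (x - y)) = NN (4 * d) (JJ (d := d) (2 * (t - τ))) := by
        simp only [eLpNorm']
        rw [lintegral_sub_left_eq_self (fun y => ‖JJ (d := d) (2 * (t - τ)) y‖ₑ ^ (4 * d : ℝ)) x]
      have b3 := (H5 _ _ (hJm.mul hum).aemeasurable hum.aemeasurable).trans (mul_le_mul' (mul_le_mul' le_rfl
        ((NN_holder hd hJm.aemeasurable hum.aemeasurable).trans (mul_le_mul' (b2.le.trans (H4 _ (by linarith)))
          ((NN_en _).le.trans (H2 τ hτT))))) ((NN_en _).le.trans (hX τ hτT)))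
      refine (mul_le_mul' le_rfl (b1.trans b3)).trans ?_
      have c0p := c0_pos d
      rw [← ENNReal.ofReal_mul (by positivity), ← ENNReal.ofReal_mul (by positivity), ← ENNReal.ofReal_mul (by positivity),
        ← ENNReal.ofReal_mul (by positivity), ← ENNReal.ofReal_mul (by positivity)]
      refine ENNReal.ofReal_le_ofReal ?_
      have q1 : τ ^ (-(3 / 8 : ℝ)) * τ ^ (-(1 / 4 : ℝ)) ≤ (t * (1 / 2)) ^ (-(5 / 8 : ℝ)) := by
        rw [← rpow_add τ0]; norm_num
        exact Real.rpow_le_rpow_of_nonpos (by linarith) (by linarith [hτ.1]) (by norm_num)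
      have q2 : (t - τ) ^ (-(1 / 2 : ℝ)) * (t - τ) ^ (-(3 / 8 : ℝ)) = (t - τ) ^ (-(7 / 8 : ℝ)) := by
        rw [← rpow_add u0]; norm_num
      rw [mul_rpow (by norm_num) u0.le]
      calc _ = E * ((t - τ) ^ (-(1 / 2 : ℝ)) * (t - τ) ^ (-(3 / 8 : ℝ))) * (τ ^ (-(3 / 8 : ℝ)) * τ ^ (-(1 / 4 : ℝ))) := by rw [hE]; ring
        _ ≤ E * ((t - τ) ^ (-(1 / 2 : ℝ)) * (t - τ) ^ (-(3 / 8 : ℝ))) * (t * (1 / 2)) ^ (-(5 / 8 : ℝ)) := by gcongr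
        _ = _ := by rw [q2]; ring
    have h3 : (∫⁻ τ in Set.Ioc (t * (1 / 2)) t, ENNReal.ofReal (c0 d * (t - τ) ^ (-(1 / 2 : ℝ))) *
        ∫⁻ y, JJ (2 * (t - τ)) (x - y) * ‖FF u τ y‖ₑ) ≤ ENNReal.ofReal (E * (t * (1 / 2)) ^ (-(5 / 8 : ℝ))) *
          ENNReal.ofReal ((t - t * (1 / 2)) ^ (1 - 7 / 8 : ℝ) / (1 - 7 / 8)) := by
      rw [← ti_right (by norm_num) (by linarith), ← lintegral_const_mul' _ _ ENNReal.ofReal_ne_top]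
      refine lintegral_mono_ae ?_
      rw [ae_restrict_iff' measurableSet_Ioc]
      filter_upwards [compl_mem_ae_iff.2 (measure_singleton t)] with τ hτt hτ
      exact h2 τ hτ (lt_of_le_of_ne hτ.2 hτt)
    refine (add_le_add le_rfl h3).trans ?_
    rw [e, ← ENNReal.ofReal_mul (by positivity), ← ENNReal.ofReal_mul (by positivity), ← ENNReal.ofReal_add (by positivity) (by positivity)]
    refine ENNReal.ofReal_le_ofReal ?_
    have e2 : (t * (1 / 2)) ^ (-(5 / 8 : ℝ)) * (t * (1 / 2)) ^ (1 - 7 / 8 : ℝ) = (t * (1 / 2)) ^ (-(1 / 2 : ℝ)) := by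
      rw [← rpow_add (by positivity)]; norm_num
    have : 0 ≤ t ^ (-(1 / 2 : ℝ)) := by positivity
    calc _ = C * (t * (1 / 2)) ^ (-(1 / 2 : ℝ)) * L + E * ((t * (1 / 2)) ^ (-(5 / 8 : ℝ)) * (t * (1 / 2)) ^ (1 - 7 / 8 : ℝ)) * 8 := by ring
      _ ≤ _ := by rw [e2, mul_rpow t0.le (by norm_num)]; nlinarith
  have := (gradc_le (by lia) (u t) x).trans key
  rw [← ofReal_norm] at this
  exact (ENNReal.ofReal_le_ofReal_iff (by positivity)).1 this

end p9

section p10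
variable {d : ℕ}

theorem interp_min {x : ℝ≥0∞} {P η u : ℝ} (hP : 0 ≤ P) (hη : 0 ≤ η) (hu : 0 < u)
    (h1 : x ≤ ENNReal.ofReal (P * (η ^ (1 / 2 : ℝ) * u⁻¹))) (h2 : x ≤ ENNReal.ofReal (P * u ^ (-(1 / 2 : ℝ)))) :
    x ≤ ENNReal.ofReal (P * (η ^ (1 / 4 : ℝ) * u ^ (-(3 / 4 : ℝ)))) := by
  rcases le_total η u with h | h
  · refine h1.trans (ENNReal.ofReal_le_ofReal (mul_le_mul_of_nonneg_left ?_ hP))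
    rcases hη.eq_or_lt with rfl | hη
    · rw [zero_rpow (by norm_num), zero_rpow (by norm_num)]; simp
    have e1 : η ^ (1 / 2 : ℝ) = η ^ (1 / 4 : ℝ) * η ^ (1 / 4 : ℝ) := by rw [← rpow_add hη]; norm_num
    have e2 : u ^ (-(3 / 4 : ℝ)) = u ^ (1 / 4 : ℝ) * u⁻¹ := by rw [← rpow_neg_one, ← rpow_add hu]; norm_num
    rw [e1, e2, mul_assoc]
    gcongr
  · refine h2.trans (ENNReal.ofReal_le_ofReal (mul_le_mul_of_nonneg_left ?_ hP))
    have e2 : u ^ (-(1 / 2 : ℝ)) = u ^ (1 / 4 : ℝ) * u ^ (-(3 / 4 : ℝ)) := by rw [← rpow_add hu]; norm_num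
    rw [e2]
    gcongr

theorem schur {E : Type*} [NormedAddCommGroup E] [NormedSpace ℝ E] {k : Euc d → Euc d → E} (hk : Measurable fun p : Euc d × Euc d => ‖k p.1 p.2‖ₑ)
    {g : Euc d → ℝ} (hg : AEMeasurable g) {B : ℝ≥0∞} (hB : ∀ y, ∫⁻ x, ‖k x y‖ₑ ≤ B) :
    ∫⁻ x, ‖∫ y, g y • k x y‖ₑ ≤ B * ∫⁻ y, ‖g y‖ₑ := by
  have h1 : ∀ x, ‖∫ y, g y • k x y‖ₑ ≤ ∫⁻ y, ‖g y‖ₑ * ‖k x y‖ₑ := fun x =>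
    (enorm_integral_le_lintegral_enorm _).trans (lintegral_mono fun y => (enorm_smul _ _).le)
  refine (lintegral_mono h1).trans ?_
  rw [lintegral_lintegral_swap]
  · rw [← lintegral_const_mul'' _ hg.enorm]
    refine lintegral_mono fun y => ?_
    dsimp only
    have hm : Measurable fun x => ‖k x y‖ₑ := hk.comp (measurable_id.prodMk measurable_const)
    rw [lintegral_const_mul _ hm, mul_comm]
    gcongr
    exact hB y
  · exact (hg.enorm.comp_snd).mul hk.aemeasurable

theorem gradHeat_bdd {u : ℝ} (hu : 0 < u) : ∃ C : ℝ, ∀ x : Euc d, ‖gradHeat d u x‖ ≤ C := by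
  refine ⟨c0 d * u ^ (-(1 / 2 : ℝ)) * (4 * π * (2 * u)) ^ (-(d : ℝ) / 2), fun x => (gradHeat_norm_le hu x).trans ?_⟩
  have := c0_pos d
  gcongr
  exact hk_le (by linarith) x

theorem gradHeat_diff {k : Euc d → ℝ} (hk : Measurable k) {B : ℝ≥0∞} (hB : ∫⁻ x, ‖k x‖ₑ ≤ B) {u : ℝ} (hu : 0 < u) :
    ∫⁻ x, ‖∫ z, k (x - z) • gradHeat d u z‖ₑ ≤ ENNReal.ofReal (c0 d * u ^ (-(1 / 2 : ℝ))) * B := by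
  have h1 : ∀ x, ‖∫ z, k (x - z) • gradHeat d u z‖ₑ ≤ ∫⁻ z, ‖k (x - z)‖ₑ * ‖gradHeat d u z‖ₑ := fun x =>
    (enorm_integral_le_lintegral_enorm _).trans (lintegral_mono fun y => (enorm_smul _ _).le)
  have m1 : Measurable fun z => ‖gradHeat d u z‖ₑ := (gradHeat_meas2 measurable_const measurable_id).enorm
  refine (lintegral_mono h1).trans ?_
  rw [lintegral_lintegral_swap]
  · refine le_trans (b := ∫⁻ z, ‖gradHeat d u z‖ₑ * B) (lintegral_mono fun z => ?_) ?_
    · dsimp only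
      have hm : Measurable fun x => ‖k (x - z)‖ₑ := (hk.comp (by fun_prop : Measurable fun x : Euc d => x - z)).enorm
      rw [lintegral_mul_const _ hm, mul_comm,
        lintegral_sub_right_eq_self (fun x => ‖k x‖ₑ) z]
      gcongr
    · rw [lintegral_mul_const _ m1]
      gcongr
      exact gradHeat_lint hu
  · exact ((hk.comp (measurable_fst.sub measurable_snd)).enorm.mul (m1.comp measurable_snd)).aemeasurable

theorem hk_smul_int {u v : ℝ} (hu : 0 < u) (hv : 0 < v) (x : Euc d) : Integrable fun z => heatKernel d u (x - z) • gradHeat d v z := by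
  refine Integrable.bdd_smul (φ := fun z => heatKernel d u (x - z)) (gradHeat_integrable hv) ((4 * π * u) ^ (-(d : ℝ) / 2)) ?_ ?_
  · exact ((hk_cont u).measurable.comp (by fun_prop : Measurable fun z : Euc d => x - z)).aestronglyMeasurable
  · exact Eventually.of_forall fun z => by rw [norm_of_nonneg (hk_pos hu _).le]; exact hk_le hu _

/-- constant in gradient-kernel differences -/
def c1 (d : ℕ) : ℝ := 2 * c0 d + 2 * c0 d ^ 2 + 4 * c0 d ^ 3

theorem c1_pos (d : ℕ) : 0 < c1 d := by have := c0_pos d; unfold c1; positivity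

theorem half_half {u : ℝ} (hu : 0 < u) : (u / 2) ^ (-(1 / 2 : ℝ)) * (u / 2) ^ (-(1 / 2 : ℝ)) = 2 * u⁻¹ := by
  rw [← rpow_add (by positivity)]; norm_num; rw [rpow_neg_one]; field_simp

theorem gradHeat_shift {u : ℝ} (hu : 0 < u) {a : Euc d} {α : ℝ} (ha : ‖a‖ ≤ α) :
    ∫⁻ x, ‖gradHeat d u (x - a) - gradHeat d u x‖ₑ ≤ ENNReal.ofReal (c1 d * ((α ^ 2) ^ (1 / 4 : ℝ) * u ^ (-(3 / 4 : ℝ)))) := by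
  have c0p := c0_pos d
  have α0 : 0 ≤ α := (norm_nonneg a).trans ha
  refine interp_min (c1_pos d).le (by positivity) hu ?_ ?_
  · have hu2 : 0 < u / 2 := by linarith
    have e : ∀ x, gradHeat d u (x - a) - gradHeat d u x = ∫ z, (heatKernel d (u / 2) (x - z - a) - heatKernel d (u / 2) (x - z)) • gradHeat d (u / 2) z := by
      intro x
      have h1 := gradHeat_semi hu2 hu2 (x - a)
      have h2 := gradHeat_semi hu2 hu2 x
      rw [add_halves] at h1 h2
      rw [← h1, ← h2, ← integral_sub (hk_smul_int hu2 hu2 _) (hk_smul_int hu2 hu2 _)]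
      refine integral_congr_ae (Eventually.of_forall fun z => ?_)
      simp only [sub_smul, sub_right_comm x a z]
    simp_rw [e]
    refine (gradHeat_diff (k := fun x => heatKernel d (u / 2) (x - a) - heatKernel d (u / 2) x) ?_ (hk_shift_lint hu2 a) hu2).trans ?_
    · exact ((hk_cont _).measurable.comp (by fun_prop)).sub (hk_cont _).measurable
    · rw [← ofReal_norm, ← ENNReal.ofReal_mul (by positivity), ← ENNReal.ofReal_mul (by positivity)]
      refine ENNReal.ofReal_le_ofReal ?_
      have : (α ^ 2) ^ (1 / 2 : ℝ) = α := by rw [← sqrt_eq_rpow, sqrt_sq α0]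
      rw [this, show ∀ a b c : ℝ, a * b * (a * b * c) = a ^ 2 * (b * b) * c by intros; ring, half_half hu]
      have h3 : 2 * c0 d ^ 2 ≤ c1 d := by unfold c1; nlinarith [pow_pos c0p 3]
      calc _ = 2 * c0 d ^ 2 * (‖a‖ * u⁻¹) := by ring
        _ ≤ _ := by gcongr; exact (c1_pos d).le
  · have m : Measurable fun x => gradHeat d u x := gradHeat_meas2 measurable_const measurable_id
    refine le_trans (lintegral_mono fun x => enorm_sub_le) ?_
    rw [lintegral_add_right _ m.enorm, lintegral_sub_right_eq_self (fun x => ‖gradHeat d u x‖ₑ) a]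
    refine (add_le_add (gradHeat_lint hu) (gradHeat_lint hu)).trans ?_
    rw [← ENNReal.ofReal_add (by positivity) (by positivity), ← two_mul, ← mul_assoc]
    refine ENNReal.ofReal_le_ofReal ?_
    gcongr
    unfold c1; nlinarith [pow_pos c0p 3, pow_pos c0p 2]

theorem gradHeat_time {u η : ℝ} (hu : 0 < u) (hη : 0 ≤ η) :
    ∫⁻ x, ‖gradHeat d u x - gradHeat d (u + η) x‖ₑ ≤ ENNReal.ofReal (c1 d * (η ^ (1 / 4 : ℝ) * u ^ (-(3 / 4 : ℝ)))) := by
  have c0p := c0_pos d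
  refine interp_min (c1_pos d).le (by positivity) hu ?_ ?_
  · rcases hη.eq_or_lt with rfl | hη
    · simp
    have hu2 : 0 < u / 2 := by linarith
    have e : ∀ x, gradHeat d u x - gradHeat d (u + η) x = ∫ z, (heatKernel d (u / 2) (x - z) - heatKernel d (u / 2 + η) (x - z)) • gradHeat d (u / 2) z := by
      intro x
      have h1 := gradHeat_semi (by linarith : 0 < u / 2 + η) hu2 x
      have h2 := gradHeat_semi hu2 hu2 x
      rw [add_halves] at h2
      rw [show u / 2 + η + u / 2 = u + η by ring] at h1
      rw [← h1, ← h2, ← integral_sub (hk_smul_int hu2 hu2 _) (hk_smul_int (by linarith) hu2 _)]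
      refine integral_congr_ae (Eventually.of_forall fun z => ?_)
      simp only [sub_smul]
    simp_rw [e]
    refine (gradHeat_diff (k := fun x => heatKernel d (u / 2) x - heatKernel d (u / 2 + η) x) ?_ ?_ hu2).trans (b := ENNReal.ofReal (c0 d * (u / 2) ^ (-(1 / 2 : ℝ))) * ENNReal.ofReal (2 * c0 d ^ 2 * (η ^ (1 / 2 : ℝ) * (u / 2) ^ (-(1 / 2 : ℝ))))) ?_
    · exact (hk_cont _).measurable.sub (hk_cont _).measurable
    · refine le_trans (le_of_eq ?_) (hk_time hu2 hη)
      exact lintegral_congr fun x => enorm_sub_rev _ _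
    · rw [← ENNReal.ofReal_mul (by positivity)]
      refine ENNReal.ofReal_le_ofReal ?_
      rw [show ∀ a b c : ℝ, a * b * (2 * a ^ 2 * (c * b)) = 2 * a ^ 3 * (b * b) * c by intros; ring, half_half hu]
      have h3 : 4 * c0 d ^ 3 ≤ c1 d := by unfold c1; nlinarith [pow_pos c0p 2]
      calc _ = 4 * c0 d ^ 3 * (η ^ (1 / 2 : ℝ) * u⁻¹) := by ring
        _ ≤ _ := by gcongr
  · have m : Measurable fun x => gradHeat d u x := gradHeat_meas2 measurable_const measurable_id
    refine le_trans (lintegral_mono fun x => enorm_sub_le) ?_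
    rw [lintegral_add_left m.enorm]
    refine (add_le_add (gradHeat_lint hu) (gradHeat_lint (by linarith))).trans ?_
    rw [← ENNReal.ofReal_add (by positivity) (by positivity)]
    refine ENNReal.ofReal_le_ofReal ?_
    have h1 : (u + η) ^ (-(1 / 2 : ℝ)) ≤ u ^ (-(1 / 2 : ℝ)) := Real.rpow_le_rpow_of_nonpos hu (by linarith) (by norm_num)
    have h2 : 2 * c0 d ≤ c1 d := by unfold c1; nlinarith [pow_pos c0p 2, pow_pos c0p 3]
    calc _ ≤ c0 d * u ^ (-(1 / 2 : ℝ)) + c0 d * u ^ (-(1 / 2 : ℝ)) := by gcongr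
      _ = 2 * c0 d * u ^ (-(1 / 2 : ℝ)) := by ring
      _ ≤ _ := by gcongr

theorem hk_taylor1 {u : ℝ} (a x : Euc d) :
    ‖heatKernel d u (x - a) - heatKernel d u x + (inner ℝ (gradHeat d u x) a : ℝ)‖ₑ ≤
      ∫⁻ r in Set.Ioc (0:ℝ) 1, ‖gradHeat d u (x - r • a) - gradHeat d u x‖ₑ * ‖a‖ₑ := by
  have hc : Continuous fun r : ℝ => -(inner ℝ (gradHeat d u (x - r • a)) a : ℝ) := by
    have := hk_cont (d := d) u
    simp only [gradHeat_eq]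
    fun_prop
  have e : heatKernel d u (x - a) - heatKernel d u x + (inner ℝ (gradHeat d u x) a : ℝ) =
      ∫ r in (0:ℝ)..1, -(inner ℝ (gradHeat d u (x - r • a) - gradHeat d u x) a : ℝ) := by
    simp_rw [inner_sub_left, neg_sub', sub_neg_eq_add]
    rw [intervalIntegral.integral_add (hc.intervalIntegrable _ _) (by simp), hk_shift_eq]
    simp
  rw [e, intervalIntegral.integral_of_le zero_le_one]
  refine (enorm_integral_le_lintegral_enorm _).trans (lintegral_mono fun r => ?_)
  dsimp only
  rw [enorm_neg]
  exact enorm_inner_le' _ _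

theorem hk_taylor {u : ℝ} (hu : 0 < u) {a : Euc d} {α : ℝ} (ha : ‖a‖ ≤ α) :
    ∫⁻ x, ‖heatKernel d u (x - a) - heatKernel d u x + (inner ℝ (gradHeat d u x) a : ℝ)‖ₑ ≤
      ENNReal.ofReal (c1 d * ((α ^ 2) ^ (1 / 4 : ℝ) * u ^ (-(3 / 4 : ℝ)))) * ENNReal.ofReal α := by
  have g : Measurable fun x : Euc d => gradHeat d u x := gradHeat_meas2 measurable_const measurable_id
  have m : Measurable fun p : Euc d × ℝ => ‖gradHeat d u (p.1 - p.2 • a) - gradHeat d u p.1‖ₑ * ‖a‖ₑ :=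
    ((g.comp (by fun_prop : Measurable fun p : Euc d × ℝ => p.1 - p.2 • a)).sub (g.comp measurable_fst)).enorm.mul_const _
  refine (lintegral_mono (hk_taylor1 a)).trans ?_
  rw [lintegral_lintegral_swap (f := fun x r => ‖gradHeat d u (x - r • a) - gradHeat d u x‖ₑ * ‖a‖ₑ) m.aemeasurable]
  have h2 : ∀ᵐ r ∂(volume.restrict (Set.Ioc (0:ℝ) 1)), (∫⁻ x, ‖gradHeat d u (x - r • a) - gradHeat d u x‖ₑ * ‖a‖ₑ) ≤
      ENNReal.ofReal (c1 d * ((α ^ 2) ^ (1 / 4 : ℝ) * u ^ (-(3 / 4 : ℝ)))) * ENNReal.ofReal α := by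
    rw [ae_restrict_iff' measurableSet_Ioc]
    refine Eventually.of_forall fun r hr => ?_
    have mm : Measurable fun x => ‖gradHeat d u (x - r • a) - gradHeat d u x‖ₑ :=
      ((g.comp (by fun_prop : Measurable fun p : Euc d => p - r • a)).sub g).enorm
    rw [lintegral_mul_const _ mm, ← ofReal_norm a]
    refine mul_le_mul' (gradHeat_shift hu ?_) (ENNReal.ofReal_le_ofReal ha)
    rw [norm_smul, norm_of_nonneg hr.1.le]
    nlinarith [hr.2, norm_nonneg a, hr.1]
  refine (lintegral_mono_ae h2).trans ?_
  simp

end p10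

section p11
variable {d : ℕ}

theorem hk_mono_int {g : Euc d → ℝ} (hg : Integrable g) {k : Euc d → ℝ} (hk : Measurable k) {C : ℝ} (hC : ∀ y, ‖k y‖ ≤ C) :
    Integrable fun y => g y • k y := by
  have := hg.bdd_mul (c := C) hk.aestronglyMeasurable (Eventually.of_forall hC)
  simpa [mul_comm] using this

/-- one Euler step -/
def Es (κ : ℝ) (a : Euc d → Euc d) (W : Euc d → ℝ) (x : Euc d) : ℝ := ∫ y, W y • heatKernel d κ (x - y - a y)

theorem hkb {κ : ℝ} (hκ : 0 < κ) (z : Euc d) : ‖heatKernel d κ z‖ ≤ (4 * π * κ) ^ (-(d : ℝ) / 2) := by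
  rw [norm_of_nonneg (hk_pos hκ _).le]; exact hk_le hκ _

theorem Es_int {κ : ℝ} (hκ : 0 < κ) {a : Euc d → Euc d} (ha : Measurable a) {W : Euc d → ℝ} (hW : Integrable W) (x : Euc d) :
    Integrable fun y => W y • heatKernel d κ (x - y - a y) :=
  hk_mono_int hW ((hk_cont κ).measurable.comp (by fun_prop : Measurable fun y => x - y - a y)) fun _ => hkb hκ _

theorem Es_meas2 {κ : ℝ} {a : Euc d → Euc d} (ha : Measurable a) :
    Measurable fun p : Euc d × Euc d => heatKernel d κ (p.1 - p.2 - a p.2) :=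
  (hk_cont κ).measurable.comp (by fun_prop)

theorem hk_tr_lint {κ : ℝ} (hκ : 0 < κ) (b : Euc d) : ∫⁻ x, ‖heatKernel d κ (x - b)‖ₑ = 1 := by
  rw [lintegral_sub_right_eq_self (fun x => ‖heatKernel d κ x‖ₑ) b, ← hk_lintegral (d := d) hκ]
  exact lintegral_congr fun x => by rw [enorm_of_nonneg (hk_pos hκ _).le]

theorem Es_lint {κ : ℝ} (hκ : 0 < κ) {a : Euc d → Euc d} (ha : Measurable a) {W : Euc d → ℝ} (hW : AEMeasurable W) :
    ∫⁻ x, ‖Es κ a W x‖ₑ ≤ ∫⁻ y, ‖W y‖ₑ := by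
  have := schur (k := fun x y => heatKernel d κ (x - y - a y)) (B := 1) (Es_meas2 ha).enorm hW fun y => by
    simp_rw [sub_sub]; exact (hk_tr_lint hκ _).le
  simpa [Es] using this

theorem Es_integrable {κ : ℝ} (hκ : 0 < κ) {a : Euc d → Euc d} (ha : Measurable a) {W : Euc d → ℝ} (hW : Integrable W) (hm : Measurable W) :
    Integrable (Es κ a W) := by
  refine ⟨?_, (Es_lint hκ ha hW.aemeasurable).trans_lt hW.2⟩
  have : StronglyMeasurable (Function.uncurry fun x y => W y • heatKernel d κ (x - y - a y)) :=
    ((hm.comp measurable_snd).smul (Es_meas2 ha)).stronglyMeasurable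
  exact this.integral_prod_right.aestronglyMeasurable

theorem Es_measurable {κ : ℝ} {a : Euc d → Euc d} (ha : Measurable a) {W : Euc d → ℝ} (hm : Measurable W) :
    Measurable (Es κ a W) := by
  have : StronglyMeasurable (Function.uncurry fun x y => W y • heatKernel d κ (x - y - a y)) :=
    ((hm.comp measurable_snd).smul (Es_meas2 ha)).stronglyMeasurable
  exact this.integral_prod_right.measurable

theorem Es_prod {κ : ℝ} (hκ : 0 < κ) {a : Euc d → Euc d} (ha : Measurable a) {W : Euc d → ℝ} (hW : Integrable W)
    (hm : Measurable W) : Integrable (fun p : Euc d × Euc d => W p.2 • heatKernel d κ (p.1 - p.2 - a p.2)) (volume.prod volume) := by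
  have m : Measurable fun p : Euc d × Euc d => W p.2 • heatKernel d κ (p.1 - p.2 - a p.2) :=
    (hm.comp measurable_snd).smul (Es_meas2 (κ := κ) ha)
  refine ⟨m.aestronglyMeasurable, ?_⟩
  rw [hasFiniteIntegral_iff_enorm, lintegral_prod_symm _ m.enorm.aemeasurable]
  refine lt_of_le_of_lt (lintegral_mono fun y => ?_) hW.2
  have hm2 : Measurable fun x => ‖heatKernel d κ (x - y - a y)‖ₑ := ((hk_cont κ).measurable.comp (by fun_prop : Measurable fun x : Euc d => x - y - a y)).enorm
  simp only [enorm_smul]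
  rw [lintegral_const_mul _ hm2]
  simp_rw [sub_sub]
  rw [hk_tr_lint hκ, mul_one]

theorem Es_conv {κ u : ℝ} (hκ : 0 < κ) (hu : 0 < u) {a : Euc d → Euc d} (ha : Measurable a) {W : Euc d → ℝ} (hW : Integrable W)
    (hm : Measurable W) (x : Euc d) : conv (heatKernel d u) (Es κ a W) x = Es (u + κ) a W x := by
  unfold conv Es
  simp_rw [← integral_const_mul]
  rw [integral_integral_swap]
  · refine integral_congr_ae (Eventually.of_forall fun y => ?_)
    dsimp only
    simp_rw [smul_eq_mul, mul_left_comm (heatKernel d u _)]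
    rw [integral_const_mul]
    congr 1
    rw [← integral_add_right_eq_self _ (y + a y), ← hk_semi hu hκ]
    refine integral_congr_ae (Eventually.of_forall fun z => ?_)
    dsimp only
    congr 2 <;> abel
  · exact (Es_prod hκ ha hW hm).bdd_mul (c := (4 * π * u) ^ (-(d : ℝ) / 2))
      ((hk_cont u).measurable.comp (by fun_prop : Measurable fun p : Euc d × Euc d => x - p.1)).aestronglyMeasurable
      (Eventually.of_forall fun _ => hkb hu _)

theorem ti_mid {c c' T : ℝ} (h1 : c < c') (h2 : c' ≤ T) :
    ∫⁻ τ in Set.Ioc c c', ENNReal.ofReal ((T - τ) ^ (-(3 / 4 : ℝ))) ≤ ENNReal.ofReal (4 * ((c' - c) * (T - c) ^ (-(3 / 4 : ℝ)))) := by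
  have e1 := ti_right (a := 3 / 4) (by norm_num) (h1.le.trans h2)
  have e2 := ti_right (a := 3 / 4) (by norm_num) h2
  rw [← Set.Ioc_union_Ioc_eq_Ioc h1.le h2, lintegral_union measurableSet_Ioc (Set.Ioc_disjoint_Ioc_of_le le_rfl), e2] at e1
  rw [ENNReal.eq_sub_of_add_eq ENNReal.ofReal_ne_top e1, ← ENNReal.ofReal_sub _ (by have : 0 ≤ T - c' := by linarith
                                                                                    positivity)]
  refine ENNReal.ofReal_le_ofReal ?_
  have hp : 0 < T - c := by linarith
  have k1 : (T - c) ^ (1 - 3 / 4 : ℝ) = (T - c) * (T - c) ^ (-(3 / 4 : ℝ)) := by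
    rw [← rpow_one_add' hp.le (by norm_num)]; norm_num
  have k2 : (T - c') * (T - c) ^ (-(3 / 4 : ℝ)) ≤ (T - c') ^ (1 - 3 / 4 : ℝ) := by
    rcases h2.eq_or_lt with rfl | h2
    · simp; positivity
    · have hp' : 0 < T - c' := by linarith
      have : (T - c') ^ (1 - 3 / 4 : ℝ) = (T - c') * (T - c') ^ (-(3 / 4 : ℝ)) := by
        rw [← rpow_one_add' hp'.le (by norm_num)]; norm_num
      rw [this]
      exact mul_le_mul_of_nonneg_left (rpow_le_rpow_of_nonpos hp' (by linarith) (by norm_num)) hp'.le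
  rw [k1]
  norm_num at k2 ⊢
  linarith

theorem slab_schur {a c : ℝ} {φ : Euc d → ℝ × Euc d → ℝ} {ψ : ℝ × Euc d → ℝ≥0∞}
    (hφ : Measurable (Function.uncurry φ)) (h : ∀ᵐ z ∂(slab d a c), ∫⁻ x, ‖φ x z‖ₑ ≤ ψ z) :
    ∫⁻ x, ‖∫ z, φ x z ∂(slab d a c)‖ₑ ≤ ∫⁻ z, ψ z ∂(slab d a c) := by
  refine (lintegral_mono fun x => enorm_integral_le_lintegral_enorm _).trans ?_
  rw [lintegral_lintegral_swap hφ.enorm.aemeasurable]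
  exact lintegral_mono_ae h

theorem step_abs {k1 k0 kg : Euc d → Euc d → ℝ} (m1 : Measurable (Function.uncurry k1)) (m0 : Measurable (Function.uncurry k0))
    (mg : Measurable (Function.uncurry kg)) {C : ℝ} (b1 : ∀ x y, ‖k1 x y‖ ≤ C) (b0 : ∀ x y, ‖k0 x y‖ ≤ C) (bg : ∀ x y, ‖kg x y‖ ≤ C)
    {W v D : Euc d → ℝ} (hW : Integrable W) (hWm : Measurable W) (hv : Integrable v) (hvm : Measurable v) {B1 B2 : ℝ≥0∞}
    (h1 : ∀ y, ∫⁻ x, ‖k1 x y - k0 x y‖ₑ ≤ B1) (h2 : ∀ y, ∫⁻ x, ‖k1 x y - k0 x y + kg x y‖ₑ ≤ B2) :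
    ∫⁻ x, ‖(∫ y, W y • k1 x y) - (∫ y, W y • k0 x y) + D x‖ₑ ≤
      B1 * (∫⁻ y, ‖W y - v y‖ₑ) + B2 * (∫⁻ y, ‖v y‖ₑ) + ∫⁻ x, ‖D x - ∫ y, v y • kg x y‖ₑ := by
  have I : ∀ {V : Euc d → ℝ} {k : Euc d → Euc d → ℝ} (_ : Integrable V) (_ : Measurable (Function.uncurry k)) (_ : ∀ x y, ‖k x y‖ ≤ C) (x : Euc d),
      Integrable fun y => V y • k x y := fun hV hk hb x => hk_mono_int hV (hk.comp (measurable_const.prodMk measurable_id)) fun y => hb x y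
  have key : ∀ x, (∫ y, W y • k1 x y) - (∫ y, W y • k0 x y) + D x =
      (∫ y, (W y - v y) • (k1 x y - k0 x y)) + (∫ y, v y • (k1 x y - k0 x y + kg x y)) + (D x - ∫ y, v y • kg x y) := by
    intro x
    have J : ∀ {V : Euc d → ℝ} (_ : Integrable V), Integrable fun y => V y • k1 x y - V y • k0 x y := fun hV => (I hV m1 b1 x).sub (I hV m0 b0 x)
    have e1 : (∫ y, (W y - v y) • (k1 x y - k0 x y)) = (∫ y, W y • k1 x y) - (∫ y, W y • k0 x y) - ((∫ y, v y • k1 x y) - (∫ y, v y • k0 x y)) := by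
      rw [← integral_sub (I hW m1 b1 x) (I hW m0 b0 x), ← integral_sub (I hv m1 b1 x) (I hv m0 b0 x),
        ← integral_sub (J hW) (J hv)]
      refine integral_congr_ae (Eventually.of_forall fun y => ?_)
      simp only [smul_eq_mul]; ring
    have e2 : (∫ y, v y • (k1 x y - k0 x y + kg x y)) = (∫ y, v y • k1 x y) - (∫ y, v y • k0 x y) + ∫ y, v y • kg x y := by
      rw [← integral_sub (I hv m1 b1 x) (I hv m0 b0 x), ← integral_add (J hv) (I hv mg bg x)]
      refine integral_congr_ae (Eventually.of_forall fun y => ?_)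
      simp only [smul_eq_mul]; ring
    rw [e1, e2]; ring
  simp_rw [key]
  have mS : ∀ {V : Euc d → ℝ} {k : Euc d → Euc d → ℝ} (_ : Measurable V) (_ : Measurable (Function.uncurry k)), Measurable fun x => ∫ y, V y • k x y := by
    intro V k hV hk
    have : StronglyMeasurable (Function.uncurry fun x y => V y • k x y) := ((hV.comp measurable_snd).smul hk).stronglyMeasurable
    exact this.integral_prod_right.measurable
  have mA := mS (V := fun y => W y - v y) (k := fun x y => k1 x y - k0 x y) (hWm.sub hvm) (m1.sub m0)
  have mB := mS (V := v) (k := fun x y => k1 x y - k0 x y + kg x y) hvm ((m1.sub m0).add mg)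
  refine (lintegral_mono fun x => (enorm_add_le _ _).trans (add_le_add_left (enorm_add_le _ _) _)).trans ?_
  rw [lintegral_add_left (by exact mA.enorm.add mB.enorm), lintegral_add_left mA.enorm]
  refine add_le_add_left (add_le_add ?_ ?_) _
  · exact schur (k := fun x y => k1 x y - k0 x y) (m1.sub m0).enorm (hWm.sub hvm).aemeasurable h1
  · exact schur (k := fun x y => k1 x y - k0 x y + kg x y) ((m1.sub m0).add mg).enorm hvm.aemeasurable h2

section step
variable {w : ℝ → Euc d → ℝ} {b : ℝ → Euc d → Euc d} {M S ω c c' T : ℝ}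

/-- averaged drift -/
def av (b : ℝ → Euc d → Euc d) (c c' : ℝ) (y : Euc d) : Euc d := ∫ τ in Set.Ioc c c', b τ y

theorem av_meas (hb : Measurable (Function.uncurry b)) : Measurable (av b c c') := by
  have : StronglyMeasurable (Function.uncurry fun y τ => b τ y) := (hb.comp measurable_swap).stronglyMeasurable
  exact this.integral_prod_right.measurable

theorem av_le (hM : ∀ τ y, ‖b τ y‖ ≤ M) (h : c ≤ c') (y : Euc d) : ‖av b c c' y‖ ≤ M * (c' - c) := by
  have := norm_setIntegral_le_of_norm_le_const (μ := volume) (s := Set.Ioc c c') (f := fun τ => b τ y) (C := M) (by simp) (fun τ _ => hM τ y)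
  simpa [av, Measure.real, h] using this

theorem stepC (hw : Measurable (Function.uncurry w)) (hb : Measurable (Function.uncurry b)) (hM : ∀ τ y, ‖b τ y‖ ≤ M)
    (h1 : c < c') (h2 : c' ≤ T) (hS : ∀ τ ∈ Set.Icc c c', ∫⁻ y, ‖w τ y‖ₑ ≤ ENNReal.ofReal S)
    (hω : ∀ τ ∈ Set.Ioc c c', ∫⁻ y, ‖w τ y - w c y‖ₑ ≤ ENNReal.ofReal ω) (hi : Integrable (w c)) :
    ∫⁻ x, ‖Duh (fun τ y => w τ y • b τ y) c c' T x - ∫ y, w c y • (inner ℝ (gradHeat d (T - c) (x - y)) (av b c c' y) : ℝ)‖ₑ ≤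
      ENNReal.ofReal (4 * c1 d * M * S * (c' - c) ^ (1 / 4 : ℝ) * ((c' - c) * (T - c) ^ (-(3 / 4 : ℝ)))) +
      ENNReal.ofReal (c0 d * M * ω * ((c' - c) * (T - c) ^ (-(1 / 2 : ℝ)))) := by
  have hκ : 0 < T - c := by linarith
  have hh : 0 < c' - c := by linarith
  have M0 : 0 ≤ M := (norm_nonneg _).trans (hM 0 0)
  have c0p := c0_pos d
  have c1p := c1_pos d
  have hwc : Measurable (w c) := hw.comp (measurable_const.prodMk measurable_id)
  have hF : Measurable (Function.uncurry fun τ y => w τ y • b τ y) := hw.smul hb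
  have hFb : ∀ τ ∈ Set.Ioc c c', ∫⁻ y, ‖w τ y • b τ y‖ₑ ≤ ENNReal.ofReal M * ENNReal.ofReal S := fun τ hτ => by
    refine le_trans ?_ (mul_le_mul_right (hS τ ⟨hτ.1.le, hτ.2⟩) _)
    rw [← lintegral_const_mul' _ _ ENNReal.ofReal_ne_top]
    refine lintegral_mono fun y => ?_
    dsimp only
    rw [enorm_smul, mul_comm, ← ofReal_norm (b τ y)]
    gcongr; exact hM _ _
  have hDM : ∫⁻ x, DM (fun τ y => w τ y • b τ y) c c' T x ≠ ⊤ := by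
    refine ne_top_of_le_ne_top ?_ ((DM_l1 hF h2).trans (setLIntegral_mono' measurableSet_Ioc fun τ hτ => mul_le_mul_right (hFb τ hτ) _))
    rw [lintegral_mul_const' _ _ (by finiteness)]
    refine ENNReal.mul_ne_top ?_ (by finiteness)
    refine ne_top_of_le_ne_top ?_ (lintegral_mono_set (Set.Ioc_subset_Ioc_right h2))
    simp_rw [ENNReal.ofReal_mul c0p.le]
    rw [lintegral_const_mul' _ _ (by finiteness), ti_right (by norm_num) (by linarith)]
    finiteness
  have hae := ae_lt_top (DM_meas hF c c' T) hDM
  obtain ⟨Cg, hCg⟩ := gradHeat_bdd (d := d) hκ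
  have mφ2 : Measurable fun p : Euc d × (ℝ × Euc d) => (inner ℝ (gradHeat d (T - c) (p.1 - p.2.2)) (w c p.2.2 • b p.2.1 p.2.2) : ℝ) :=
    (gradHeat_meas2 measurable_const (by fun_prop)).inner ((hwc.comp (by fun_prop : Measurable fun p : Euc d × (ℝ × Euc d) => p.2.2)).smul (hb.comp measurable_snd))
  have i2 : ∀ x, Integrable (fun z : ℝ × Euc d => (inner ℝ (gradHeat d (T - c) (x - z.2)) (w c z.2 • b z.1 z.2) : ℝ)) (slab d c c') := by
    intro x
    refine Integrable.mono' ((hi.comp_snd (volume.restrict (Set.Ioc c c'))).norm.const_mul (Cg * M))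
      (mφ2.comp (measurable_const.prodMk measurable_id)).aestronglyMeasurable (Eventually.of_forall fun z => ?_)
    refine (norm_inner_le_norm _ _).trans ?_
    rw [norm_smul]
    calc _ ≤ Cg * (‖w c z.2‖ * M) := mul_le_mul (hCg _) (mul_le_mul_of_nonneg_left (hM _ _) (norm_nonneg _)) (by positivity) ((norm_nonneg _).trans (hCg 0))
      _ = _ := by ring
  have e2 : ∀ x, ∫ y, w c y • (inner ℝ (gradHeat d (T - c) (x - y)) (av b c c' y) : ℝ) =
      ∫ z, (inner ℝ (gradHeat d (T - c) (x - z.2)) (w c z.2 • b z.1 z.2) : ℝ) ∂(slab d c c') := by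
    intro x
    rw [integral_prod_symm _ (i2 x)]
    refine integral_congr_ae (Eventually.of_forall fun y => ?_)
    have ib : Integrable (fun τ => b τ y) (volume.restrict (Set.Ioc c c')) :=
      Integrable.mono' (integrable_const M) (hb.comp (measurable_id.prodMk measurable_const)).aestronglyMeasurable (Eventually.of_forall fun τ => hM τ y)
    simp only [real_inner_smul_right, smul_eq_mul]
    rw [integral_const_mul, integral_inner ib, av]
  have e3 : ∫⁻ x, ‖Duh (fun τ y => w τ y • b τ y) c c' T x - ∫ y, w c y • (inner ℝ (gradHeat d (T - c) (x - y)) (av b c c' y) : ℝ)‖ₑ =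
      ∫⁻ x, ‖∫ z, ((inner ℝ (gradHeat d (T - z.1) (x - z.2)) (w z.1 z.2 • b z.1 z.2) : ℝ) -
        (inner ℝ (gradHeat d (T - c) (x - z.2)) (w c z.2 • b z.1 z.2) : ℝ)) ∂(slab d c c')‖ₑ := by
    refine lintegral_congr_ae ?_
    filter_upwards [hae] with x hx
    rw [e2, Duh_eq hF hx.ne, integral_sub (Duh_int hF hx.ne) (i2 x)]
  rw [e3]
  have mφ1 : Measurable fun p : Euc d × (ℝ × Euc d) => (inner ℝ (gradHeat d (T - p.2.1) (p.1 - p.2.2)) (w p.2.1 p.2.2 • b p.2.1 p.2.2) : ℝ) :=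
    (gradHeat_meas2 (by fun_prop) (by fun_prop)).inner (hF.comp measurable_snd)
  have mw : Measurable (Function.uncurry fun τ y => ‖w τ y‖ₑ) := hw.enorm
  have mw' : Measurable (Function.uncurry fun τ y => ‖w τ y - w c y‖ₑ) := (hw.sub (hwc.comp measurable_snd)).enorm
  have mg1 : Measurable fun τ : ℝ => ENNReal.ofReal (c1 d * ((c' - c) ^ (1 / 4 : ℝ) * (T - τ) ^ (-(3 / 4 : ℝ))) * M) := by fun_prop
  refine (slab_schur (φ := fun x z => (inner ℝ (gradHeat d (T - z.1) (x - z.2)) (w z.1 z.2 • b z.1 z.2) : ℝ) -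
    (inner ℝ (gradHeat d (T - c) (x - z.2)) (w c z.2 • b z.1 z.2) : ℝ)) (ψ := fun z => ENNReal.ofReal (c1 d * ((c' - c) ^ (1 / 4 : ℝ) * (T - z.1) ^ (-(3 / 4 : ℝ))) * M) * ‖w z.1 z.2‖ₑ +
    ENNReal.ofReal (c0 d * (T - c) ^ (-(1 / 2 : ℝ)) * M) * ‖w z.1 z.2 - w c z.2‖ₑ) (mφ1.sub mφ2) ?_).trans ?_
  · filter_upwards [slab_lt (d := d) h2] with z hz
    have hu : 0 < T - z.1 := by linarith [hz.2]
    have bm : ‖b z.1 z.2‖ₑ ≤ ENNReal.ofReal M := by rw [← ofReal_norm]; exact ENNReal.ofReal_le_ofReal (hM _ _)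
    have gm : ∀ u, Measurable fun x => gradHeat d u (x - z.2) := fun u => gradHeat_meas2 measurable_const (by fun_prop)
    have p1 : ∀ x, ‖(inner ℝ (gradHeat d (T - z.1) (x - z.2)) (w z.1 z.2 • b z.1 z.2) : ℝ) - (inner ℝ (gradHeat d (T - c) (x - z.2)) (w c z.2 • b z.1 z.2) : ℝ)‖ₑ ≤
        ‖gradHeat d (T - z.1) (x - z.2) - gradHeat d (T - c) (x - z.2)‖ₑ * (ENNReal.ofReal M * ‖w z.1 z.2‖ₑ) +
        ‖gradHeat d (T - c) (x - z.2)‖ₑ * (ENNReal.ofReal M * ‖w z.1 z.2 - w c z.2‖ₑ) := by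
      intro x
      have : (inner ℝ (gradHeat d (T - z.1) (x - z.2)) (w z.1 z.2 • b z.1 z.2) : ℝ) - (inner ℝ (gradHeat d (T - c) (x - z.2)) (w c z.2 • b z.1 z.2) : ℝ) =
          inner ℝ (gradHeat d (T - z.1) (x - z.2) - gradHeat d (T - c) (x - z.2)) (w z.1 z.2 • b z.1 z.2) +
          inner ℝ (gradHeat d (T - c) (x - z.2)) ((w z.1 z.2 - w c z.2) • b z.1 z.2) := by
        rw [inner_sub_left, sub_smul, inner_sub_right]; ring
      rw [this]
      refine (enorm_add_le _ _).trans (add_le_add ?_ ?_)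
      all_goals
        refine (enorm_inner_le' _ _).trans (mul_le_mul_right ?_ _)
        rw [enorm_smul, mul_comm]
        gcongr
    refine (lintegral_mono p1).trans ?_
    have n1 : Measurable fun x => ‖gradHeat d (T - z.1) (x - z.2) - gradHeat d (T - c) (x - z.2)‖ₑ := ((gm _).sub (gm _)).enorm
    rw [lintegral_add_left (n1.mul_const _), lintegral_mul_const _ n1, lintegral_mul_const _ (gm _).enorm,
      lintegral_sub_right_eq_self (fun x => ‖gradHeat d (T - z.1) x - gradHeat d (T - c) x‖ₑ) z.2,
      lintegral_sub_right_eq_self (fun x => ‖gradHeat d (T - c) x‖ₑ) z.2, ← mul_assoc, ← mul_assoc,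
      ENNReal.ofReal_mul (by positivity), ENNReal.ofReal_mul (q := M) (by positivity)]
    gcongr
    · have := gradHeat_time (d := d) hu (η := z.1 - c) (by linarith [hz.1.1])
      rw [show T - z.1 + (z.1 - c) = T - c by ring] at this
      refine this.trans (ENNReal.ofReal_le_ofReal ?_)
      have := hz.1.1
      have := hz.1.2
      gcongr
    · exact gradHeat_lint hκ
  · rw [lintegral_add_left (by exact (mg1.comp measurable_fst).mul mw),
      slab_lint mg1 mw, slab_lint measurable_const mw']
    refine add_le_add ?_ ?_
    · refine (setLIntegral_mono' measurableSet_Ioc fun τ hτ => mul_le_mul_right (hS τ ⟨hτ.1.le, hτ.2⟩) _).trans ?_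
      have e : ∀ τ, ENNReal.ofReal (c1 d * ((c' - c) ^ (1 / 4 : ℝ) * (T - τ) ^ (-(3 / 4 : ℝ))) * M) * ENNReal.ofReal S =
          ENNReal.ofReal (c1 d * (c' - c) ^ (1 / 4 : ℝ) * M) * ENNReal.ofReal S * ENNReal.ofReal ((T - τ) ^ (-(3 / 4 : ℝ))) := by
        intro τ
        rw [show ∀ p q r m : ℝ, p * (q * r) * m = p * q * m * r by intros; ring, ENNReal.ofReal_mul (by positivity), mul_right_comm]
      simp_rw [e]
      rw [lintegral_const_mul' _ _ (by finiteness)]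
      refine (mul_le_mul_right (ti_mid h1 h2) _).trans ?_
      rw [mul_right_comm, ← ENNReal.ofReal_mul (by positivity), ← ENNReal.ofReal_mul (by positivity)]
      refine ENNReal.ofReal_le_ofReal (le_of_eq (by ring))
    · refine (setLIntegral_mono' measurableSet_Ioc fun τ hτ => mul_le_mul_right (hω τ hτ) _).trans ?_
      rw [setLIntegral_const, Real.volume_Ioc, ← ENNReal.ofReal_mul (by positivity), ← ENNReal.ofReal_mul' (by positivity)]
      refine ENNReal.ofReal_le_ofReal (le_of_eq (by ring))

theorem step (hw : Measurable (Function.uncurry w)) (hb : Measurable (Function.uncurry b)) (hM : ∀ τ y, ‖b τ y‖ ≤ M)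
    (h1 : c < c') (h2 : c' ≤ T) (hS : ∀ τ ∈ Set.Icc c c', ∫⁻ y, ‖w τ y‖ₑ ≤ ENNReal.ofReal S)
    (hω : ∀ τ ∈ Set.Ioc c c', ∫⁻ y, ‖w τ y - w c y‖ₑ ≤ ENNReal.ofReal ω) (hi : Integrable (w c)) {W : Euc d → ℝ} (hW : Integrable W)
    (hWm : Measurable W) :
    ∫⁻ x, ‖Es (T - c) (av b c c') W x - conv (heatKernel d (T - c)) W x + Duh (fun τ y => w τ y • b τ y) c c' T x‖ₑ ≤
      ENNReal.ofReal (c0 d * M * ((c' - c) * (T - c) ^ (-(1 / 2 : ℝ)))) * (∫⁻ y, ‖W y - w c y‖ₑ) +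
      ENNReal.ofReal (c1 d * M * S * ((M * (c' - c)) ^ 2) ^ (1 / 4 : ℝ) * ((c' - c) * (T - c) ^ (-(3 / 4 : ℝ)))) +
      (ENNReal.ofReal (4 * c1 d * M * S * (c' - c) ^ (1 / 4 : ℝ) * ((c' - c) * (T - c) ^ (-(3 / 4 : ℝ)))) +
      ENNReal.ofReal (c0 d * M * ω * ((c' - c) * (T - c) ^ (-(1 / 2 : ℝ))))) := by
  have hκ : 0 < T - c := by linarith
  have hh : 0 < c' - c := by linarith
  have M0 : 0 ≤ M := (norm_nonneg _).trans (hM 0 0)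
  have c0p := c0_pos d
  have c1p := c1_pos d
  have ha : Measurable (av b c c') := av_meas hb
  have hal := av_le (c := c) (c' := c') hM h1.le
  have hwc : Measurable (w c) := hw.comp (measurable_const.prodMk measurable_id)
  obtain ⟨Cg, hCg⟩ := gradHeat_bdd (d := d) hκ
  have Cg0 : 0 ≤ Cg := (norm_nonneg _).trans (hCg 0)
  have e3 : ∀ x, conv (heatKernel d (T - c)) W x = ∫ y, W y • heatKernel d (T - c) (x - y) := fun x => by
    unfold conv; simp_rw [smul_eq_mul, mul_comm]
  have := step_abs (k1 := fun x y => heatKernel d (T - c) (x - y - av b c c' y)) (k0 := fun x y => heatKernel d (T - c) (x - y))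
    (kg := fun x y => (inner ℝ (gradHeat d (T - c) (x - y)) (av b c c' y) : ℝ)) (Es_meas2 ha) ((hk_cont _).measurable.comp (by fun_prop))
    ((gradHeat_meas2 measurable_const (by fun_prop)).inner (ha.comp measurable_snd)) (C := (4 * π * (T - c)) ^ (-(d : ℝ) / 2) + Cg * (M * (c' - c)))
    (fun x y => (hkb hκ _).trans (le_add_of_nonneg_right (by positivity))) (fun x y => (hkb hκ _).trans (le_add_of_nonneg_right (by positivity)))
    (fun x y => ((norm_inner_le_norm _ _).trans (mul_le_mul (hCg _) (hal y) (norm_nonneg _) Cg0)).trans (le_add_of_nonneg_left (by positivity)))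
    (D := Duh (fun τ y => w τ y • b τ y) c c' T) hW hWm hi hwc
    (B1 := ENNReal.ofReal (c0 d * M * ((c' - c) * (T - c) ^ (-(1 / 2 : ℝ)))))
    (B2 := ENNReal.ofReal (c1 d * (((M * (c' - c)) ^ 2) ^ (1 / 4 : ℝ) * (T - c) ^ (-(3 / 4 : ℝ)))) * ENNReal.ofReal (M * (c' - c))) ?_ ?_
  · simp_rw [e3]
    refine this.trans (add_le_add (add_le_add_right ((mul_le_mul_right (hS c ⟨le_rfl, h1.le⟩) _).trans ?_) _) (stepC hw hb hM h1 h2 hS hω hi))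
    rw [← ENNReal.ofReal_mul (by positivity), ← ENNReal.ofReal_mul (by positivity)]
    refine ENNReal.ofReal_le_ofReal (le_of_eq (by ring))
  · intro y
    rw [lintegral_sub_right_eq_self (fun x => ‖heatKernel d (T - c) (x - av b c c' y) - heatKernel d (T - c) x‖ₑ) y]
    refine (hk_shift_lint hκ _).trans ?_
    rw [← ofReal_norm, ← ENNReal.ofReal_mul (by positivity)]
    refine ENNReal.ofReal_le_ofReal ?_
    calc _ ≤ c0 d * (T - c) ^ (-(1 / 2 : ℝ)) * (M * (c' - c)) := by gcongr; exact hal y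
      _ = _ := by ring
  · intro y
    rw [lintegral_sub_right_eq_self (fun x => ‖heatKernel d (T - c) (x - av b c c' y) - heatKernel d (T - c) x + (inner ℝ (gradHeat d (T - c) x) (av b c c' y) : ℝ)‖ₑ) y]
    exact hk_taylor hκ (hal y)

end step

end p11

section p12
variable {d : ℕ}

theorem sum34 {h : ℝ} (hh : 0 < h) (m : ℕ) : ∑ j ∈ Finset.range m, h * (((m:ℝ) - j) * h) ^ (-(3 / 4 : ℝ)) ≤ 4 * (m * h) ^ (1 / 4 : ℝ) := by
  induction m with
  | zero => simp
  | succ m ih =>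
    rw [Finset.sum_range_succ']
    push_cast
    simp only [add_sub_add_right_eq_sub, sub_zero]
    have hp : 0 < ((m:ℝ) + 1) * h := by positivity
    have hq : 0 ≤ (m:ℝ) * h := by positivity
    set p := (((m:ℝ) + 1) * h) ^ (1 / 4 : ℝ) with hpd
    set q := ((m:ℝ) * h) ^ (1 / 4 : ℝ) with hqd
    have p0 : 0 < p := by positivity
    have q0 : 0 ≤ q := by positivity
    have pq : q ≤ p := rpow_le_rpow hq (by nlinarith) (by norm_num)
    have p4 : p ^ 4 = ((m:ℝ) + 1) * h := by rw [hpd, ← rpow_natCast, ← rpow_mul hp.le]; norm_num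
    have q4 : q ^ 4 = (m:ℝ) * h := by rw [hqd, ← rpow_natCast, ← rpow_mul hq]; norm_num
    have e : (((m:ℝ) + 1) * h) ^ (-(3 / 4 : ℝ)) = (p ^ 3)⁻¹ := by
      rw [hpd, ← rpow_natCast, ← rpow_mul hp.le, ← rpow_neg hp.le]; norm_num
    have e2 : h = p ^ 4 - q ^ 4 := by rw [p4, q4]; ring
    have : h * (((m:ℝ) + 1) * h) ^ (-(3 / 4 : ℝ)) ≤ 4 * p - 4 * q := by
      rw [e, ← div_eq_mul_inv, div_le_iff₀ (by positivity), e2]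
      have : 0 ≤ (p - q) ^ 2 * (3 * p ^ 2 + 2 * p * q + q ^ 2) := by positivity
      nlinarith
    linarith

theorem gron {h L δ lam τ : ℝ} (hh : 0 < h) (hL : 0 ≤ L) (hδ : 0 ≤ δ) (hlam : 0 < lam) {m : ℕ} (hm : m * h ≤ τ)
    (hl : L * lam ^ (-(1 / 4 : ℝ)) * (4 * τ ^ (1 / 4 : ℝ)) ≤ 1 / 2) :
    ∑ j ∈ Finset.range m, (L * (h * (((m:ℝ) - j) * h) ^ (-(1 / 2 : ℝ))) * (8 * δ * τ ^ (1 / 4 : ℝ) * rexp (lam * (j * h))) +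
      δ * (h * (((m:ℝ) - j) * h) ^ (-(3 / 4 : ℝ)))) ≤ 8 * δ * τ ^ (1 / 4 : ℝ) * rexp (lam * (m * h)) := by
  have m0 : 0 ≤ (m:ℝ) * h := by positivity
  have τ0 : 0 ≤ τ := m0.trans hm
  have s1 := (sum34 hh m).trans (mul_le_mul_of_nonneg_left (rpow_le_rpow m0 hm (by norm_num : (0:ℝ) ≤ 1 / 4)) (by norm_num))
  set Q := 8 * δ * τ ^ (1 / 4 : ℝ) with hQ
  have Q0 : 0 ≤ Q := by positivity
  have E1 : 1 ≤ rexp (lam * (m * h)) := one_le_exp (by positivity)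
  calc _ ≤ ∑ j ∈ Finset.range m, (L * Q * rexp (lam * (m * h)) * lam ^ (-(1 / 4 : ℝ)) + δ) * (h * (((m:ℝ) - j) * h) ^ (-(3 / 4 : ℝ))) := by
        refine Finset.sum_le_sum fun j hj => ?_
        have hj : (j:ℝ) < m := by exact_mod_cast Finset.mem_range.1 hj
        have k0 : 0 < ((m:ℝ) - j) * h := mul_pos (by linarith) hh
        set κ := ((m:ℝ) - j) * h with hκ
        have e1 : rexp (lam * (j * h)) = rexp (lam * (m * h)) * rexp (-(lam * κ)) := by
          rw [← exp_add, hκ]; congr 1; ring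
        have e2 : rexp (-(lam * κ)) ≤ lam ^ (-(1 / 4 : ℝ)) * κ ^ (-(1 / 4 : ℝ)) := by
          rw [← mul_rpow hlam.le k0.le]
          have hx : 0 < lam * κ := by positivity
          set x := lam * κ
          rw [exp_neg, rpow_neg hx.le]
          refine inv_anti₀ (by positivity) ?_
          calc x ^ (1 / 4 : ℝ) ≤ (rexp x) ^ (1 / 4 : ℝ) := rpow_le_rpow hx.le (by linarith [add_one_le_exp x]) (by norm_num)
            _ ≤ (rexp x) ^ (1 : ℝ) := rpow_le_rpow_of_exponent_le (one_le_exp hx.le) (by norm_num)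
            _ = _ := rpow_one _
        have e3 : κ ^ (-(3 / 4 : ℝ)) = κ ^ (-(1 / 2 : ℝ)) * κ ^ (-(1 / 4 : ℝ)) := by rw [← rpow_add k0]; norm_num
        rw [add_mul]
        refine add_le_add ?_ le_rfl
        rw [e1]
        calc _ ≤ L * (h * κ ^ (-(1 / 2 : ℝ))) * (Q * (rexp (lam * (m * h)) * (lam ^ (-(1 / 4 : ℝ)) * κ ^ (-(1 / 4 : ℝ))))) := by gcongr
          _ = _ := by rw [e3]; ring
    _ = (L * Q * rexp (lam * (m * h)) * lam ^ (-(1 / 4 : ℝ)) + δ) * ∑ j ∈ Finset.range m, (h * (((m:ℝ) - j) * h) ^ (-(3 / 4 : ℝ))) := by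
        rw [Finset.mul_sum]
    _ ≤ (L * Q * rexp (lam * (m * h)) * lam ^ (-(1 / 4 : ℝ)) + δ) * (4 * τ ^ (1 / 4 : ℝ)) := by gcongr
    _ = Q * rexp (lam * (m * h)) * (L * lam ^ (-(1 / 4 : ℝ)) * (4 * τ ^ (1 / 4 : ℝ))) + Q / 2 := by rw [hQ]; ring
    _ ≤ Q * rexp (lam * (m * h)) * (1 / 2) + Q * rexp (lam * (m * h)) * (1 / 2) := by
        refine add_le_add (by gcongr) ?_
        nlinarith
    _ = _ := by ring

/-- Euler iterates -/
def Ws (h : ℝ) (A : ℕ → Euc d → Euc d) (W0 : Euc d → ℝ) : ℕ → Euc d → ℝ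
  | 0 => W0
  | j + 1 => Es h (A j) (Ws h A W0 j)

section ws
variable {h : ℝ} {A : ℕ → Euc d → Euc d} {W0 : Euc d → ℝ}

theorem Ws_meas (hA : ∀ j, Measurable (A j)) (hm : Measurable W0) : ∀ j, Measurable (Ws h A W0 j)
  | 0 => hm
  | j + 1 => Es_measurable (hA j) (Ws_meas hA hm j)

theorem Ws_int (hh : 0 < h) (hA : ∀ j, Measurable (A j)) (hm : Measurable W0) (hi : Integrable W0) : ∀ j, Integrable (Ws h A W0 j)
  | 0 => hi
  | j + 1 => Es_integrable hh (hA j) (Ws_int hh hA hm hi j) (Ws_meas hA hm j)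

theorem Ws_rep (hh : 0 < h) (hA : ∀ j, Measurable (A j)) (hm : Measurable W0) (hi : Integrable W0) (x : Euc d) : ∀ (m : ℕ) {u : ℝ}, 0 < u →
    conv (heatKernel d u) (Ws h A W0 m) x = conv (heatKernel d (u + m * h)) W0 x +
      ∑ j ∈ Finset.range m, (Es (u + ((m:ℝ) - j) * h) (A j) (Ws h A W0 j) x - conv (heatKernel d (u + ((m:ℝ) - j) * h)) (Ws h A W0 j) x)
  | 0, u, hu => by simp [Ws]
  | m + 1, u, hu => by
    have ih := Ws_rep hh hA hm hi x m (u := u + h) (by linarith)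
    rw [Finset.sum_range_succ, Ws, Es_conv hh hu (hA m) (Ws_int hh hA hm hi m) (Ws_meas hA hm m)]
    push_cast
    rw [show u + ((m:ℝ) + 1) * h = u + h + m * h by ring, show u + ((m:ℝ) + 1 - m) * h = u + h by ring]
    have e : ∀ j : ℕ, u + ((m:ℝ) + 1 - j) * h = u + h + ((m:ℝ) - j) * h := fun j => by ring
    simp_rw [e]
    linarith

theorem Ws_rep' (hh : 0 < h) (hA : ∀ j, Measurable (A j)) (hm : Measurable W0) (hi : Integrable W0) (x : Euc d) (m : ℕ) :
    Ws h A W0 (m + 1) x = conv (heatKernel d (((m + 1 : ℕ) : ℝ) * h)) W0 x +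
      ∑ j ∈ Finset.range (m + 1), (Es ((((m + 1 : ℕ) : ℝ) - j) * h) (A j) (Ws h A W0 j) x - conv (heatKernel d ((((m + 1 : ℕ):ℝ) - j) * h)) (Ws h A W0 j) x) := by
  have ih := Ws_rep hh hA hm hi x m hh
  rw [Finset.sum_range_succ, Ws]
  push_cast
  rw [show ((m:ℝ) + 1) * h = h + m * h by ring, show ((m:ℝ) + 1 - m) * h = h by ring]
  have e : ∀ j : ℕ, ((m:ℝ) + 1 - j) * h = h + ((m:ℝ) - j) * h := fun j => by ring
  simp_rw [e]
  linarith

end ws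

theorem Duh_meas' {F : ℝ → Euc d → Euc d} (hF : Measurable (Function.uncurry F)) (a c t : ℝ) : Measurable (Duh F a c t) := by
  have m : StronglyMeasurable fun p : (Euc d × ℝ) × Euc d => (inner ℝ (gradHeat d (t - p.1.2) (p.1.1 - p.2)) (F p.1.2 p.2) : ℝ) :=
    ((gradHeat_meas2 (by fun_prop) (by fun_prop)).inner (hF.comp (by fun_prop : Measurable fun p : (Euc d × ℝ) × Euc d => (p.1.2, p.2)))).stronglyMeasurable
  have m2 := m.integral_prod_right' (ν := (volume : Measure (Euc d)))
  have m3 := m2.integral_prod_right' (ν := volume.restrict (Set.Ioc a c))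
  exact m3.measurable

theorem DM_mono {F : ℝ → Euc d → Euc d} {a b c t : ℝ} (h : b ≤ c) (x : Euc d) : DM F a b t x ≤ DM F a c t x := by
  unfold DM slab
  gcongr

theorem Duh_sum {F : ℝ → Euc d → Euc d} (hF : Measurable (Function.uncurry F)) {s h T : ℝ} (hh : 0 < h) {x : Euc d} : ∀ m : ℕ,
    DM F s (s + m * h) T x ≠ ⊤ → Duh F s (s + m * h) T x = ∑ j ∈ Finset.range m, Duh F (s + j * h) (s + ((j + 1 : ℕ) : ℝ) * h) T x
  | 0, _ => by simp [Duh]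
  | m + 1, hx => by
    have h1 : s + m * h ≤ s + ((m + 1 : ℕ) : ℝ) * h := by push_cast; nlinarith
    have h0 : s ≤ s + m * h := by have : 0 ≤ m * h := by positivity
                                  linarith
    rw [Finset.sum_range_succ, ← Duh_sum hF hh m (ne_top_of_le_ne_top hx (DM_mono h1 x)), Duh_split hF h0 h1 hx]

/-- linear drift-diffusion on `[s,t]` -/
structure DS (w : ℝ → Euc d → ℝ) (b : ℝ → Euc d → Euc d) (M S s t : ℝ) : Prop where
  hw : Measurable (Function.uncurry w)
  hb : Measurable (Function.uncurry b)
  hM : ∀ τ y, ‖b τ y‖ ≤ M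
  hst : s < t
  S0 : 0 ≤ S
  hS : ∀ τ ∈ Set.Icc s t, ∫⁻ y, ‖w τ y‖ₑ ≤ ENNReal.ofReal S
  hmod : ∀ ε : ℝ, 0 < ε → ∃ δ : ℝ, 0 < δ ∧ ∀ t₁ t₂ : ℝ, s ≤ t₁ → t₁ ≤ t₂ → t₂ ≤ t → t₂ - t₁ ≤ δ → ∫⁻ x, ‖w t₂ x - w t₁ x‖ₑ ≤ ENNReal.ofReal ε
  hres : ∀ t' ∈ Set.Ioc s t, w t' =ᵐ[volume] fun x => conv (heatKernel d (t' - s)) (w s) x - Duh (fun τ y => w τ y • b τ y) s t' t' x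
  hDM : ∀ t' ∈ Set.Ioc s t, ∫⁻ x, DM (fun τ y => w τ y • b τ y) s t' t' x ≠ ⊤

section ds
variable {w : ℝ → Euc d → ℝ} {b : ℝ → Euc d → Euc d} {M S s t : ℝ}

theorem DS.mw (H : DS w b M S s t) (τ : ℝ) : Measurable (w τ) := H.hw.comp (measurable_const.prodMk measurable_id)

theorem DS.hi (H : DS w b M S s t) {τ : ℝ} (hτ : τ ∈ Set.Icc s t) : Integrable (w τ) :=
  ⟨(H.mw τ).aestronglyMeasurable, (H.hS τ hτ).trans_lt ENNReal.ofReal_lt_top⟩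

/-- drift steps -/
def Ad (b : ℝ → Euc d → Euc d) (s h : ℝ) (j : ℕ) : Euc d → Euc d := av b (s + j * h) (s + ((j + 1 : ℕ) : ℝ) * h)

theorem DS.err (H : DS w b M S s t) {n : ℕ} {h ω δ lam : ℝ} (hh : 0 < h) (hn : n * h = t - s) (δ0 : 0 ≤ δ) (hlam : 0 < lam)
    (hω : ∀ t₁ t₂ : ℝ, s ≤ t₁ → t₁ ≤ t₂ → t₂ ≤ t → t₂ - t₁ ≤ h → ∫⁻ x, ‖w t₂ x - w t₁ x‖ₑ ≤ ENNReal.ofReal ω) (ω0 : 0 ≤ ω)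
    (hδ : c1 d * M * S * ((M * h) ^ 2) ^ (1 / 4 : ℝ) + 4 * c1 d * M * S * h ^ (1 / 4 : ℝ) + c0 d * M * ω * (t - s) ^ (1 / 4 : ℝ) ≤ δ)
    (hl : c0 d * M * lam ^ (-(1 / 4 : ℝ)) * (4 * (t - s) ^ (1 / 4 : ℝ)) ≤ 1 / 2) (m : ℕ) (hm : m ≤ n) :
    ∫⁻ x, ‖Ws h (Ad b s h) (w s) m x - w (s + m * h) x‖ₑ ≤ ENNReal.ofReal (8 * δ * (t - s) ^ (1 / 4 : ℝ) * rexp (lam * (m * h))) := by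
  have c0p := c0_pos d
  have c1p := c1_pos d
  have hst := H.hst
  have S0 := H.S0
  have M0 : 0 ≤ M := (norm_nonneg _).trans (H.hM 0 0)
  have hA : ∀ j, Measurable (Ad b s h j) := fun j => av_meas H.hb
  have hF : Measurable (Function.uncurry fun τ y => w τ y • b τ y) := H.hw.smul H.hb
  have iw := H.hi ⟨le_rfl, hst.le⟩
  have hWm := Ws_meas (h := h) hA (H.mw s)
  have hWi := Ws_int hh hA (H.mw s) iw
  induction m using Nat.strong_induction_on with
  | _ m ih =>
  rcases m with _ | m
  · simp [Ws]
  have hmn : ((m + 1 : ℕ) : ℝ) * h ≤ t - s := by rw [← hn]; gcongr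
  have hmp : 0 < ((m + 1 : ℕ) : ℝ) * h := by positivity
  set T := s + ((m + 1 : ℕ) : ℝ) * h with hT
  have hTm : T ∈ Set.Ioc s t := ⟨by linarith, by linarith⟩
  have hκ : ∀ j : ℕ, T - (s + j * h) = (((m + 1 : ℕ) : ℝ) - j) * h := fun j => by rw [hT]; ring
  have hc : ∀ j : ℕ, (s + ((j + 1 : ℕ) : ℝ) * h) - (s + j * h) = h := fun j => by push_cast; ring
  have key : ∫⁻ x, ‖Ws h (Ad b s h) (w s) (m + 1) x - w T x‖ₑ = ∫⁻ x, ‖∑ j ∈ Finset.range (m + 1),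
      (Es (T - (s + j * h)) (Ad b s h j) (Ws h (Ad b s h) (w s) j) x - conv (heatKernel d (T - (s + j * h))) (Ws h (Ad b s h) (w s) j) x +
        Duh (fun τ y => w τ y • b τ y) (s + j * h) (s + ((j + 1 : ℕ) : ℝ) * h) T x)‖ₑ := by
    refine lintegral_congr_ae ?_
    filter_upwards [H.hres T hTm, ae_lt_top (DM_meas hF s T T) (H.hDM T hTm)] with x hx hx2
    rw [hx, Ws_rep' hh hA (H.mw s) iw, Finset.sum_add_distrib, ← Duh_sum hF hh (m + 1) hx2.ne]
    simp_rw [hκ]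
    rw [show T - s = ((m + 1 : ℕ) : ℝ) * h by rw [hT]; ring]
    congr 1; ring
  rw [key]
  refine (lintegral_mono fun x => enorm_sum_le _ _).trans ?_
  rw [lintegral_finsetSum _ fun j _ => by exact (((Es_measurable (hA j) (hWm j)).sub
    ((hconv_meas (hWm j).aemeasurable).comp (measurable_const.prodMk measurable_id))).add (Duh_meas' hF _ _ _)).enorm]
  refine le_trans ?_ (ENNReal.ofReal_le_ofReal (gron hh (by positivity : 0 ≤ c0 d * M) δ0 hlam hmn hl))
  have τ0 : 0 ≤ t - s := by linarith
  have kp : ∀ j ∈ Finset.range (m + 1), h ≤ (((m + 1 : ℕ) : ℝ) - j) * h := fun j hj => by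
    have : (j:ℝ) + 1 ≤ ((m + 1 : ℕ) : ℝ) := by exact_mod_cast Finset.mem_range.1 hj
    nlinarith
  rw [ENNReal.ofReal_sum_of_nonneg fun j hj => by have := hh.trans_le (kp j hj); positivity]
  refine Finset.sum_le_sum fun j hj => ?_
  have kj := kp j hj
  have hj := Finset.mem_range.1 hj
  have ihj := ih j hj (by omega)
  have jp : 0 ≤ (j:ℝ) * h := by positivity
  have e1 := hκ j
  have e2 := hc j
  set κ := (((m + 1 : ℕ) : ℝ) - j) * h with hκd
  have κt : κ ≤ t - s := by rw [hκd, sub_mul]; linarith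
  have κ0 : 0 < κ := by linarith
  have st := step (T := T) H.hw H.hb H.hM (c := s + j * h) (c' := s + ((j + 1 : ℕ) : ℝ) * h) (S := S) (ω := ω) (by linarith) (by linarith)
    (fun τ hτ => H.hS τ ⟨by linarith [hτ.1], by linarith [hτ.2, hTm.2]⟩)
    (fun τ hτ => hω _ _ (by linarith) hτ.1.le (by linarith [hτ.2, hTm.2]) (by linarith [hτ.2]))
    (H.hi ⟨by linarith, by linarith [hTm.2]⟩) (hWi j) (hWm j)
  rw [e1, e2] at st
  rw [e1]
  refine st.trans ?_
  rw [ENNReal.ofReal_add (by positivity) (by positivity), ENNReal.ofReal_mul (p := c0 d * M * (h * κ ^ (-(1 / 2 : ℝ)))) (by positivity), add_assoc]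
  refine add_le_add (mul_le_mul_right ihj _) ?_
  rw [← ENNReal.ofReal_add (by positivity) (by positivity), ← ENNReal.ofReal_add (by positivity) (by positivity)]
  refine ENNReal.ofReal_le_ofReal ?_
  have e3 : κ ^ (-(1 / 2 : ℝ)) ≤ (t - s) ^ (1 / 4 : ℝ) * κ ^ (-(3 / 4 : ℝ)) := by
    rw [show (-(1 / 2 : ℝ)) = 1 / 4 + -(3 / 4) by norm_num, rpow_add κ0]; gcongr
  calc _ ≤ c1 d * M * S * ((M * h) ^ 2) ^ (1 / 4 : ℝ) * (h * κ ^ (-(3 / 4 : ℝ))) + (4 * c1 d * M * S * h ^ (1 / 4 : ℝ) * (h * κ ^ (-(3 / 4 : ℝ))) +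
        c0 d * M * ω * (h * ((t - s) ^ (1 / 4 : ℝ) * κ ^ (-(3 / 4 : ℝ))))) := by gcongr
    _ = (c1 d * M * S * ((M * h) ^ 2) ^ (1 / 4 : ℝ) + 4 * c1 d * M * S * h ^ (1 / 4 : ℝ) + c0 d * M * ω * (t - s) ^ (1 / 4 : ℝ)) * (h * κ ^ (-(3 / 4 : ℝ))) := by ring
    _ ≤ _ := by gcongr

theorem DS.euler (H : DS w b M S s t) {ε : ℝ} (hε : 0 < ε) : ∃ (n : ℕ) (h : ℝ), 0 < h ∧ n * h = t - s ∧
    ∫⁻ x, ‖Ws h (Ad b s h) (w s) n x - w t x‖ₑ ≤ ENNReal.ofReal ε := by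
  have c0p := c0_pos d
  have M0 : 0 ≤ M := (norm_nonneg _).trans (H.hM 0 0)
  have τ0 : 0 < t - s := by linarith [H.hst]
  set τ := t - s with hτ
  set L := c0 d * M * (4 * τ ^ (1 / 4 : ℝ)) with hL
  have L0 : 0 ≤ L := by positivity
  set lam := (2 * L + 1) ^ 4 with hlam
  have lam0 : 0 < lam := by positivity
  have hl : c0 d * M * lam ^ (-(1 / 4 : ℝ)) * (4 * τ ^ (1 / 4 : ℝ)) ≤ 1 / 2 := by
    have : lam ^ (-(1 / 4 : ℝ)) = (2 * L + 1)⁻¹ := by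
      rw [rpow_neg lam0.le, hlam, ← rpow_natCast, ← rpow_mul (by positivity)]; norm_num
    rw [this, mul_right_comm, ← hL, ← div_eq_mul_inv, div_le_iff₀ (by positivity)]; linarith
  set δ := ε / (8 * τ ^ (1 / 4 : ℝ) * rexp (lam * τ)) with hδ
  have δ0 : 0 < δ := by positivity
  set ω := δ / 2 / (c0 d * M * τ ^ (1 / 4 : ℝ) + 1) with hω
  have ω0 : 0 < ω := by positivity
  obtain ⟨η, η0, hη⟩ := H.hmod ω ω0
  have t1 : Tendsto (fun n : ℕ => τ / (n : ℝ)) atTop (𝓝 0) := tendsto_const_div_atTop_nhds_zero_nat τ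
  have cf : ContinuousAt (fun h : ℝ => c1 d * M * S * ((M * h) ^ 2) ^ (1 / 4 : ℝ) + 4 * c1 d * M * S * h ^ (1 / 4 : ℝ)) 0 := by
    refine ContinuousAt.add (ContinuousAt.mul continuousAt_const (ContinuousAt.rpow_const (by fun_prop) (Or.inr (by norm_num))))
      (ContinuousAt.mul continuousAt_const (ContinuousAt.rpow_const (by fun_prop) (Or.inr (by norm_num))))
  have t2 := cf.tendsto.comp t1
  simp only [mul_zero, ne_eq, OfNat.ofNat_ne_zero, not_false_eq_true, zero_pow, one_div, inv_eq_zero, zero_rpow, add_zero] at t2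
  obtain ⟨n, h1, h2, h3⟩ := ((t1.eventually_le_const η0).and ((t2.eventually_le_const (half_pos δ0)).and (eventually_ge_atTop 1))).exists
  have n0 : (0:ℝ) < n := by exact_mod_cast h3
  refine ⟨n, τ / n, by positivity, by field_simp, ?_⟩
  have := H.err (n := n) (h := τ / n) (ω := ω) (δ := δ) (lam := lam) (by positivity) (by field_simp; rfl) δ0.le lam0
    (fun a b h4 h5 h6 h7 => hη a b h4 h5 h6 (h7.trans h1)) ω0.le ?_ hl n le_rfl
  · rw [show s + n * (τ / n) = t by field_simp; rw [hτ]; ring, show (n:ℝ) * (τ / n) = τ by field_simp] at this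
    refine this.trans (ENNReal.ofReal_le_ofReal (le_of_eq ?_))
    rw [hδ, ← hτ]; field_simp
  · have : c0 d * M * ω * τ ^ (1 / 4 : ℝ) ≤ δ / 2 := by
      rw [hω, mul_div_assoc', div_mul_eq_mul_div, div_le_iff₀ (by positivity)]; nlinarith
    simp only [Function.comp] at h2
    simp only [one_div] at this ⊢
    linarith

end ds

end p12

section p13
variable {d : ℕ}

/-- measurable with values in `[0,1]` -/
def B01 (f : Euc d → ℝ) : Prop := Measurable f ∧ ∀ x, 0 ≤ f x ∧ f x ≤ 1

/-- dual Euler step -/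
def Td (h : ℝ) (a : Euc d → Euc d) (f : Euc d → ℝ) (y : Euc d) : ℝ := ∫ x, f x * heatKernel d h (x - y - a y)

section td
variable {h : ℝ} {a : Euc d → Euc d} {f g : Euc d → ℝ}

theorem B01.nb (hf : B01 f) (x : Euc d) : ‖f x‖ ≤ 1 := by rw [norm_of_nonneg (hf.2 x).1]; exact (hf.2 x).2

theorem hk_tr_int (hh : 0 < h) (b : Euc d) : Integrable fun x => heatKernel d h (x - b) := (hk_integrable hh).comp_sub_right b

theorem hk_tr_integral (hh : 0 < h) (b : Euc d) : ∫ x, heatKernel d h (x - b) = 1 := by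
  rw [integral_sub_right_eq_self (fun x => heatKernel d h x) b, hk_integral hh]

theorem td_int (hh : 0 < h) (hf : B01 f) (b c : Euc d) : Integrable fun x => f x * heatKernel d h (x - b - c) := by
  simp_rw [sub_sub]
  exact (hk_tr_int hh _).bdd_mul (c := 1) hf.1.aestronglyMeasurable (Eventually.of_forall hf.nb)

theorem Td_mono (hh : 0 < h) (hf : B01 f) (hg : B01 g) (hfg : ∀ x, f x ≤ g x) (y : Euc d) : Td h a f y ≤ Td h a g y :=
  integral_mono (td_int hh hf _ _) (td_int hh hg _ _) fun x => mul_le_mul_of_nonneg_right (hfg x) (hk_pos hh _).le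

theorem Td_compl (hh : 0 < h) (hf : B01 f) (y : Euc d) : Td h a (fun x => 1 - f x) y = 1 - Td h a f y := by
  unfold Td
  conv_rhs => rw [← hk_tr_integral hh (y + a y), ← integral_sub (hk_tr_int hh _) (td_int hh hf _ _)]
  refine integral_congr_ae (Eventually.of_forall fun x => ?_)
  simp only [sub_mul, one_mul, sub_sub]

theorem B01.compl (hf : B01 f) : B01 fun x => 1 - f x :=
  ⟨measurable_const.sub hf.1, fun x => ⟨by linarith [(hf.2 x).2], by linarith [(hf.2 x).1]⟩⟩

theorem B01.sq (hf : B01 f) : B01 fun x => f x ^ 2 :=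
  ⟨hf.1.pow_const 2, fun x => ⟨sq_nonneg _, pow_le_one₀ (hf.2 x).1 (hf.2 x).2⟩⟩

theorem B01.smul (hf : B01 f) {c : ℝ} (c0 : 0 ≤ c) (c1 : c ≤ 1) : B01 fun x => c * f x :=
  ⟨hf.1.const_mul c, fun x => ⟨mul_nonneg c0 (hf.2 x).1, mul_le_one₀ c1 (hf.2 x).1 (hf.2 x).2⟩⟩

theorem Td_nonneg (hh : 0 < h) (hf : B01 f) (y : Euc d) : 0 ≤ Td h a f y :=
  integral_nonneg fun x => mul_nonneg (hf.2 x).1 (hk_pos hh _).le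

theorem Td_B01 (hh : 0 < h) (ha : Measurable a) (hf : B01 f) : B01 (Td h a f) := by
  refine ⟨?_, fun y => ⟨Td_nonneg hh hf y, ?_⟩⟩
  · have : StronglyMeasurable (Function.uncurry fun y x => f x * heatKernel d h (x - y - a y)) :=
      ((hf.1.comp measurable_snd).mul ((hk_cont h).measurable.comp (by fun_prop : Measurable fun p : Euc d × Euc d => p.2 - p.1 - a p.1))).stronglyMeasurable
    exact this.integral_prod_right.measurable
  · have := Td_nonneg (a := a) hh hf.compl y
    rw [Td_compl hh hf] at this; linarith

theorem Td_dual (hh : 0 < h) (ha : Measurable a) (hf : B01 f) {W : Euc d → ℝ} (hW : Integrable W) (hm : Measurable W) :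
    ∫ x, Es h a W x * f x = ∫ y, W y * Td h a f y := by
  unfold Es Td
  simp_rw [← integral_mul_const, ← integral_const_mul]
  rw [integral_integral_swap]
  · refine integral_congr_ae (Eventually.of_forall fun y => integral_congr_ae (Eventually.of_forall fun x => ?_))
    simp only [smul_eq_mul]; ring
  · have := (Es_prod hh ha hW hm).bdd_mul (c := 1) (hf.1.comp measurable_fst).aestronglyMeasurable (Eventually.of_forall fun p => hf.nb p.1)
    refine this.congr (Eventually.of_forall fun p => ?_)
    simp [Function.uncurry, mul_comm]

theorem Td_low (hh : 0 < h) {M : ℝ} (hM : ∀ y, ‖a y‖ ≤ M * h) (hf : B01 f) (y : Euc d) :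
    rexp (-(h * M ^ 2 / 2)) * Td h (fun _ => 0) f y ^ 2 ≤ Td h a (fun x => f x ^ 2) y := by
  set m := Td h (fun _ => 0) f y with hm
  set E := rexp (‖a y‖ ^ 2 / (2 * h)) with hE
  have E0 : 0 < E := exp_pos _
  have key : 2 * (m / E) * m ≤ Td h a (fun x => f x ^ 2) y + (m / E) ^ 2 * E * 1 := by
    rw [← hk_tr_integral hh (y - a y), ← integral_const_mul]
    nth_rewrite 2 [hm]
    rw [Td, Td, ← integral_const_mul, ← integral_add (td_int hh hf.sq _ _) ((hk_tr_int hh _).const_mul _)]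
    refine integral_mono ((td_int hh hf _ _).const_mul _) ((td_int hh hf.sq _ _).add ((hk_tr_int hh _).const_mul _)) fun x => ?_
    dsimp only
    have g := hk_girs hh (x - y) (a y)
    rw [sub_zero, show x - (y - a y) = x - y + a y by abel]
    have p0 := hk_pos hh (x - y)
    have p1 := hk_pos hh (x - y - a y)
    have p2 := hk_pos hh (x - y + a y)
    rw [← hE] at g
    set k0 := heatKernel d h (x - y)
    set k1 := heatKernel d h (x - y - a y)
    set k2 := heatKernel d h (x - y + a y)
    set l := m / E
    have s1 : √(k1 * (k2 * E)) = k0 := by rw [← mul_assoc, ← g, sqrt_sq p0.le]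
    rw [sqrt_mul p1.le] at s1
    have s2 := sq_sqrt p1.le
    have s3 := sq_sqrt (by positivity : 0 ≤ k2 * E)
    have e : (f x * √k1 - l * √(k2 * E)) ^ 2 = f x ^ 2 * (√k1 ^ 2) - 2 * l * (f x * (√k1 * √(k2 * E))) + l ^ 2 * (√(k2 * E) ^ 2) := by ring
    rw [s2, s3, s1] at e
    linarith [sq_nonneg (f x * √k1 - l * √(k2 * E))]
  have h2 : m ^ 2 / E ≤ Td h a (fun x => f x ^ 2) y := by
    have : (m / E) ^ 2 * E * 1 = m ^ 2 / E := by field_simp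
    have : 2 * (m / E) * m = 2 * (m ^ 2 / E) := by ring
    linarith
  refine le_trans ?_ h2
  rw [div_eq_mul_inv (m ^ 2), mul_comm, hE, ← exp_neg]
  refine mul_le_mul_of_nonneg_left (exp_le_exp.2 (neg_le_neg ?_)) (sq_nonneg m)
  rw [div_le_iff₀ (by positivity)]
  have := hM y
  have : ‖a y‖ ^ 2 ≤ (M * h) ^ 2 := by gcongr
  nlinarith

end td

/-- dual Euler iterates -/
def Pd (h : ℝ) (A : ℕ → Euc d → Euc d) : ℕ → (Euc d → ℝ) → Euc d → ℝ
  | 0, f => f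
  | n + 1, f => Pd h A n (Td h (A n) f)

section pd
variable {h : ℝ} {A : ℕ → Euc d → Euc d}

theorem Pd_B01 (hh : 0 < h) (hA : ∀ j, Measurable (A j)) : ∀ (n : ℕ) {f : Euc d → ℝ}, B01 f → B01 (Pd h A n f)
  | 0, _, hf => hf
  | n + 1, _, hf => Pd_B01 hh hA n (Td_B01 hh (hA n) hf)

theorem Pd_mono (hh : 0 < h) (hA : ∀ j, Measurable (A j)) : ∀ (n : ℕ) {f g : Euc d → ℝ}, B01 f → B01 g → (∀ x, f x ≤ g x) → ∀ y, Pd h A n f y ≤ Pd h A n g y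
  | 0, _, _, _, _, h, y => h y
  | n + 1, _, _, hf, hg, h, y => Pd_mono hh hA n (Td_B01 hh (hA n) hf) (Td_B01 hh (hA n) hg) (Td_mono hh hf hg h) y

theorem Pd_compl (hh : 0 < h) (hA : ∀ j, Measurable (A j)) : ∀ (n : ℕ) {f : Euc d → ℝ}, B01 f → ∀ y, Pd h A n (fun x => 1 - f x) y = 1 - Pd h A n f y
  | 0, _, _, _ => rfl
  | n + 1, f, hf, y => by
    have : Td h (A n) (fun x => 1 - f x) = fun y => 1 - Td h (A n) f y := funext (Td_compl hh hf)
    rw [Pd, this, Pd_compl hh hA n (Td_B01 hh (hA n) hf)]; rfl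

theorem Pd_smul (c : ℝ) : ∀ (n : ℕ) (f : Euc d → ℝ) (y : Euc d), Pd h A n (fun x => c * f x) y = c * Pd h A n f y
  | 0, _, _ => rfl
  | n + 1, f, y => by
    have : Td h (A n) (fun x => c * f x) = fun y => c * Td h (A n) f y := funext fun y => by
      unfold Td; rw [← integral_const_mul]; simp_rw [mul_assoc]
    rw [Pd, this, Pd_smul c n]; rfl

theorem Pd_dual (hh : 0 < h) (hA : ∀ j, Measurable (A j)) {W : Euc d → ℝ} (hW : Integrable W) (hm : Measurable W) : ∀ (n : ℕ) {f : Euc d → ℝ}, B01 f →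
    ∫ x, Ws h A W n x * f x = ∫ y, W y * Pd h A n f y
  | 0, _, _ => rfl
  | n + 1, f, hf => by
    rw [Pd, ← Pd_dual hh hA hW hm n (Td_B01 hh (hA n) hf), ← Td_dual hh (hA n) hf (Ws_int hh hA hm hW n) (Ws_meas hA hm n)]; rfl

theorem Pd_low (hh : 0 < h) (hA : ∀ j, Measurable (A j)) {M : ℝ} (hM : ∀ j y, ‖A j y‖ ≤ M * h) : ∀ (n : ℕ) {f : Euc d → ℝ}, B01 f → ∀ y,
    rexp (-(h * M ^ 2 / 2)) ^ n * Pd h (fun _ _ => 0) n f y ^ 2 ≤ Pd h A n (fun x => f x ^ 2) y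
  | 0, _, _, _ => by simp [Pd]
  | n + 1, f, hf, y => by
    have c1 : rexp (-(h * M ^ 2 / 2)) ≤ 1 := exp_le_one_iff.2 (neg_nonpos.2 (by positivity))
    have b1 := Td_B01 (a := fun _ => 0) hh measurable_const hf
    calc _ = rexp (-(h * M ^ 2 / 2)) * (rexp (-(h * M ^ 2 / 2)) ^ n * Pd h (fun _ _ => 0) n (Td h (fun _ => 0) f) y ^ 2) := by
          rw [Pd]; ring
      _ ≤ rexp (-(h * M ^ 2 / 2)) * Pd h A n (fun x => Td h (fun _ => 0) f x ^ 2) y := by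
          gcongr; exact Pd_low hh hA hM n b1 y
      _ = Pd h A n (fun x => rexp (-(h * M ^ 2 / 2)) * Td h (fun _ => 0) f x ^ 2) y := (Pd_smul _ n _ y).symm
      _ ≤ _ := Pd_mono hh hA n (b1.sq.smul (exp_pos _).le c1) (Td_B01 hh (hA n) hf.sq) (fun x => Td_low hh (hM n) hf x) y

theorem Ws_zero (hh : 0 < h) {W : Euc d → ℝ} (hW : Integrable W) (hm : Measurable W) (n : ℕ) (hn : n ≠ 0) (x : Euc d) :
    Ws h (fun _ _ => 0) W n x = conv (heatKernel d (n * h)) W x := by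
  obtain ⟨n, rfl⟩ := Nat.exists_eq_succ_of_ne_zero hn
  rw [Ws_rep' hh (fun _ => measurable_const) hm hW]
  have e : ∀ κ V, Es κ (fun _ : Euc d => 0) V x = conv (heatKernel d κ) V x := fun κ V => by
    unfold Es conv; simp_rw [smul_eq_mul, mul_comm, sub_zero]
  simp [e]

theorem Ws_contr (hh : 0 < h) (hA : ∀ j, Measurable (A j)) {M : ℝ} (hM : ∀ j y, ‖A j y‖ ≤ M * h) {W : Euc d → ℝ} (hW : Integrable W) (hm : Measurable W)
    (n : ℕ) (hn : n ≠ 0) : ∫ x, ‖Ws h A W n x‖ ≤ rexp (-(n * h * M ^ 2 / 2)) * (∫ x, ‖conv (heatKernel d (n * h)) W x‖) +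
      (1 - rexp (-(n * h * M ^ 2 / 2)) / 2) * ∫ x, ‖W x‖ := by
  have hV := Ws_int hh hA hm hW n
  have hVm := Ws_meas (h := h) hA hm n
  have hG : Integrable (Ws h (fun _ _ => 0) W n) := Ws_int hh (fun _ => measurable_const) hm hW n
  set V := Ws h A W n with hVd
  set C := rexp (-(n * h * M ^ 2 / 2)) with hC
  have hCn : rexp (-(h * M ^ 2 / 2)) ^ n = C := by rw [← exp_nat_mul, hC]; congr 1; ring
  have C0 : 0 < C := exp_pos _
  set f : Euc d → ℝ := Set.indicator {x | 0 ≤ V x} 1 with hf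
  have fB : B01 f := by
    refine ⟨measurable_one.indicator (measurableSet_le measurable_const hVm), fun x => ?_⟩
    by_cases hx : 0 ≤ V x <;> simp [hf, hx]
  have fsq : (fun x => f x ^ 2) = f := funext fun x => by by_cases hx : 0 ≤ V x <;> simp [hf, hx]
  have fsq' : (fun x => (1 - f x) ^ 2) = fun x => 1 - f x := funext fun x => by by_cases hx : 0 ≤ V x <;> simp [hf, hx]
  have zm : ∀ j : ℕ, Measurable ((fun _ _ => 0 : ℕ → Euc d → Euc d) j) := fun _ => measurable_const
  set p := Pd h A n f with hp
  set m := Pd h (fun _ _ => 0) n f with hmd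
  have pB : B01 p := Pd_B01 hh hA n fB
  have mB : B01 m := Pd_B01 hh zm n fB
  have l1 : ∀ y, C * m y ^ 2 ≤ p y := fun y => by have := Pd_low hh hA hM n fB y; rwa [hCn, fsq] at this
  have l2 : ∀ y, C * (1 - m y) ^ 2 ≤ 1 - p y := fun y => by
    have := Pd_low hh hA hM n fB.compl y
    rwa [hCn, fsq', Pd_compl hh hA n fB, Pd_compl hh zm n fB] at this
  have I : ∀ {U g : Euc d → ℝ}, Integrable U → B01 g → Integrable fun x => U x * g x := fun hU hg =>
    hU.mul_bdd (c := 1) hg.1.aestronglyMeasurable (Eventually.of_forall hg.nb)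
  have oneB : B01 fun _ : Euc d => (1:ℝ) := ⟨measurable_const, fun _ => ⟨zero_le_one, le_rfl⟩⟩
  have mass : ∀ {B : ℕ → Euc d → Euc d} (_ : ∀ j, Measurable (B j)), ∫ x, Ws h B W n x = ∫ x, W x := by
    intro B hB
    have h1 := Pd_dual hh hB hW hm n oneB
    have h0 : ∀ y, Pd h B n (fun _ => (1:ℝ)) y = 1 := by
      intro y
      have z0 := Pd_smul (h := h) (A := B) 0 n (fun _ => (1:ℝ)) y
      have z1 := Pd_compl hh hB n oneB y
      simp only [zero_mul, sub_self] at z0 z1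
      linarith
    simpa [h0] using h1
  have e1 : ∫ x, ‖V x‖ = ∫ y, W y * (2 * p y - 1) := by
    have a1 : ∫ x, ‖V x‖ = 2 * (∫ x, V x * f x) - ∫ x, V x := by
      rw [← integral_const_mul, ← integral_sub ((I hV fB).const_mul 2) hV]
      refine integral_congr_ae (Eventually.of_forall fun x => ?_)
      by_cases hx : 0 ≤ V x
      · simp [hf, hx, abs_of_nonneg]; ring
      · simp [hf, hx, abs_of_neg (not_le.1 hx)]
    rw [a1, hVd, Pd_dual hh hA hW hm n fB, mass hA, ← integral_const_mul, ← integral_sub ((I hW pB).const_mul 2) hW]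
    refine integral_congr_ae (Eventually.of_forall fun x => ?_)
    simp only [hp]; ring
  have e2 : ∫ y, W y * (2 * m y - 1) ≤ ∫ x, ‖conv (heatKernel d (n * h)) W x‖ := by
    have a1 : ∫ y, W y * (2 * m y - 1) = 2 * (∫ x, Ws h (fun _ _ => 0) W n x * f x) - ∫ x, Ws h (fun _ _ => 0) W n x := by
      rw [Pd_dual hh zm hW hm n fB, mass zm, ← integral_const_mul, ← integral_sub ((I hW mB).const_mul 2) hW]
      refine integral_congr_ae (Eventually.of_forall fun x => ?_)
      simp only [hmd]; ring
    rw [a1, ← integral_const_mul, ← integral_sub ((I hG fB).const_mul 2) hG]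
    simp_rw [← Ws_zero hh hW hm n hn]
    refine integral_mono (((I hG fB).const_mul 2).sub hG) hG.norm fun x => ?_
    by_cases hx : 0 ≤ V x
    · simp [hf, hx]; linarith [le_abs_self (Ws h (fun _ _ => 0) W n x)]
    · simp [hf, hx]; exact neg_le_abs _
  have iW : ∀ {g : Euc d → ℝ}, B01 g → Integrable fun x => W x * (2 * g x - 1) := fun {g} hg => by
    have := ((I hW hg).const_mul 2).sub hW
    refine this.congr (Eventually.of_forall fun x => ?_)
    simp only [Pi.sub_apply]; ring
  have e3 : ∫ y, W y * (2 * p y - 1) ≤ C * (∫ y, W y * (2 * m y - 1)) + (1 - C / 2) * ∫ x, ‖W x‖ := by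
    rw [← integral_const_mul, ← integral_const_mul, ← integral_add ((iW mB).const_mul C) (hW.norm.const_mul _)]
    refine integral_mono (iW pB) (((iW mB).const_mul C).add (hW.norm.const_mul _)) fun y => ?_
    dsimp only
    have q1 := l1 y
    have q2 := l2 y
    have : |(2 * p y - 1) - C * (2 * m y - 1)| ≤ 1 - C / 2 := by
      rw [abs_le]
      constructor <;> nlinarith [mul_nonneg C0.le (sq_nonneg (2 * m y - 1))]
    have h3 : W y * ((2 * p y - 1) - C * (2 * m y - 1)) ≤ ‖W y‖ * (1 - C / 2) := by
      refine (le_abs_self _).trans ?_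
      rw [abs_mul, Real.norm_eq_abs]
      gcongr
    linarith
  rw [e1]
  refine e3.trans ?_
  gcongr

end pd

end p13

section p14
variable {d : ℕ}

theorem l1_real {f : Euc d → ℝ} (hf : Integrable f) {r : ℝ} (hr : 0 ≤ r) : ∫⁻ x, ‖f x‖ₑ ≤ ENNReal.ofReal r ↔ ∫ x, ‖f x‖ ≤ r := by
  rw [← ofReal_integral_norm_eq_lintegral_enorm hf, ENNReal.ofReal_le_ofReal_iff hr]

theorem DS.contr {w : ℝ → Euc d → ℝ} {b : ℝ → Euc d → Euc d} {M S s t : ℝ} (H : DS w b M S s t) :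
    ∫ x, ‖w t x‖ ≤ rexp (-((t - s) * M ^ 2 / 2)) * (∫ x, ‖conv (heatKernel d (t - s)) (w s) x‖) +
      (1 - rexp (-((t - s) * M ^ 2 / 2)) / 2) * ∫ x, ‖w s x‖ := by
  refine le_of_forall_pos_le_add fun ε hε => ?_
  obtain ⟨n, h, hh, hn, he⟩ := H.euler hε
  have hs := H.hi (Set.left_mem_Icc.2 H.hst.le)
  have ht := H.hi (Set.right_mem_Icc.2 H.hst.le)
  have n0 : n ≠ 0 := by
    rintro rfl
    have := H.hst
    simp at hn; linarith
  have hA : ∀ j, Measurable (Ad b s h j) := fun j => av_meas H.hb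
  have hW := Ws_int hh hA (H.mw s) hs n
  have c := Ws_contr hh hA (M := M) (fun j y => by
    have := av_le (c := s + j * h) (c' := s + ((j + 1 : ℕ) : ℝ) * h) H.hM (by push_cast; nlinarith) y
    rwa [show s + ((j + 1 : ℕ) : ℝ) * h - (s + j * h) = h by push_cast; ring] at this) hs (H.mw s) n n0
  rw [hn] at c
  have hD : Integrable fun x => Ws h (Ad b s h) (w s) n x - w t x := hW.sub ht
  rw [l1_real hD hε.le] at he
  have : ∫ x, ‖w t x‖ ≤ (∫ x, ‖Ws h (Ad b s h) (w s) n x‖) + ∫ x, ‖Ws h (Ad b s h) (w s) n x - w t x‖ := by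
    rw [← integral_add hW.norm hD.norm]
    refine integral_mono ht.norm (hW.norm.add hD.norm) fun x => ?_
    have := norm_sub_le (Ws h (Ad b s h) (w s) n x) (Ws h (Ad b s h) (w s) n x - w t x)
    simpa using this
  linarith

section ls
variable {ρ₀ : Euc d → ℝ} {u : ℝ → Euc d → ℝ} {T A' : ℝ} {B : ℝ≥0∞}

theorem LS.toDS (hu : Measurable (Function.uncurry u)) (h : LS (FF u) ρ₀ u T B) (hA : 0 < A')
    (hg : ∀ t ∈ Set.Ioc 0 T, ∀ x, ‖gradc d (u t) x‖ ≤ A' * t ^ (-(1 / 2 : ℝ))) {L : ℝ} (L0 : 0 ≤ L) (hL : ∀ t ∈ Set.Ioc 0 T, ∫⁻ x, ‖u t x‖ₑ ≤ ENNReal.ofReal L)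
    {s t : ℝ} (hs : 0 < s) (hst : s < t) (ht : t ≤ T) :
    DS u (fun τ y => if τ ∈ Set.Ioc s t then gradc d (u τ) y else 0) (A' * s ^ (-(1 / 2 : ℝ))) L s t := by
  have hb : Measurable (Function.uncurry fun τ y => if τ ∈ Set.Ioc s t then gradc d (u τ) y else 0) :=
    Measurable.ite (measurable_fst measurableSet_Ioc) (gradc_meas hu) measurable_const
  have hM : ∀ τ (y : Euc d), ‖(if τ ∈ Set.Ioc s t then gradc d (u τ) y else 0)‖ ≤ A' * s ^ (-(1 / 2 : ℝ)) := fun τ y => by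
    split_ifs with hτ
    · refine (hg τ ⟨hs.trans hτ.1, hτ.2.trans ht⟩ y).trans ?_
      gcongr A' * ?_
      exact rpow_le_rpow_of_nonpos hs hτ.1.le (by norm_num)
    · rw [norm_zero]; positivity
  refine ⟨hu, hb, hM, hst, L0, fun τ hτ => hL τ ⟨hs.trans_le hτ.1, hτ.2.trans ht⟩, fun ε hε => ?_, fun t' ht' => ?_, fun t' ht' => ?_⟩
  · obtain ⟨δ, δ0, hδ⟩ := h.modulus hs hε
    exact ⟨δ, δ0, fun t₁ t₂ h1 h2 h3 h4 => hδ t₁ t₂ h1 h2 (h3.trans ht) h4⟩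
  · refine (h.restart hs ht'.1 (ht'.2.trans ht)).trans (Eventually.of_forall fun x => ?_)
    dsimp only
    congr 1
    refine Duh_congr (fun τ hτ => Eventually.of_forall fun y => ?_) _ _
    simp [FF, hτ.1, hτ.2.trans ht'.2]
  · obtain ⟨C, _, hC⟩ := DM_const (d := d) (r := 1) le_rfl (by rw [ka_one]; norm_num)
    have := hC (fun τ y => u τ y • (if τ ∈ Set.Ioc s t then gradc d (u τ) y else 0)) (hu.smul hb) s t'
      (ENNReal.ofReal L * ENNReal.ofReal (A' * s ^ (-(1 / 2 : ℝ)))) ht'.1.le (fun τ hτ => by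
        simp_rw [enorm_smul]
        refine (lintegral_mono fun y => mul_le_mul_right (?_ : _ ≤ ENNReal.ofReal (A' * s ^ (-(1 / 2 : ℝ)))) _).trans ?_
        · rw [← ofReal_norm]; exact ENNReal.ofReal_le_ofReal (hM τ y)
        · rw [lintegral_mul_const' _ _ ENNReal.ofReal_ne_top]
          gcongr
          exact hL τ ⟨hs.trans hτ.1, hτ.2.trans (ht'.2.trans ht)⟩)
    rw [NN_one] at this
    simp only [enorm_eq_self] at this
    exact (this.trans_lt (by finiteness)).ne

theorem LS.conv_bd {F : ℝ → Euc d → Euc d} (h : LS F ρ₀ u T B) {s t : ℝ} (hs : 0 < s) (hst : s < t) (ht : t ≤ T) :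
    ∫⁻ x, ‖conv (heatKernel d (t - s)) (u s) x‖ₑ ≤ (∫⁻ x, ‖ρ₀ x‖ₑ) + ENNReal.ofReal (2 * c0 d * ((t - s) ^ (-(1 / 2 : ℝ)) * s ^ (1 / 2 : ℝ))) * B := by
  have hsT : s ∈ Set.Ioc 0 T := ⟨hs, hst.le.trans ht⟩
  have e : ∀ x, conv (heatKernel d (t - s)) (u s) x = conv (heatKernel d t) ρ₀ x - Duh F 0 s t x := fun x => by
    rw [conv_congr (h.eq s hsT), hconv_sub (sub_pos.2 hst) (hconv_integrable hs h.r0) (h.int_Duh hsT),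
      hconv_semi (sub_pos.2 hst) hs h.r0, (Duh_conv h.mF hst (h.DMt hsT) x).1, sub_add_cancel]
  simp_rw [e]
  have hc := hconv_NN (d := d) (hs.trans hst) (r := 1) le_rfl h.r0.aemeasurable
  rw [NN_one, ka_one, neg_zero, rpow_zero, ENNReal.ofReal_one, one_mul] at hc
  calc _ ≤ ∫⁻ x, (‖conv (heatKernel d t) ρ₀ x‖ₑ + DM F 0 s t x) := lintegral_mono fun x =>
        enorm_sub_le.trans (add_le_add le_rfl (Duh_le h.mF _ _ _ _))
    _ = (∫⁻ x, ‖conv (heatKernel d t) ρ₀ x‖ₑ) + ∫⁻ x, DM F 0 s t x := by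
        rw [lintegral_add_right _ (by exact DM_meas h.mF _ _ _)]
    _ ≤ _ := by
        refine add_le_add hc ((DM_l1 h.mF hst.le).trans ?_)
        calc _ ≤ ∫⁻ τ in Set.Ioc 0 s, ENNReal.ofReal (c0 d * (t - s) ^ (-(1 / 2 : ℝ))) * B * ENNReal.ofReal (τ ^ (-(1 / 2 : ℝ))) := by
              refine setLIntegral_mono' measurableSet_Ioc fun τ hτ => ?_
              rw [mul_assoc]
              refine mul_le_mul' (ENNReal.ofReal_le_ofReal ?_) (h.bF τ ⟨hτ.1, hτ.2.trans hsT.2⟩)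
              have := (c0_pos (d := d)).le
              gcongr _ * ?_
              exact rpow_le_rpow_of_nonpos (sub_pos.2 hst) (by linarith [hτ.2]) (by norm_num)
          _ = _ := by
              rw [lintegral_const_mul _ (by fun_prop), ti_left (by norm_num) hs.le, mul_right_comm, ← ENNReal.ofReal_mul (by have := (c0_pos (d := d)).le; have := sub_pos.2 hst; positivity)]
              congr 2
              norm_num; ring

theorem mass_bd (hu : Measurable (Function.uncurry u)) (h : LS (FF u) ρ₀ u T B) (hA : 0 < A')
    (hg : ∀ t ∈ Set.Ioc 0 T, ∀ x, ‖gradc d (u t) x‖ ≤ A' * t ^ (-(1 / 2 : ℝ))) {ε : ℝ} (hε : 0 ≤ ε) (h0 : ∫⁻ x, ‖ρ₀ x‖ₑ ≤ ENNReal.ofReal ε) :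
    ∀ t ∈ Set.Ioc 0 T, ∫⁻ x, ‖u t x‖ₑ ≤ ENNReal.ofReal (2 * ε) := by
  obtain ⟨L, L0, hL⟩ := h.l1'
  intro t₀ ht₀
  obtain ⟨β, hβ⟩ : ∃ β : ℝ, β = B.toReal := ⟨_, rfl⟩
  have β0 : 0 ≤ β := hβ ▸ ENNReal.toReal_nonneg
  have hB : B = ENNReal.ofReal β := by rw [hβ, ENNReal.ofReal_toReal h.Bt]
  have c0p := c0_pos (d := d)
  set P : Set ℝ := (fun t => ∫ x, ‖u t x‖) '' Set.Ioc 0 T with hP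
  have bP : BddAbove P := by
    refine ⟨L, ?_⟩
    rintro _ ⟨t, ht, rfl⟩
    exact (l1_real (h.int ht) L0).1 (hL t ht)
  have nP : P.Nonempty := ⟨_, t₀, ht₀, rfl⟩
  have key : ∀ K : ℝ, 0 < K → sSup P ≤ 2 * (ε + 2 * c0 d / K * β) := by
    intro K hK
    set C := rexp (-(A' ^ 2 * K ^ 2 / 2)) with hC
    have C0 : 0 < C := exp_pos _
    have C1 : C ≤ 1 := exp_le_one_iff.2 (neg_nonpos.2 (by positivity))
    have : sSup P ≤ C * (ε + 2 * c0 d / K * β) + (1 - C / 2) * sSup P := by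
      refine csSup_le nP ?_
      rintro _ ⟨t, ht, rfl⟩
      dsimp only
      set s := t / (1 + K ^ 2) with hs
      have s0 : 0 < s := div_pos ht.1 (by positivity)
      have ts : t - s = K ^ 2 * s := by rw [hs]; field_simp; ring
      have st : s < t := by have : 0 < K ^ 2 * s := by positivity
                            linarith
      have sT : s ∈ Set.Ioc 0 T := ⟨s0, st.le.trans ht.2⟩
      have c := (h.toDS hu hA hg L0 hL s0 st ht.2).contr
      have hh : (s ^ (-(1 / 2 : ℝ))) ^ 2 = s⁻¹ := by
        rw [← rpow_natCast, ← rpow_mul s0.le]; norm_num [rpow_neg_one]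
      rw [show (t - s) * (A' * s ^ (-(1 / 2 : ℝ))) ^ 2 / 2 = A' ^ 2 * K ^ 2 / 2 by
        rw [ts, mul_pow, hh]; field_simp] at c
      refine c.trans (add_le_add (mul_le_mul_of_nonneg_left ?_ C0.le) (mul_le_mul_of_nonneg_left (le_csSup bP ⟨s, sT, rfl⟩) (by linarith)))
      rw [← l1_real (hconv_integrable (sub_pos.2 st) (h.int sT)) (by positivity)]
      refine (h.conv_bd s0 st ht.2).trans ?_
      rw [ENNReal.ofReal_add hε (by positivity), ENNReal.ofReal_mul (p := 2 * c0 d / K) (by positivity), hB]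
      refine add_le_add h0 (le_of_eq ?_)
      congr 2
      rw [ts, mul_rpow (by positivity) s0.le, mul_assoc (_ ^ _), ← rpow_add s0, ← rpow_natCast, ← rpow_mul hK.le]
      norm_num [rpow_neg_one]
      rfl
    nlinarith
  rw [l1_real (h.int ht₀) (by positivity)]
  refine (le_csSup bP ⟨t₀, ht₀, rfl⟩).trans ?_
  refine le_of_forall_pos_le_add fun δ hδ => ?_
  have k := key (4 * c0 d * β / δ + 1) (by positivity)
  have : 2 * c0 d / (4 * c0 d * β / δ + 1) * β ≤ δ / 2 := by
    rw [div_mul_eq_mul_div, div_le_iff₀ (by positivity)]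
    have : δ / 2 * (4 * c0 d * β / δ + 1) = 2 * c0 d * β + δ / 2 := by field_simp; ring
    linarith
  linarith

theorem XB.mono {A A₁ : ℝ} (h : XB u T A) (hA : A ≤ A₁) : XB u T A₁ := fun t ht =>
  (h t ht).trans (ENNReal.ofReal_le_ofReal (by have := ht.1; gcongr))

end ls

theorem small_norm (hd : 2 ≤ d) {η : ℝ} (hη : 0 < η) : ∃ ε₁ : ℝ, 0 < ε₁ ∧ ∀ (ρ₀ : Euc d → ℝ) (u : ℝ → Euc d → ℝ) (T A ε : ℝ), Integrable ρ₀ →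
    Measurable (Function.uncurry u) → 0 ≤ A → XB u T A → (∀ t ∈ Set.Ioc 0 T, u t =ᵐ[volume] mildRHS d ρ₀ u t) → 0 ≤ ε → ε ≤ ε₁ →
    ∫⁻ x, ‖ρ₀ x‖ₑ ≤ ENNReal.ofReal ε → XB u T η := by
  obtain ⟨K, K0, hK⟩ := sol_LS hd
  have kp := ka_pe hd
  obtain ⟨C, C0, hC⟩ := LS.restart_NN (d := d) (r := pe d) (pe_facts hd).1.le (by rw [kp]; norm_num)
  set D := C * K + 1 / η with hD
  have D0 : 0 < D := by positivity
  refine ⟨1 / (32 * D), by positivity, fun ρ₀ u T A ε h0 hu hA hX hm hε hε1 hρ => ?_⟩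
  have hLS := hK ρ₀ u T A h0 hu hA hX hm
  obtain ⟨A', A'0, hg⟩ := drift_bd hd hu hA hX hLS
  have mass := mass_bd hu hLS A'0 hg hε hρ
  have step : ∀ A, η ≤ A → XB u T A → XB u T (3 / 4 * A) := by
    intro A hηA hX t ht
    have A0 : 0 < A := hη.trans_le hηA
    have hLS := hK ρ₀ u T A h0 hu A0.le hX hm
    set q := 1 / (4 * D * A) with hq
    have q0 : 0 < q := by positivity
    have q1 : q ≤ 1 / 4 := by
      rw [hq]
      have : 1 ≤ D * A := by
        calc 1 = 1 / η * η := by field_simp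
          _ ≤ D * A := by gcongr; rw [hD]; have : 0 < C * K := by positivity
                          linarith
      rw [div_le_div_iff₀ (by positivity) (by norm_num)]; linarith
    have q4 : q ^ 4 ≤ 1 / 2 := by
      calc q ^ 4 ≤ (1 / 4) ^ 4 := by gcongr
        _ ≤ _ := by norm_num
    have t0 := ht.1
    set s := t - q ^ 4 * t with hs
    have ts : t - s = q ^ 4 * t := by rw [hs]; ring
    have s2 : t / 4 ≤ s := by rw [hs]; nlinarith
    have s0 : 0 < s := by linarith
    have st : s < t := by have : 0 < q ^ 4 * t := by positivity
                          linarith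
    have r1 := hC hLS s t s0 st ht.2
    have e1 : (q ^ 4 : ℝ) ^ (1 / 4 : ℝ) = q := by rw [← rpow_natCast, ← rpow_mul q0.le]; norm_num
    rw [kp, ts, show (1 / 2 - 1 / 4 : ℝ) = 1 / 4 by norm_num, mul_rpow (by positivity) t0.le, mul_rpow (by positivity) t0.le, rpow_neg (by positivity), e1] at r1
    refine (r1.trans (add_le_add (mul_le_mul_right (mass s ⟨s0, st.le.trans ht.2⟩) _) le_rfl)).trans ?_
    rw [← ENNReal.ofReal_mul (by positivity), ← ENNReal.ofReal_mul (by positivity), ← ENNReal.ofReal_mul (by positivity), ← ENNReal.ofReal_add (by positivity) (by positivity)]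
    refine ENNReal.ofReal_le_ofReal ?_
    have e2 : s ^ (-(1 / 2 : ℝ)) ≤ 2 * t ^ (-(1 / 2 : ℝ)) := by
      refine (rpow_le_rpow_of_nonpos (by positivity) s2 (by norm_num)).trans (le_of_eq ?_)
      rw [div_rpow t0.le (by norm_num), show (4:ℝ) = 2 ^ (2:ℝ) by norm_num, ← rpow_mul (by norm_num)]
      norm_num [rpow_neg_one]; ring
    have e3 : t ^ (1 / 4 : ℝ) * t ^ (-(1 / 2 : ℝ)) = t ^ (-(1 / 4 : ℝ)) := by rw [← rpow_add t0]; norm_num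
    have e4 : C * (q * t ^ (1 / 4 : ℝ)) * (K * A ^ 2 * s ^ (-(1 / 2 : ℝ))) ≤ A / 2 * t ^ (-(1 / 4 : ℝ)) := by
      calc _ ≤ C * (q * t ^ (1 / 4 : ℝ)) * (K * A ^ 2 * (2 * t ^ (-(1 / 2 : ℝ)))) := by gcongr
        _ = (2 * (C * K) * A ^ 2 * q) * t ^ (-(1 / 4 : ℝ)) := by rw [← e3]; ring
        _ ≤ _ := by
          gcongr
          have : 2 * (C * K) * A ^ 2 * q = C * K / D * (A / 2) := by rw [hq]; field_simp; ring
          rw [this]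
          have : C * K / D ≤ 1 := by rw [div_le_one D0, hD]; have : 0 < 1 / η := by positivity
                                     linarith
          nlinarith
    have e5 : q⁻¹ * t ^ (-(1 / 4 : ℝ)) * (2 * ε) ≤ A / 4 * t ^ (-(1 / 4 : ℝ)) := by
      rw [mul_right_comm]
      gcongr
      rw [hq, one_div, inv_inv]
      calc 4 * D * A * (2 * ε) ≤ 4 * D * A * (2 * (1 / (32 * D))) := by gcongr
        _ = _ := by field_simp; norm_num
    linarith
  have it : ∀ n : ℕ, XB u T (max η ((3 / 4) ^ n * A)) := by
    intro n
    induction n with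
    | zero => exact hX.mono (by simp)
    | succ n ih =>
      refine (step _ (le_max_left _ _) ih).mono ?_
      rw [mul_max_of_nonneg _ _ (by norm_num), pow_succ']
      exact max_le_max (by linarith) (by linarith)
  obtain ⟨n, hn⟩ := exists_pow_lt_of_lt_one (show 0 < η / (A + 1) by positivity) (show (3 / 4 : ℝ) < 1 by norm_num)
  refine (it n).mono (max_le le_rfl ?_)
  rw [lt_div_iff₀ (by positivity)] at hn
  have : 0 ≤ (3 / 4 : ℝ) ^ n := by positivity
  linarith

theorem uniq (hd : 2 ≤ d) : ∃ ε₁ : ℝ, 0 < ε₁ ∧ ∀ (ρ₀ : Euc d → ℝ) (u v : ℝ → Euc d → ℝ) (T A A' ε : ℝ), Integrable ρ₀ →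
    Measurable (Function.uncurry u) → Measurable (Function.uncurry v) → 0 ≤ A → 0 ≤ A' → XB u T A → XB v T A' →
    (∀ t ∈ Set.Ioc 0 T, u t =ᵐ[volume] mildRHS d ρ₀ u t) → (∀ t ∈ Set.Ioc 0 T, v t =ᵐ[volume] mildRHS d ρ₀ v t) → 0 ≤ ε → ε ≤ ε₁ →
    ∫⁻ x, ‖ρ₀ x‖ₑ ≤ ENNReal.ofReal ε → ∀ t ∈ Set.Ioc 0 T, u t =ᵐ[volume] v t := by
  obtain ⟨K, K0, hK⟩ := bil hd
  set η := 1 / (4 * K) with hη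
  have η0 : 0 < η := by positivity
  obtain ⟨ε₁, ε0, H⟩ := small_norm hd η0
  refine ⟨ε₁, ε0, fun ρ₀ u v T A A' ε h0 hu hv hA hA' hXu hXv mu mv hε hε1 hρ t ht => ?_⟩
  have p1 := (pe_facts hd).1
  have Xu := H ρ₀ u T A ε h0 hu hA hXu mu hε hε1 hρ
  have Xv := H ρ₀ v T A' ε h0 hv hA' hXv mv hε hε1 hρ
  have it : ∀ n : ℕ, XB (fun t x => u t x - v t x) T ((1 / 2) ^ n * (2 * η)) := by
    intro n
    induction n with
    | zero =>
      intro t ht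
      refine (NN_sub0 p1.le (meas_sl hu t).aemeasurable (meas_sl hv t).aemeasurable).trans ((add_le_add (Xu t ht) (Xv t ht)).trans ?_)
      have := ht.1
      rw [← ENNReal.ofReal_add (by positivity) (by positivity)]
      exact ENNReal.ofReal_le_ofReal (by linarith)
    | succ n ih =>
      have b := hK u v T η η _ hu hv η0.le η0.le (by positivity) Xu Xv ih
      intro t ht
      have e : (fun x => u t x - v t x) =ᵐ[volume] fun x => Duh (FF v) 0 t t x - Duh (FF u) 0 t t x := by
        filter_upwards [mu t ht, mv t ht] with x h1 h2
        rw [h1, h2, mildRHS_eq, mildRHS_eq]; ring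
      dsimp only
      rw [NN_congr e, NN_comm]
      refine (b t ht).trans (le_of_eq ?_)
      congr 2
      rw [hη, pow_succ]; field_simp; ring
  refine NN_zero' (by linarith) (meas_sl hu t).aemeasurable (meas_sl hv t).aemeasurable (le_antisymm ?_ zero_le)
  have lim : Tendsto (fun n : ℕ => ENNReal.ofReal ((1 / 2) ^ n * (2 * η) * t ^ (-(1 / 4 : ℝ)))) atTop (𝓝 0) := by
    have : Tendsto (fun n : ℕ => ((1 / 2 : ℝ) ^ n * (2 * η) * t ^ (-(1 / 4 : ℝ)))) atTop (𝓝 (0 * (2 * η) * t ^ (-(1 / 4 : ℝ)))) :=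
      ((tendsto_pow_atTop_nhds_zero_of_lt_one (by norm_num) (by norm_num)).mul_const _).mul_const _
    rw [zero_mul, zero_mul] at this
    have := (ENNReal.continuous_ofReal.tendsto 0).comp this
    rwa [ENNReal.ofReal_zero] at this
  exact ge_of_tendsto' lim fun n => it n t ht

end p14

section p15
variable {d : ℕ}

theorem FF_one {u : ℝ → Euc 1 → ℝ} {s : ℝ} (hu : Integrable (u s)) : FF u s =ᵐ[volume] FF (fun _ _ => 0) s := by
  have hf : ∫⁻ y, ‖u s y‖ₑ ≠ ⊤ := hu.2.ne
  filter_upwards [(Besicovitch.vitaliFamily (volume : Measure (Euc 1))).ae_tendsto_lintegral_div hu.1.enorm hf] with x hx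
  rw [FF_zero, FF]
  by_cases hi : Integrable fun y => (u s y / ‖x - y‖ ^ 2) • (x - y)
  swap
  · rw [gradc, integral_undef hi, smul_zero, smul_zero]
  have hG : ∫⁻ y, kk (x - y) * ‖u s y‖ₑ ≠ ⊤ := by
    simp_rw [← kk_enorm]; exact hi.2.ne
  have hx' := hx.comp (Besicovitch.tendsto_filterAt (volume : Measure (Euc 1)) x)
  obtain ⟨κ, κ0, κt, hv⟩ : ∃ κ : ℝ≥0∞, κ ≠ 0 ∧ κ ≠ ⊤ ∧ ∀ r : ℝ, volume (Metric.closedBall x r) = ENNReal.ofReal r * κ := by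
    refine ⟨ENNReal.ofReal (√π / Gamma (1 / 2 + 1)), ?_, ENNReal.ofReal_ne_top, fun r => ?_⟩
    · rw [Ne, ENNReal.ofReal_eq_zero, not_le]
      have := Gamma_pos_of_pos (show (0:ℝ) < 1 / 2 + 1 by norm_num)
      positivity
    · rw [EuclideanSpace.volume_closedBall]; simp
  have h0 : Tendsto (fun r : ℝ => volume (Metric.closedBall x r)) (𝓝[>] 0) (𝓝 0) := by
    simp_rw [hv]
    have h1 : Tendsto (fun r : ℝ => ENNReal.ofReal r) (𝓝[>] 0) (𝓝 0) := by
      have := (ENNReal.continuous_ofReal.tendsto 0).mono_left (nhdsWithin_le_nhds (s := Set.Ioi 0))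
      rwa [ENNReal.ofReal_zero] at this
    simpa using ENNReal.Tendsto.mul_const h1 (Or.inr κt)
  have h1 := ENNReal.Tendsto.div_const (tendsto_setLIntegral_zero hG h0) (b := κ) (Or.inr κ0)
  rw [ENNReal.zero_div] at h1
  have h2 : ‖u s x‖ₑ = 0 := by
    refine le_antisymm (le_of_tendsto_of_tendsto hx' h1 ?_) zero_le
    filter_upwards [self_mem_nhdsWithin] with r hr
    have hr : 0 < r := hr
    have r0 : ENNReal.ofReal r ≠ 0 := by simpa using hr
    dsimp only [Function.comp]
    rw [hv, ← ENNReal.mul_div_mul_left _ κ r0 ENNReal.ofReal_ne_top, ← lintegral_const_mul' _ _ ENNReal.ofReal_ne_top]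
    refine ENNReal.div_le_div_right ?_ _
    refine lintegral_mono_ae ?_
    have hne : ∀ᵐ y ∂(volume : Measure (Euc 1)), y ≠ x := by simp [ae_iff]
    filter_upwards [ae_restrict_mem Metric.isClosed_closedBall.measurableSet, ae_restrict_of_ae hne] with y hy hyx
    rw [← mul_assoc, kk, ← ENNReal.ofReal_mul hr.le]
    refine le_mul_of_one_le_left zero_le (ENNReal.one_le_ofReal.2 ?_)
    have n0 : 0 < ‖x - y‖ := norm_pos_iff.2 (sub_ne_zero.2 hyx.symm)
    rw [Metric.mem_closedBall, dist_comm, dist_eq_norm] at hy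
    rw [← div_eq_mul_inv, le_div_iff₀ n0, one_mul]; exact hy
  rw [enorm_eq_zero.1 h2, zero_smul]

theorem qd_eq (hd : 1 ≤ d) : qd d = ENNReal.ofReal (pe d) := by
  have : (1:ℝ) ≤ d := by exact_mod_cast hd
  rw [qd, pe, ENNReal.ofReal_div_of_pos (by linarith), ENNReal.ofReal_sub _ zero_le_one, ENNReal.ofReal_mul (by norm_num)]
  simp

theorem eL_NN (hd : 1 ≤ d) (f : Euc d → ℝ) : eLpNorm f (qd d) volume = NN (pe d) f := by
  have : (1:ℝ) ≤ d := by exact_mod_cast hd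
  have p0 : 0 < pe d := div_pos (by linarith) (by linarith)
  rw [qd_eq hd, eLpNorm_eq_lintegral_rpow_enorm_toReal (by simpa using p0) ENNReal.ofReal_ne_top, ENNReal.toReal_ofReal p0.le]
  rfl

theorem memXT (hd : 1 ≤ d) {F : ℝ → Euc d → Euc d} {ρ₀ : Euc d → ℝ} {u : ℝ → Euc d → ℝ} {T A : ℝ} {B : ℝ≥0∞} (h : LS F ρ₀ u T B) (_ : 0 ≤ A) (hX : XB u T A) : MemXT d T u := by
  obtain ⟨L, L0, hL⟩ := h.l1'
  refine ⟨fun t ht => memLp_one_iff_integrable.2 (h.int ht), fun t ht => ?_, ⟨ENNReal.ofReal L, ENNReal.ofReal_ne_top, fun t ht => ?_⟩, ENNReal.ofReal A, ENNReal.ofReal_ne_top, fun t ht => ?_⟩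
  · simp_rw [eLpNorm_one_eq_lintegral_enorm]; exact h.cont ht
  · rw [eLpNorm_one_eq_lintegral_enorm]; exact hL t ht
  · rw [eL_NN hd]
    have t0 := ht.1
    refine (mul_le_mul_right (hX t ht) _).trans (le_of_eq ?_)
    rw [← ENNReal.ofReal_mul (by positivity), mul_left_comm, ← rpow_add t0]; norm_num

theorem case_one {ρ₀ : Euc 1 → ℝ} (h0 : Integrable ρ₀) :
    ∃ ρ : ℝ → Euc 1 → ℝ, (∀ T : ℝ, 0 < T → IsMildSolution 1 ρ₀ T ρ ∧ MemXT 1 T ρ) ∧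
      ∀ ρ' : ℝ → Euc 1 → ℝ, (∀ T : ℝ, 0 < T → IsMildSolution 1 ρ₀ T ρ' ∧ MemXT 1 T ρ') → ∀ t : ℝ, 0 < t → ρ' t =ᵐ[volume] ρ t := by
  have key : ∀ (v : ℝ → Euc 1 → ℝ) (t : ℝ), (∀ s ∈ Set.Ioc 0 t, Integrable (v s)) → ∀ x, mildRHS 1 ρ₀ v t x = conv (heatKernel 1 t) ρ₀ x := fun v t hv x => by
    rw [mildRHS_eq, Duh_congr (fun s hs => FF_one (hv s hs)), Duh_zero, sub_zero]
  refine ⟨fun t => conv (heatKernel 1 t) ρ₀, fun T hT => ⟨fun t ht x => (key _ t (fun s hs => hconv_integrable hs.1 h0) x).symm, ?_⟩, fun ρ' h t ht => Eventually.of_forall fun x => ?_⟩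
  · have hL : LS (FF (fun _ (_ : Euc 1) => 0)) ρ₀ (fun t => conv (heatKernel 1 t) ρ₀) T 0 :=
      ⟨FF_meas measurable_const, h0, ENNReal.zero_ne_top, fun t ht => Eventually.of_forall fun x => by simp only [Duh_zero, sub_zero], fun s hs => by simp [FF_zero]⟩
    refine memXT le_rfl hL (A := (∫⁻ x, ‖ρ₀ x‖ₑ).toReal) ENNReal.toReal_nonneg fun t ht => ?_
    have p2 : pe 1 = 2 := by norm_num [pe]
    have := ht.1
    rw [p2]
    refine (hconv_NN ht.1 (by norm_num) h0.aemeasurable).trans (le_of_eq ?_)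
    rw [mul_comm, ENNReal.ofReal_mul ENNReal.toReal_nonneg, ENNReal.ofReal_toReal h0.2.ne, show ka 1 2 = 1 / 4 by norm_num [ka]]
  · rw [(h t ht).1 t ⟨ht, le_rfl⟩ x, key]
    exact fun s hs => memLp_one_iff_integrable.1 ((h t ht).2.1 s hs)

theorem case_two (hd : 2 ≤ d) : ∃ ε : ℝ, 0 < ε ∧ ∀ ρ₀ : Euc d → ℝ, Integrable ρ₀ → ∫⁻ x, ‖ρ₀ x‖ₑ ≤ ENNReal.ofReal ε →
    ∃ ρ : ℝ → Euc d → ℝ, (∀ T : ℝ, 0 < T → IsMildSolution d ρ₀ T ρ ∧ MemXT d T ρ) ∧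
      ∀ ρ' : ℝ → Euc d → ℝ, (∀ T : ℝ, 0 < T → IsMildSolution d ρ₀ T ρ' ∧ MemXT d T ρ') → ∀ t : ℝ, 0 < t → ρ' t =ᵐ[volume] ρ t := by
  have hd1 : 1 ≤ d := by omega
  obtain ⟨ε₀, e0, hex⟩ := existence hd
  obtain ⟨ε₁, e1, hun⟩ := uniq hd
  obtain ⟨K, K0, hK⟩ := sol_LS hd
  have εp : 0 < min ε₀ ε₁ := lt_min e0 e1
  refine ⟨min ε₀ ε₁, εp, fun ρ₀ h0 hρ => ?_⟩
  obtain ⟨ρ, mρ, sρ, Xρ⟩ := hex ρ₀ _ h0 εp.le (min_le_left _ _) hρ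
  refine ⟨ρ, fun T hT => ⟨fun t ht => sρ t ht.1, memXT hd1 (hK ρ₀ ρ T _ h0 mρ (by positivity) (Xρ T) fun t ht => Eventually.of_forall (sρ t ht.1)) (by positivity) (Xρ T)⟩, fun ρ' h t ht => ?_⟩
  obtain ⟨u, mu, hu⟩ := meas_rep (v := ρ') (fun t ht => memLp_one_iff_integrable.1 ((h t ht).2.1 t ⟨ht, le_rfl⟩)) (fun t ht => by
    have := (h (t + 1) (by linarith)).2.2.1 t ⟨ht, by linarith⟩
    rw [nhdsWithin_eq_nhds.2 (Ioc_mem_nhds ht (by linarith))] at this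
    simpa only [eLpNorm_one_eq_lintegral_enorm] using this)
  obtain ⟨C, Ct, hC⟩ := (h t ht).2.2.2.2
  have Xu : XB u t C.toReal := fun τ hτ => by
    have t0 := hτ.1
    have := hC τ hτ
    rw [eL_NN hd1, ← NN_congr (hu τ t0)] at this
    rw [ENNReal.ofReal_mul ENNReal.toReal_nonneg, ENNReal.ofReal_toReal Ct]
    calc _ = ENNReal.ofReal (τ ^ (1 / 4 : ℝ)) * NN (pe d) (u τ) * ENNReal.ofReal (τ ^ (-(1 / 4 : ℝ))) := by
          rw [mul_right_comm, ← ENNReal.ofReal_mul (by positivity), ← rpow_add t0]; norm_num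
      _ ≤ _ := by gcongr
  have su : ∀ τ ∈ Set.Ioc 0 t, u τ =ᵐ[volume] mildRHS d ρ₀ u τ := fun τ hτ => by
    filter_upwards [hu τ hτ.1] with x hx
    rw [hx, (h t ht).1 τ hτ x, mildRHS_eq, mildRHS_eq, Duh_congr fun s hs => FF_congr (hu s hs.1)]
  refine (hu t ht).symm.trans (hun ρ₀ u ρ t _ _ _ h0 mu mρ ENNReal.toReal_nonneg (by positivity) Xu (Xρ t) su (fun τ hτ => Eventually.of_forall (sρ τ hτ.1)) εp.le (min_le_right _ _) hρ t ⟨ht, le_rfl⟩)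

end p15
/-- for small `L¹` initial data, Assumption (𝒜) holds for every horizon `T`
and every exponent `q`; in particular there is a unique global mild solution. -/
theorem mPKS_small_mass_assumptionA_and_global_solution (d : ℕ) (hd : 1 ≤ d)
    (θ : ℝ) (hθ : 0 < θ) :
    (∃ ε : ℝ, 0 < ε ∧
      ∀ (ρ₀ : Euc d → ℝ), MemLp ρ₀ 1 volume → (∀ x, 0 ≤ ρ₀ x) →
        eLpNorm ρ₀ 1 volume ≤ ENNReal.ofReal ε →
        ∀ T : ℝ, 0 < T → AssumptionA d ρ₀ T θ) ∧
    (∃ ε : ℝ, 0 < ε ∧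
      ∀ (ρ₀ : Euc d → ℝ), MemLp ρ₀ 1 volume → (∀ x, 0 ≤ ρ₀ x) →
        eLpNorm ρ₀ 1 volume ≤ ENNReal.ofReal ε →
        ∃ ρ : ℝ → Euc d → ℝ,
          (∀ T : ℝ, 0 < T → IsMildSolution d ρ₀ T ρ ∧ MemXT d T ρ) ∧
          ∀ ρ' : ℝ → Euc d → ℝ,
            (∀ T : ℝ, 0 < T → IsMildSolution d ρ₀ T ρ' ∧ MemXT d T ρ') →
            ∀ t : ℝ, 0 < t → ρ' t =ᵐ[volume] ρ t) := by
  refine ⟨⟨θ, hθ, fun ρ₀ h1 _ h2 T _ => part1 ρ₀ h1 h2 T⟩, ?_⟩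
  rcases hd.eq_or_lt with rfl | hd2
  · exact ⟨1, one_pos, fun ρ₀ h1 _ _ => case_one (memLp_one_iff_integrable.1 h1)⟩
  · obtain ⟨ε, e0, H⟩ := case_two hd2
    refine ⟨ε, e0, fun ρ₀ h1 _ h2 => H ρ₀ (memLp_one_iff_integrable.1 h1) ?_⟩
    rwa [eLpNorm_one_eq_lintegral_enorm] at h2


end
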